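/- For fixed ρ > 0, limsup_{n→∞} ( n^{1/2} D_S ) ≤ ((1 − e^{−φ})/(5 g_S(ρ))) · ( √( 11 (κ_d^+)²/g_S(ρ)^{1/2} + 5 η_S(ρ)^{1/2} ) + 2 κ_d^+/g_S(ρ)^{1/4} )², where η_S(ρ) := lim_{n→∞} η_S(n,ρ). -/

import Mathlib

open MeasureTheory ProbabilityTheory Filter Set Metric
open scoped ENNReal NNReal BigOperators Topology Classical

noncomputable section

/-- Side length `n^(1/d)` of the cube `C_n` of volume `n` in dimension `d`. -/
def sideLen (d n : ℕ) : ℝ := (n : ℝ) ^ ((d : ℝ)⁻¹)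

/-- The cube `C_n = [0, L)^d`. -/
def box (d : ℕ) (L : ℝ) : Set (Fin d → ℝ) := Set.univ.pi fun _ => Set.Ico (0 : ℝ) L

/-- The Euclidean toroidal distance on the cube `[0, L)^d`. -/
def torDist {d : ℕ} (L : ℝ) (x y : Fin d → ℝ) : ℝ :=
  Real.sqrt (∑ i, (⨅ k : ℤ, |x i - y i - k * L|) ^ 2)

/-- The toroidal ball `B_r(x) = {y ∈ C_n : D(x,y) ≤ r}`. -/
def torBall {d : ℕ} (L : ℝ) (x : Fin d → ℝ) (r : ℝ) : Set (Fin d → ℝ) :=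
  {y ∈ box d L | torDist L x y ≤ r}

/-- Addition (translation) in the torus `[0, L)^d`. -/
def torAdd {d : ℕ} (L : ℝ) (y x : Fin d → ℝ) : Fin d → ℝ :=
  fun i => L * Int.fract ((y i + x i) / L)

/-- The uniform probability measure on the cube `[0, L)^d`. -/
def uniformBox (d : ℕ) (L : ℝ) : Measure (Fin d → ℝ) :=
  ((L.toNNReal ^ d)⁻¹ : ℝ≥0) • volume.restrict (box d L)

/-- The joint law of `n` independent points uniformly distributed on the cube `C_n`
of volume `n`; a point configuration is `ω : Fin n → (Fin d → ℝ)`, with `U_i = ω i`. -/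
def binppLaw (d n : ℕ) : Measure (Fin n → Fin d → ℝ) :=
  Measure.pi fun _ => uniformBox d (sideLen d n)

/-- The total covered volume `V` of the union of toroidal balls of radius `ρ`
centered at the `n` points. -/
def coveredVol (d n : ℕ) (ρ : ℝ) (ω : Fin n → Fin d → ℝ) : ℝ :=
  (volume (⋃ i, torBall (sideLen d n) (ω i) ρ)).toReal

/-- The number `S` of isolated points: indices `i` with `𝒰_n ∩ B_ρ(U_i) = {U_i}`. -/
def isolCount (d n : ℕ) (ρ : ℝ) (ω : Fin n → Fin d → ℝ) : ℝ :=
  ∑ i, if Set.range ω ∩ torBall (sideLen d n) (ω i) ρ = {ω i} then 1 else 0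

/-- `π_d`: the volume of the unit ball in `ℝ^d`. -/
def unitBallVol (d : ℕ) : ℝ :=
  (volume (Metric.closedBall (0 : EuclideanSpace ℝ (Fin d)) 1)).toReal

/-- `φ = π_d ρ^d`. -/
def phi (d : ℕ) (ρ : ℝ) : ℝ := unitBallVol d * ρ ^ d

/-- The standard normal cumulative distribution function. -/
def stdGaussCDF (t : ℝ) : ℝ := (gaussianReal 0 1 (Set.Iic t)).toReal

/-- The Kolmogorov distance `D_X` between the law of the standardized version of `X`
and the standard normal. -/
def kolDist {Ω : Type*} [MeasurableSpace Ω] (P : Measure Ω) (X : Ω → ℝ) : ℝ :=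
  ⨆ t : ℝ,
    |(P {ω | (X ω - ∫ x, X x ∂P) / Real.sqrt (variance X P) ≤ t}).toReal - stdGaussCDF t|

/-- A fixed unit vector in `ℝ^d` (junk value `0` if `d = 0`). -/
def unitVec (d : ℕ) : EuclideanSpace ℝ (Fin d) :=
  if h : 0 < d then EuclideanSpace.single (⟨0, h⟩ : Fin d) 1 else 0

/-- `ω_d(r)`: the volume of the union of two unit balls in `ℝ^d` whose centers are
at distance `r` apart. -/
def omegaVol (d : ℕ) (r : ℝ) : ℝ :=
  (volume (Metric.closedBall (0 : EuclideanSpace ℝ (Fin d)) 1 ∪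
      Metric.closedBall (r • unitVec d) 1)).toReal

/-- The integral `J_{r,d}(ρ) = d π_d ∫_0^r exp(-ρ^d ω_d(t)) t^{d-1} dt`. -/
def Jint (r : ℝ) (d : ℕ) (ρ : ℝ) : ℝ :=
  d * unitBallVol d * ∫ t in (0:ℝ)..r, Real.exp (-(ρ ^ d * omegaVol d t)) * t ^ (d - 1)

/-- The limiting variance density `g_V(ρ)`. -/
def gV (d : ℕ) (ρ : ℝ) : ℝ :=
  ρ ^ d * Jint 2 d ρ - (2 ^ d * phi d ρ + phi d ρ ^ 2) * Real.exp (-(2 * phi d ρ))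

/-- The limiting variance density `g_S(ρ)`. -/
def gS (d : ℕ) (ρ : ℝ) : ℝ :=
  Real.exp (-phi d ρ) - (1 + (2 ^ d - 2) * phi d ρ + phi d ρ ^ 2) * Real.exp (-(2 * phi d ρ))
    + ρ ^ d * (Jint 2 d ρ - Jint 1 d ρ)

/-- `κ_d`: the maximum number of closed unit balls in `ℝ^d` that can be packed so that
they all intersect a closed unit ball at the origin but are pairwise disjoint. -/
def kappa (d : ℕ) : ℕ :=
  sSup {k : ℕ | ∃ c : Fin k → EuclideanSpace ℝ (Fin d),
    (∀ i, (Metric.closedBall (c i) 1 ∩ Metric.closedBall 0 1).Nonempty) ∧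
    Pairwise fun i j => Disjoint (Metric.closedBall (c i) 1) (Metric.closedBall (c j) 1)}

/-- `η_V(n, ρ)`. -/
def etaV (d n : ℕ) (ρ : ℝ) : ℝ :=
  2 * phi d ρ ^ 2 * ((3 ^ d + 1) * phi d ρ + 1) ^ 2 *
      (1 + (2 ^ d + 1) * 6 ^ d * phi d ρ +
        ((2 * n - 6 ^ d * phi d ρ) / (n - 6 ^ d * phi d ρ)) * 6 ^ (2 * d) * phi d ρ ^ 2) +
    2 * phi d ρ ^ 4 *
      (3 * (4 ^ d + 2 ^ d) * phi d ρ +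
        3 * 4 ^ d * phi d ρ ^ 2 * ((2 * n - 3 * 2 ^ d * phi d ρ) / (n - 3 * 2 ^ d * phi d ρ)) +
        4 + 2 / n)

/-- `η_S(n, ρ)`. -/
def etaS (d n : ℕ) (ρ : ℝ) : ℝ :=
  2 * (1 + 2 * (kappa d : ℝ)) ^ 2 *
      (1 + (2 ^ d + 1) * 3 ^ d * phi d ρ +
        ((2 * n - 3 ^ d * phi d ρ) / (n - 3 ^ d * phi d ρ)) * 9 ^ d * phi d ρ ^ 2) +
    (((1 : ℝ) + kappa d) ^ 2 / 2) *
      ((2 ^ d + 2 * 3 ^ d + 3) * phi d ρ +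
        (2 ^ (d + 1) + 1) *
          ((2 * n - (2 ^ (d + 1) + 1) * phi d ρ) / (n - (2 ^ (d + 1) + 1) * phi d ρ)) *
          phi d ρ ^ 2 +
        (4 * n - 2) / (n - 1))

/-- Gaussian density. -/
def gd (x : ℝ) : ℝ := gaussianPDFReal 0 1 x

lemma gd_eq (x : ℝ) : gd x = (Real.sqrt (2 * Real.pi))⁻¹ * Real.exp (-(1/2) * x ^ 2) := by
  simp only [gd, gaussianPDFReal, NNReal.coe_one, mul_one, sub_zero]
  congr 2; ring

lemma gd_pos (x : ℝ) : 0 < gd x := gaussianPDFReal_pos 0 1 x one_ne_zero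

lemma gd_int : Integrable gd := integrable_gaussianPDFReal 0 1

lemma gd_total : ∫ x, gd x = 1 := integral_gaussianPDFReal_eq_one 0 one_ne_zero

lemma gd_deriv (x : ℝ) : HasDerivAt gd (-x * gd x) x := by
  have h : gd = fun x => (Real.sqrt (2 * Real.pi))⁻¹ * Real.exp (-(1/2) * x ^ 2) := funext gd_eq
  rw [h]
  have := (((hasDerivAt_pow 2 x).const_mul (-(1/2:ℝ))).exp).const_mul (Real.sqrt (2 * Real.pi))⁻¹
  refine this.congr_deriv ?_
  beta_reduce; push_cast; ring

lemma gd_cont : Continuous gd := continuous_iff_continuousAt.2 fun x => (gd_deriv x).continuousAt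

lemma sqrt_two_pi_inv_le : (Real.sqrt (2 * Real.pi))⁻¹ ≤ 0.4 := by
  have : (2.5:ℝ) ≤ Real.sqrt (2 * Real.pi) := by
    apply Real.le_sqrt_of_sq_le
    have := Real.pi_gt_d2
    linarith
  rw [inv_le_comm₀ (by positivity) (by norm_num)]
  linarith

lemma le_sqrt_two_pi_inv : 0.39 ≤ (Real.sqrt (2 * Real.pi))⁻¹ := by
  have : Real.sqrt (2 * Real.pi) ≤ 2.56 := by
    apply Real.sqrt_le_iff.2 ⟨by norm_num, ?_⟩
    have := Real.pi_lt_d2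
    linarith
  rw [le_inv_comm₀ (by norm_num) (by positivity)]
  refine this.trans (by norm_num)

lemma gd_le (x : ℝ) : gd x ≤ 0.4 := by
  rw [gd_eq]
  have h1 : Real.exp (-(1/2) * x ^ 2) ≤ 1 := Real.exp_le_one_iff.2 (by nlinarith [sq_nonneg x])
  calc _ ≤ (Real.sqrt (2 * Real.pi))⁻¹ * 1 := by gcongr
    _ ≤ _ := by rw [mul_one]; exact sqrt_two_pi_inv_le

lemma gd_mul_int : Integrable fun x => x * gd x := by
  have := (integrable_mul_exp_neg_mul_sq (b := 1/2) (by norm_num)).const_mul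
    (Real.sqrt (2 * Real.pi))⁻¹
  refine this.congr (ae_of_all _ fun x => ?_)
  simp only [gd_eq]; ring

lemma gd_tendsto_top : Tendsto gd atTop (𝓝 0) := by
  have h : gd = fun x => (Real.sqrt (2 * Real.pi))⁻¹ * Real.exp (-(1/2) * x ^ 2) := funext gd_eq
  rw [h]
  have : Tendsto (fun x : ℝ => Real.exp (-(1/2) * x ^ 2)) atTop (𝓝 0) := by
    apply Real.tendsto_exp_atBot.comp
    exact (tendsto_pow_atTop (two_ne_zero)).const_mul_atTop_of_neg (by norm_num)
  simpa using this.const_mul (Real.sqrt (2 * Real.pi))⁻¹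

lemma gd_tendsto_bot : Tendsto gd atBot (𝓝 0) := by
  have h : gd = fun x => gd (-x) := by funext x; simp [gd_eq]
  rw [h]
  exact gd_tendsto_top.comp tendsto_neg_atBot_atTop

lemma cdf_eq (t : ℝ) : stdGaussCDF t = ∫ x in Iic t, gd x := by
  unfold stdGaussCDF
  rw [gaussianReal_apply_eq_integral 0 one_ne_zero, ENNReal.toReal_ofReal]
  · rfl
  · exact setIntegral_nonneg measurableSet_Iic fun x _ => (gd_pos x).le

lemma cdf_compl (t : ℝ) : 1 - stdGaussCDF t = ∫ x in Ioi t, gd x := by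
  rw [cdf_eq, ← gd_total, ← integral_add_compl (measurableSet_Iic (a := t)) gd_int, compl_Iic]
  ring

lemma cdf_nonneg (t : ℝ) : 0 ≤ stdGaussCDF t := ENNReal.toReal_nonneg

lemma cdf_le_one (t : ℝ) : stdGaussCDF t ≤ 1 := by
  have : 0 ≤ 1 - stdGaussCDF t := by
    rw [cdf_compl]; exact setIntegral_nonneg measurableSet_Ioi fun x _ => (gd_pos x).le
  linarith

lemma cdf_sub_le {s t : ℝ} (h : s ≤ t) : stdGaussCDF t - stdGaussCDF s ≤ 0.4 * (t - s) := by
  rw [cdf_eq, cdf_eq, intervalIntegral.integral_Iic_sub_Iic gd_int.integrableOn gd_int.integrableOn]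
  calc ∫ x in s..t, gd x ≤ ∫ x in s..t, (0.4:ℝ) := by
        apply intervalIntegral.integral_mono_on h gd_cont.continuousOn.intervalIntegrable
          (by simp) fun x _ => gd_le x
    _ = _ := by simp; ring

lemma mills_pos (w : ℝ) : w * (1 - stdGaussCDF w) ≤ gd w := by
  have h1 : ∫ x in Ioi w, -x * gd x = 0 - gd w :=
    integral_Ioi_of_hasDerivAt_of_tendsto' (fun x _ => gd_deriv x)
      (by simpa [neg_mul] using gd_mul_int.neg.integrableOn) gd_tendsto_top
  rw [cdf_compl, ← integral_const_mul]
  have h2 : gd w = ∫ x in Ioi w, x * gd x := by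
    have : ∫ x in Ioi w, -x * gd x = - ∫ x in Ioi w, x * gd x := by
      rw [← integral_neg]; simp
    linarith
  rw [h2]
  apply setIntegral_mono_on (gd_int.const_mul w).integrableOn gd_mul_int.integrableOn
    measurableSet_Ioi
  intro x hx
  have := gd_pos x
  have : w < x := hx
  gcongr

lemma mills_neg (w : ℝ) : -w * stdGaussCDF w ≤ gd w := by
  have h1 : ∫ x in Iic w, -x * gd x = gd w - 0 :=
    integral_Iic_of_hasDerivAt_of_tendsto' (fun x _ => gd_deriv x)
      (by simpa [neg_mul] using gd_mul_int.neg.integrableOn) gd_tendsto_bot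
  rw [sub_zero] at h1
  rw [cdf_eq, ← integral_const_mul, ← h1]
  apply setIntegral_mono_on (gd_int.const_mul _).integrableOn
    (by simpa [neg_mul] using gd_mul_int.neg.integrableOn) measurableSet_Iic
  intro x hx
  have := gd_pos x
  have : x ≤ w := hx
  gcongr

lemma gd_lower {w : ℝ} (h : |w| ≤ 5/7) : 0.25 ≤ 1.4 * gd w := by
  rw [gd_eq]
  have h1 : w ^ 2 ≤ (5/7)^2 := by rw [← sq_abs]; gcongr
  have h2 := Real.add_one_le_exp (-(1/2) * w ^ 2)
  have h3 := le_sqrt_two_pi_inv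
  have h4 : (0.7:ℝ) ≤ Real.exp (-(1/2) * w ^ 2) := by
    refine le_trans ?_ h2; norm_num at h1 ⊢; linarith
  have : (0.39:ℝ) * 0.7 ≤ (Real.sqrt (2 * Real.pi))⁻¹ * Real.exp (-(1/2) * w ^ 2) := by gcongr
  norm_num at this ⊢; linarith

lemma cdf_mul_le (w : ℝ) : stdGaussCDF w * (1 - stdGaussCDF w) ≤ 1.4 * gd w := by
  have h0 := cdf_nonneg w
  have h1 := cdf_le_one w
  have m1 := mills_pos w
  have m2 := mills_neg w
  by_cases h : |w| ≤ 5/7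
  · have := gd_lower h
    norm_num at this ⊢
    nlinarith [sq_nonneg (stdGaussCDF w - 1/2)]
  · rcases lt_abs.1 (not_le.1 h) with h | h
    · have : 5/7 * (1 - stdGaussCDF w) ≤ gd w :=
        (mul_le_mul_of_nonneg_right h.le (by linarith)).trans m1
      norm_num
      nlinarith
    · have : 5/7 * (stdGaussCDF w) ≤ gd w :=
        (mul_le_mul_of_nonneg_right h.le (by linarith)).trans m2
      norm_num
      nlinarith

/-- Stein solution -/
def stN (h : ℝ → ℝ) : ℝ := ∫ x, h x * gd x
def stf (h : ℝ → ℝ) (w : ℝ) : ℝ := (∫ x in Iic w, (h x - stN h) * gd x) / gd w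
def stg (h : ℝ → ℝ) (w : ℝ) : ℝ := h w - stN h + w * stf h w

lemma st_int {h : ℝ → ℝ} (hc : Continuous h) (h0 : ∀ x, 0 ≤ h x) (h1 : ∀ x, h x ≤ 1) : Integrable fun x => h x * gd x := by
  refine gd_int.mono' (hc.mul gd_cont).aestronglyMeasurable (ae_of_all _ fun x => ?_)
  rw [Real.norm_eq_abs, abs_of_nonneg (mul_nonneg (h0 x) (gd_pos x).le)]
  nlinarith [h1 x, gd_pos x]

lemma st_int2 {h : ℝ → ℝ} (hc : Continuous h) (h0 : ∀ x, 0 ≤ h x) (h1 : ∀ x, h x ≤ 1) : Integrable fun x => (h x - stN h) * gd x := by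
  simp only [sub_mul]
  exact (st_int hc h0 h1).sub (gd_int.const_mul _)

lemma stf_deriv {h : ℝ → ℝ} (hc : Continuous h) (h0 : ∀ x, 0 ≤ h x) (h1 : ∀ x, h x ≤ 1) (w : ℝ) : HasDerivAt (stf h) (stg h w) w := by
  have hF : HasDerivAt (fun w => ∫ x in Iic w, (h x - stN h) * gd x) ((h w - stN h) * gd w) w := by
    have hi := st_int2 hc h0 h1
    have e : (fun w => ∫ x in Iic w, (h x - stN h) * gd x) = fun w =>
        (∫ x in Iic 0, (h x - stN h) * gd x) + ∫ x in (0:ℝ)..w, (h x - stN h) * gd x := by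
      funext w
      rw [← intervalIntegral.integral_Iic_sub_Iic hi.integrableOn hi.integrableOn]; ring
    rw [e]
    have hcc : Continuous fun x => (h x - stN h) * gd x := (hc.sub continuous_const).mul gd_cont
    exact (intervalIntegral.integral_hasDerivAt_right (hcc.intervalIntegrable _ _)
      (hcc.stronglyMeasurableAtFilter _ _) hcc.continuousAt).const_add _
  have := hF.div (gd_deriv w) (gd_pos w).ne'
  refine this.congr_deriv ?_
  unfold stg stf
  have := (gd_pos w).ne'
  field_simp
  ring

lemma st_G {h : ℝ → ℝ} (hc : Continuous h) (h0 : ∀ x, 0 ≤ h x) (h1 : ∀ x, h x ≤ 1) (w : ℝ) : ∫ x in Iic w, (h x - stN h) * gd x =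
    (1 - stdGaussCDF w) * (∫ x in Iic w, h x * gd x) - stdGaussCDF w * ∫ x in Ioi w, h x * gd x := by
  have hi := st_int hc h0 h1
  have : stN h = (∫ x in Iic w, h x * gd x) + ∫ x in Ioi w, h x * gd x := by
    rw [stN, ← integral_add_compl (measurableSet_Iic (a := w)) hi, compl_Iic]
  simp only [sub_mul]
  rw [integral_sub hi.integrableOn (gd_int.const_mul _).integrableOn, integral_const_mul, ← cdf_eq,
    this]
  ring

lemma st_a1 {h : ℝ → ℝ} (ha : Antitone h) (w : ℝ) (hi : Integrable fun x => h x * gd x) :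
    h w * stdGaussCDF w ≤ ∫ x in Iic w, h x * gd x := by
  rw [cdf_eq, ← integral_const_mul]
  exact setIntegral_mono_on (gd_int.const_mul _).integrableOn hi.integrableOn measurableSet_Iic
    fun x hx => mul_le_mul_of_nonneg_right (ha hx) (gd_pos x).le

lemma st_b1 {h : ℝ → ℝ} (ha : Antitone h) (w : ℝ) (hi : Integrable fun x => h x * gd x) :
    ∫ x in Ioi w, h x * gd x ≤ h w * (1 - stdGaussCDF w) := by
  rw [cdf_compl, ← integral_const_mul]
  exact setIntegral_mono_on hi.integrableOn (gd_int.const_mul _).integrableOn measurableSet_Ioi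
    fun x hx => mul_le_mul_of_nonneg_right (ha (le_of_lt hx)) (gd_pos x).le

lemma st_bounds {h : ℝ → ℝ} (hc : Continuous h) (h0 : ∀ x, 0 ≤ h x) (h1 : ∀ x, h x ≤ 1) (ha : Antitone h) (w : ℝ) : |stf h w| ≤ 1.4 ∧ |stg h w| ≤ 1 := by
  have hi := st_int hc h0 h1
  have e0 : stN h = (∫ x in Iic w, h x * gd x) + ∫ x in Ioi w, h x * gd x := by
    rw [stN, ← integral_add_compl (measurableSet_Iic (a := w)) hi, compl_Iic]
  have e1 := st_G hc h0 h1 w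
  have a1 := st_a1 ha w hi
  have b1 := st_b1 ha w hi
  have a2 : ∫ x in Iic w, h x * gd x ≤ stdGaussCDF w := by
    rw [cdf_eq]
    exact setIntegral_mono_on hi.integrableOn gd_int.integrableOn measurableSet_Iic
      fun x _ => mul_le_of_le_one_left (gd_pos x).le (h1 x)
  have b2 : 0 ≤ ∫ x in Ioi w, h x * gd x :=
    setIntegral_nonneg measurableSet_Ioi fun x _ => mul_nonneg (h0 x) (gd_pos x).le
  have hp := gd_pos w
  have c0 := cdf_nonneg w
  have c1 := cdf_le_one w
  have m1 := mills_pos w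
  have m2 := mills_neg w
  have m3 := cdf_mul_le w
  have H0 := h0 w
  have H1 := h1 w
  unfold stg stf
  rw [e1, e0]
  set a := ∫ x in Iic w, h x * gd x
  set b := ∫ x in Ioi w, h x * gd x
  set Φ := stdGaussCDF w
  set H := h w
  set g := gd w
  clear_value a b Φ H g
  have G0 : 0 ≤ (1 - Φ) * a - Φ * b := by
    nlinarith [mul_le_mul_of_nonneg_left a1 (sub_nonneg.2 c1), mul_le_mul_of_nonneg_left b1 c0]
  have G1 : (1 - Φ) * a - Φ * b ≤ Φ * (1 - Φ) := by
    nlinarith [mul_le_mul_of_nonneg_left a2 (sub_nonneg.2 c1), mul_nonneg c0 b2]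
  constructor
  · rw [abs_le]
    constructor
    · have : 0 ≤ ((1 - Φ) * a - Φ * b) / g := div_nonneg G0 hp.le
      norm_num at this ⊢; linarith
    · rw [div_le_iff₀ hp]; linarith
  · -- set r = w (1-Φ)/g, s = -w Φ / g
    obtain ⟨r, hr⟩ : ∃ r, r = w * (1 - Φ) / g := ⟨_, rfl⟩
    obtain ⟨s, hs⟩ : ∃ s, s = -w * Φ / g := ⟨_, rfl⟩
    have r1 : r ≤ 1 := by rw [hr, div_le_one hp]; exact m1
    have s1 : s ≤ 1 := by rw [hs, div_le_one hp]; exact m2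
    have key : H - (a + b) + w * (((1 - Φ) * a - Φ * b) / g) = H - (1 - r) * a - (1 - s) * b := by
      rw [hr, hs]; field_simp; ring
    have rs : r * Φ + s * (1 - Φ) = 0 := by rw [hr, hs]; field_simp; ring
    rw [key, abs_le]
    have k1 := mul_le_mul_of_nonneg_left a1 (sub_nonneg.2 r1)
    have k2 := mul_le_mul_of_nonneg_left a2 (sub_nonneg.2 r1)
    have k3 := mul_le_mul_of_nonneg_left b1 (sub_nonneg.2 s1)
    have k4 := mul_nonneg (sub_nonneg.2 s1) b2
    rcases le_total 0 w with hw | hw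
    · have r0 : 0 ≤ r := by rw [hr]; exact div_nonneg (mul_nonneg hw (by linarith)) hp.le
      have rP : r * Φ ≤ Φ := by nlinarith
      have rP0 : 0 ≤ r * Φ := by positivity
      constructor
      · nlinarith [mul_nonneg rP0 (sub_nonneg.2 H1), mul_nonneg c0 H0]
      · nlinarith [mul_nonneg (sub_nonneg.2 rP) H0]
    · have s0 : 0 ≤ s := by rw [hs]; exact div_nonneg (mul_nonneg (by linarith) c0) hp.le
      have sP : s * (1 - Φ) ≤ 1 - Φ := by nlinarith
      have sP0 : 0 ≤ s * (1 - Φ) := mul_nonneg s0 (by linarith)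
      constructor
      · nlinarith [mul_nonneg sP0 (sub_nonneg.2 H1), mul_nonneg c0 H0]
      · nlinarith [mul_nonneg sP0 H0, mul_nonneg c0 H0]



/-- ramp: `1` for `w ≤ z`, `0` for `w ≥ z + α`. -/
def ramp (z α w : ℝ) : ℝ := max 0 (min 1 ((z + α - w) / α))

lemma ramp_cont (z α : ℝ) : Continuous (ramp z α) := by unfold ramp; fun_prop
lemma ramp_nonneg (z α w : ℝ) : 0 ≤ ramp z α w := le_max_left _ _
lemma ramp_le_one (z α w : ℝ) : ramp z α w ≤ 1 := max_le zero_le_one (min_le_left _ _)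
lemma ramp_anti (z : ℝ) {α : ℝ} (hα : 0 < α) : Antitone (ramp z α) := by
  intro x y hxy; unfold ramp; gcongr
lemma ramp_left {z α w : ℝ} (hα : 0 < α) (h : w ≤ z) : ramp z α w = 1 := by
  unfold ramp
  rw [min_eq_left, max_eq_right zero_le_one]
  rw [le_div_iff₀ hα]; linarith
lemma ramp_right {z α w : ℝ} (hα : 0 < α) (h : z + α ≤ w) : ramp z α w = 0 := by
  unfold ramp
  apply max_eq_left
  apply (min_le_right _ _).trans
  apply div_nonpos_of_nonpos_of_nonneg <;> linarith
lemma ramp_lip {z α : ℝ} (hα : 0 < α) (x y : ℝ) : |ramp z α x - ramp z α y| ≤ |x - y| / α := by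
  unfold ramp
  refine (abs_max_sub_max_le_max _ _ _ _).trans ?_
  rw [sub_self, abs_zero]
  apply max_le (by positivity)
  refine (abs_min_sub_min_le_max _ _ _ _).trans ?_
  rw [sub_self, abs_zero]
  apply max_le (by positivity)
  rw [← sub_div, abs_div, abs_of_pos hα, abs_sub_comm]
  apply le_of_eq; congr 2; ring

/-- Remainder bound function. -/
def Rbd (z α b w : ℝ) : ℝ :=
  b ^ 2 / 2 * (2.4 - 1 + |w| + (1 / α) * (Icc (z - b) (z + α + b)).indicator 1 w)

lemma st_rem {z α b : ℝ} (hα : 0 < α) (w t : ℝ) (ht : |t| ≤ b) :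
    |stf (ramp z α) (w + t) - stf (ramp z α) w - stg (ramp z α) w * t| ≤ Rbd z α b w := by
  set h := ramp z α with hh
  have hc : Continuous h := ramp_cont z α
  have hd := stf_deriv hc (ramp_nonneg z α) (ramp_le_one z α)
  have hb := st_bounds hc (ramp_nonneg z α) (ramp_le_one z α) (ramp_anti z hα)
  set C := 1.4 + |w| + (1 / α) * (Icc (z - b) (z + α + b)).indicator (1 : ℝ → ℝ) w with hC
  have hlip : ∀ x y, |stf h x - stf h y| ≤ |x - y| := by
    intro x y
    have := Convex.norm_image_sub_le_of_norm_hasDerivWithin_le (f := stf h) (f' := stg h) (C := 1)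
      (s := univ) (x := y) (y := x) (fun u _ => (hd u).hasDerivWithinAt) (fun u _ => (hb u).2)
      convex_univ (mem_univ _) (mem_univ _)
    simpa using this
  have hram : ∀ s, |s| ≤ b → |h (w + s) - h w| ≤ |s| * ((1 / α) * (Icc (z - b) (z + α + b)).indicator (1 : ℝ → ℝ) w) := by
    intro s hs
    have hs' := abs_le.1 hs
    by_cases hw : w ∈ Icc (z - b) (z + α + b)
    · rw [indicator_of_mem hw]
      refine (ramp_lip hα _ _).trans (le_of_eq ?_)
      simp; ring
    · rw [indicator_of_notMem hw]
      have : h (w + s) = h w := by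
        rw [mem_Icc, not_and_or, not_le, not_le] at hw
        rcases hw with hw | hw
        · rw [hh, ramp_left hα (by linarith), ramp_left hα (by linarith)]
        · rw [hh, ramp_right hα (by linarith), ramp_right hα (by linarith)]
      simp [this]
  have hg : ∀ s, |s| ≤ b → |stg h (w + s) - stg h w| ≤ C * |s| := by
    intro s hs
    have e : stg h (w + s) - stg h w = (h (w + s) - h w) + s * stf h (w + s)
        + w * (stf h (w + s) - stf h w) := by unfold stg; ring
    rw [e]
    have h1 := hram s hs
    have h2 : |s * stf h (w + s)| ≤ |s| * 1.4 := by
      rw [abs_mul]; exact mul_le_mul_of_nonneg_left (hb _).1 (abs_nonneg _)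
    have h3 : |w * (stf h (w + s) - stf h w)| ≤ |w| * |s| := by
      rw [abs_mul]; apply mul_le_mul_of_nonneg_left _ (abs_nonneg _)
      simpa using hlip (w + s) w
    calc _ ≤ _ := abs_add_three _ _ _
      _ ≤ _ := add_le_add (add_le_add h1 h2) h3
      _ = _ := by rw [hC]; ring
  have hC0 : 0 ≤ C := by
    have : 0 ≤ (1 / α) * (Icc (z - b) (z + α + b)).indicator (1 : ℝ → ℝ) w :=
      mul_nonneg (by positivity) (indicator_nonneg (by simp) _)
    have := abs_nonneg w
    have h0 : (0:ℝ) ≤ 1.4 := by norm_num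
    rw [hC]
    linarith
  have main : ∀ ε : ℝ, |ε| = 1 → ∀ t, 0 ≤ t → t ≤ b →
      |stf h (w + ε * t) - stf h w - stg h w * (ε * t)| ≤ C * t ^ 2 / 2 := by
    intro ε hε t ht0 htb
    have hD : ∀ x, HasDerivAt (fun t => stf h (w + ε * t) - stf h w - stg h w * (ε * t))
        (ε * (stg h (w + ε * x) - stg h w)) x := by
      intro x
      have i1 : HasDerivAt (fun t => w + ε * t) ε x := by
        simpa using ((hasDerivAt_id x).const_mul ε).const_add w
      have i2 := (hd (w + ε * x)).comp x i1
      have i3 : HasDerivAt (fun t => stg h w * (ε * t)) (stg h w * ε) x := by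
        simpa using ((hasDerivAt_id x).const_mul ε).const_mul (stg h w)
      exact ((i2.sub_const (stf h w)).sub i3).congr_deriv (by ring)
    have := image_norm_le_of_norm_deriv_right_le_deriv_boundary (a := 0) (b := t)
      (f := fun t => stf h (w + ε * t) - stf h w - stg h w * (ε * t))
      (f' := fun x => ε * (stg h (w + ε * x) - stg h w)) (B := fun t => C * t ^ 2 / 2)
      (B' := fun t => C * t)
      (fun x _ => (hD x).continuousAt.continuousWithinAt)
      (fun x _ => (hD x).hasDerivWithinAt) (by simp)
      (fun x => by
        refine (((hasDerivAt_pow 2 x).const_mul C).div_const 2).congr_deriv ?_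
        push_cast; ring)
      (fun x hx => by
        have hx0 : |ε * x| = x := by rw [abs_mul, hε, one_mul, abs_of_nonneg hx.1]
        have := hg (ε * x) (by rw [hx0]; linarith [hx.2])
        rw [hx0] at this
        rw [Real.norm_eq_abs, abs_mul, hε, one_mul]
        exact this)
    exact this ⟨ht0, le_rfl⟩
  have fin : |stf h (w + t) - stf h w - stg h w * t| ≤ C * |t| ^ 2 / 2 := by
    rcases le_total 0 t with h0 | h0
    · have := main 1 (by simp) t h0 (by rwa [abs_of_nonneg h0] at ht)
      rw [abs_of_nonneg h0]; simpa using this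
    · have := main (-1) (by simp) (-t) (by linarith) (by rwa [abs_of_nonpos h0] at ht)
      rw [abs_of_nonpos h0]; simpa using this
  refine fin.trans ?_
  have : Rbd z α b w = C * b ^ 2 / 2 := by rw [hC, Rbd]; norm_num; ring
  rw [this]
  gcongr

lemma real_opt {δ c D b : ℝ} (hc : 0 < c) (hb : b ≤ 2 * c) (hD : 0 ≤ D)
    (h : ∀ α : ℝ, 0 < α → δ ≤ 0.4 * α + D + c * (2.4 + 0.4 + (0.8 * b + 2 * δ) / α)) :
    δ ≤ (Real.sqrt (0.8 * c) + Real.sqrt (4.4 * c + D)) ^ 2 := by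
  set p := 4.4 * c + D with hp
  have hp0 : 0 < p := by norm_num at hp; linarith
  set s := Real.sqrt (5 * c * p) with hs
  have hs0 : 0 < s := Real.sqrt_pos.2 (by positivity)
  have hs2 : s ^ 2 = 5 * c * p := Real.sq_sqrt (by positivity)
  have h1 := h (2 * c + s) (by positivity)
  have hα : 0 < 2 * c + s := by positivity
  have h2 : δ * s ≤ p * s + 0.4 * s ^ 2 + 2 * c * p := by
    have h3 : δ * (2 * c + s) ≤ (0.4 * (2 * c + s) + D + c * 2.8) * (2 * c + s)
        + c * (0.8 * b + 2 * δ) := by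
      have := mul_le_mul_of_nonneg_right h1 hα.le
      calc _ ≤ _ := this
        _ = _ := by field_simp; ring
    have h4 : c * b ≤ c * (2 * c) := by gcongr
    norm_num at *
    nlinarith
  have h5 : δ * s ≤ (p + 0.8 * s) * s := by
    have : 2 * c * p = 0.4 * s ^ 2 := by rw [hs2]; ring
    rw [this] at h2; linarith
  have h6 : δ ≤ p + 0.8 * s := le_of_mul_le_mul_right h5 hs0
  have h7 : Real.sqrt (0.8 * c) * Real.sqrt p = 0.4 * s := by
    rw [← Real.sqrt_mul (by positivity), hs]
    rw [show 0.8 * c * p = 0.4 ^ 2 * (5 * c * p) by ring, Real.sqrt_mul (by positivity),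
      Real.sqrt_sq (by norm_num)]
  rw [add_sq, Real.sq_sqrt hp0.le, Real.sq_sqrt (by positivity), mul_assoc, h7]
  norm_num at *
  linarith

lemma stein_bound {Ω : Type*} [MeasurableSpace Ω] (P : Measure Ω) [IsProbabilityMeasure P]
    (W T : Ω → ℝ) (hW : Measurable W) (hWi : Integrable W P) (hW1 : ∫ ω, |W ω| ∂P ≤ 1)
    (hTi : Integrable T P) {b l D : ℝ} (hb : 0 < b) (hl : 1 ≤ l * b)
    (hD : ∫ ω, |T ω - 1| ∂P ≤ D)
    (hS : ∀ f g R : ℝ → ℝ, Measurable f → Measurable g → Measurable R →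
      (∀ w t, |t| ≤ b → |f (w + t) - f w - g w * t| ≤ R w) →
      |∫ ω, W ω * f (W ω) ∂P - ∫ ω, g (W ω) * T ω ∂P| ≤ l * ∫ ω, R (W ω) ∂P) :
    (⨆ z, |P.real {ω | W ω ≤ z} - stdGaussCDF z|) ≤
      (Real.sqrt (0.8 * (l * b ^ 2 / 2)) + Real.sqrt (4.4 * (l * b ^ 2 / 2) + D)) ^ 2 := by
  have hl0 : 0 < l := by
    by_contra hn
    have : l * b ≤ 0 := mul_nonpos_of_nonpos_of_nonneg (not_lt.1 hn) hb.le
    linarith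
  have hD0 : 0 ≤ D := le_trans (integral_nonneg fun _ => abs_nonneg _) hD
  have hbdd : BddAbove (range fun z => |P.real {ω | W ω ≤ z} - stdGaussCDF z|) := by
    refine ⟨1, ?_⟩
    rintro _ ⟨z, rfl⟩
    have h1 : P.real {ω | W ω ≤ z} ≤ 1 := measureReal_le_one
    have h2 : 0 ≤ P.real {ω | W ω ≤ z} := measureReal_nonneg
    rw [abs_le]
    constructor <;> linarith [cdf_nonneg z, cdf_le_one z]
  set δ := ⨆ z, |P.real {ω | W ω ≤ z} - stdGaussCDF z| with hδ
  have hz : ∀ z, |P.real {ω | W ω ≤ z} - stdGaussCDF z| ≤ δ := fun z => le_ciSup hbdd z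
  have hlt : ∀ a, stdGaussCDF a - δ ≤ P.real {ω | W ω < a} := by
    intro a
    apply le_of_forall_pos_le_add
    intro ε hε
    have h1 : P.real {ω | W ω ≤ a - ε} ≤ P.real {ω | W ω < a} :=
      measureReal_mono fun ω (hω : W ω ≤ a - ε) => lt_of_le_of_lt hω (by linarith)
    have h2 := cdf_sub_le (show a - ε ≤ a by linarith)
    have h3 := (abs_le.1 (hz (a - ε))).1
    norm_num at h2
    linarith
  have hcc : ∀ a b', a ≤ b' → P.real (W ⁻¹' Icc a b') ≤ 0.4 * (b' - a) + 2 * δ := by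
    intro a b' hab
    have e : W ⁻¹' Icc a b' = {ω | W ω ≤ b'} \ {ω | W ω < a} := by
      ext ω; simp [and_comm]
    have hsub : {ω | W ω < a} ⊆ {ω | W ω ≤ b'} := fun ω (hω : W ω < a) => hω.le.trans hab
    have hm : MeasurableSet {ω | W ω < a} := hW measurableSet_Iio
    rw [e, measureReal_sdiff hsub hm]
    have h1 := hlt a
    have h2 := (abs_le.1 (hz b')).2
    have h3 := cdf_sub_le hab
    linarith
  have key : ∀ z α, 0 < α → |∫ ω, ramp z α (W ω) ∂P - stN (ramp z α)| ≤
      D + (l * b ^ 2 / 2) * (2.4 + 0.4 + (0.8 * b + 2 * δ) / α) := by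
    intro z α hα
    set h := ramp z α with hh
    have hc : Continuous h := ramp_cont z α
    have hd := stf_deriv hc (ramp_nonneg z α) (ramp_le_one z α)
    have hbb := st_bounds hc (ramp_nonneg z α) (ramp_le_one z α) (ramp_anti z hα)
    have mf : Measurable (stf h) :=
      (continuous_iff_continuousAt.2 fun x => (hd x).continuousAt).measurable
    have mg : Measurable (stg h) := by
      unfold stg; exact (hc.measurable.sub_const _).add (measurable_id.mul mf)
    have mI : Measurable ((Icc (z - b) (z + α + b)).indicator (1 : ℝ → ℝ)) :=
      measurable_one.indicator measurableSet_Icc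
    have mR : Measurable (Rbd z α b) := by
      unfold Rbd
      exact ((measurable_const.add measurable_norm).add (mI.const_mul _)).const_mul _
    have i1 := hS (stf h) (stg h) (Rbd z α b) mf mg mR (fun w t ht => st_rem hα w t ht)
    have gi : Integrable (fun ω => stg h (W ω)) P :=
      Integrable.of_bound (mg.comp hW).aestronglyMeasurable 1 (ae_of_all _ fun ω => (hbb _).2)
    have gTi : Integrable (fun ω => stg h (W ω) * T ω) P := by
      refine hTi.bdd_mul (c := 1) (mg.comp hW).aestronglyMeasurable (ae_of_all _ fun ω => (hbb _).2)
    have Wfi : Integrable (fun ω => W ω * stf h (W ω)) P := by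
      refine hWi.mul_bdd (c := 1.4) (mf.comp hW).aestronglyMeasurable (ae_of_all _ fun ω => (hbb _).1)
    have e : ∫ ω, h (W ω) ∂P - stN h =
        ∫ ω, stg h (W ω) * (1 - T ω) ∂P +
          (∫ ω, stg h (W ω) * T ω ∂P - ∫ ω, W ω * stf h (W ω) ∂P) := by
      have hi : Integrable (fun ω => h (W ω)) P :=
        Integrable.of_bound (hc.measurable.comp hW).aestronglyMeasurable 1
          (ae_of_all _ fun ω => by
            rw [Real.norm_eq_abs, abs_of_nonneg (ramp_nonneg _ _ _)]; exact ramp_le_one _ _ _)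
      have e1 : ∀ ω, stg h (W ω) * (1 - T ω) = h (W ω) - stN h + W ω * stf h (W ω)
          - stg h (W ω) * T ω := by intro ω; simp only [stg]; ring
      simp_rw [e1]
      rw [integral_sub (f := fun ω => h (W ω) - stN h + W ω * stf h (W ω))
        ((hi.sub (integrable_const _)).add Wfi) gTi,
        integral_add (f := fun ω => h (W ω) - stN h) (hi.sub (integrable_const _)) Wfi,
        integral_sub hi (integrable_const _)]
      simp
    have i2 : |∫ ω, stg h (W ω) * (1 - T ω) ∂P| ≤ D := by
      refine (abs_integral_le_integral_abs).trans (le_trans ?_ hD)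
      apply integral_mono_of_nonneg (ae_of_all _ fun _ => abs_nonneg _)
        (hTi.sub (integrable_const _)).abs (ae_of_all _ fun ω => ?_)
      beta_reduce
      rw [abs_mul, abs_sub_comm 1]
      exact mul_le_of_le_one_left (abs_nonneg _) (hbb _).2
    have i3 : l * ∫ ω, Rbd z α b (W ω) ∂P ≤
        (l * b ^ 2 / 2) * (2.4 + 0.4 + (0.8 * b + 2 * δ) / α) := by
      have ii : Integrable (fun ω => (Icc (z - b) (z + α + b)).indicator (1 : ℝ → ℝ) (W ω)) P :=
        Integrable.of_bound (mI.comp hW).aestronglyMeasurable 1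
          (ae_of_all _ fun ω => by
            rw [Real.norm_eq_abs]; unfold indicator; split_ifs <;> simp)
      have e2 : ∫ ω, Rbd z α b (W ω) ∂P = b ^ 2 / 2 * (2.4 - 1 + ∫ ω, |W ω| ∂P +
          (1 / α) * P.real (W ⁻¹' Icc (z - b) (z + α + b))) := by
        unfold Rbd
        rw [integral_const_mul, integral_add (f := fun ω => (2.4 - 1 : ℝ) + |W ω|)
          ((integrable_const _).add hWi.abs) (ii.const_mul _),
          integral_add (integrable_const _) hWi.abs, integral_const_mul]
        congr 4
        · simp
        · rw [← integral_indicator_one (hW measurableSet_Icc)]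
          rfl
      rw [e2]
      have h3 := hcc (z - b) (z + α + b) (by linarith)
      have h4 : (1 / α) * P.real (W ⁻¹' Icc (z - b) (z + α + b)) ≤
          0.4 + (0.8 * b + 2 * δ) / α := by
        calc _ ≤ (1 / α) * (0.4 * (z + α + b - (z - b)) + 2 * δ) := by gcongr
          _ = _ := by field_simp; ring
      have h5 : (0:ℝ) ≤ l * b ^ 2 / 2 := by positivity
      calc _ = (l * b ^ 2 / 2) * (2.4 - 1 + ∫ ω, |W ω| ∂P +
          (1 / α) * P.real (W ⁻¹' Icc (z - b) (z + α + b))) := by ring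
        _ ≤ _ := by
          apply mul_le_mul_of_nonneg_left _ h5
          linarith
    rw [e]
    rw [abs_sub_comm] at i1
    exact (abs_add_le _ _).trans (add_le_add i2 (i1.trans i3))
  have hN1 : ∀ z α, 0 < α → stN (ramp z α) ≤ stdGaussCDF (z + α) := by
    intro z α hα
    rw [stN, cdf_eq, ← integral_indicator measurableSet_Iic]
    apply integral_mono (st_int (ramp_cont z α) (ramp_nonneg z α) (ramp_le_one z α))
      (gd_int.indicator measurableSet_Iic)
    intro x
    by_cases hx : x ∈ Iic (z + α)
    · simp only [indicator_of_mem hx]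
      exact mul_le_of_le_one_left (gd_pos x).le (ramp_le_one _ _ _)
    · simp only [indicator_of_notMem hx]
      rw [ramp_right hα (le_of_lt (not_le.1 hx)), zero_mul]
  have hN2 : ∀ z α, 0 < α → stdGaussCDF z ≤ stN (ramp z α) := by
    intro z α hα
    rw [stN, cdf_eq, ← integral_indicator measurableSet_Iic]
    apply integral_mono (gd_int.indicator measurableSet_Iic)
      (st_int (ramp_cont z α) (ramp_nonneg z α) (ramp_le_one z α))
    intro x
    by_cases hx : x ∈ Iic z
    · simp only [indicator_of_mem hx]
      rw [ramp_left hα hx, one_mul]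
    · simp only [indicator_of_notMem hx]
      exact mul_nonneg (ramp_nonneg _ _ _) (gd_pos x).le
  have hri : ∀ z α, Integrable (fun ω => ramp z α (W ω)) P := fun z α =>
    Integrable.of_bound ((ramp_cont z α).measurable.comp hW).aestronglyMeasurable 1
      (ae_of_all _ fun ω => by
        rw [Real.norm_eq_abs, abs_of_nonneg (ramp_nonneg _ _ _)]; exact ramp_le_one _ _ _)
  have mle : ∀ z, MeasurableSet {ω | W ω ≤ z} := fun z => hW measurableSet_Iic
  have hP1 : ∀ z α, 0 < α → P.real {ω | W ω ≤ z} ≤ ∫ ω, ramp z α (W ω) ∂P := by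
    intro z α hα
    rw [← integral_indicator_one (mle z)]
    apply integral_mono ((integrable_const (1:ℝ)).indicator (mle z)) (hri z α)
    intro ω
    by_cases hx : ω ∈ {ω | W ω ≤ z}
    · simp only [indicator_of_mem hx]
      rw [ramp_left hα hx]
    · simp only [indicator_of_notMem hx]
      exact ramp_nonneg _ _ _
  have hP2 : ∀ z α, 0 < α → ∫ ω, ramp (z - α) α (W ω) ∂P ≤ P.real {ω | W ω ≤ z} := by
    intro z α hα
    rw [← integral_indicator_one (mle z)]
    apply integral_mono (hri _ α) ((integrable_const (1:ℝ)).indicator (mle z))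
    intro ω
    by_cases hx : ω ∈ {ω | W ω ≤ z}
    · simp only [indicator_of_mem hx]
      exact ramp_le_one _ _ _
    · simp only [indicator_of_notMem hx]
      rw [ramp_right hα]
      simp only [mem_ofPred_eq, not_le] at hx
      linarith
  apply real_opt (b := b) (by positivity) _ hD0
  · intro α hα
    apply ciSup_le
    intro z
    rw [abs_le]
    constructor
    · have k := (abs_le.1 (key (z - α) α hα)).1
      have k1 := hP2 z α hα
      have k2 := hN2 (z - α) α hα
      have k3 := cdf_sub_le (show z - α ≤ z by linarith)
      linarith
    · have k := (abs_le.1 (key z α hα)).2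
      have k1 := hP1 z α hα
      have k2 := hN1 z α hα
      have k3 := cdf_sub_le (show z ≤ z + α by linarith)
      linarith
  · nlinarith



/-- bounded measurable functions -/
def BM {Ω : Type*} [MeasurableSpace Ω] (f : Ω → ℝ) : Prop :=
  Measurable f ∧ ∃ C, ∀ x, |f x| ≤ C

namespace BM
lemma const {Ω : Type*} [MeasurableSpace Ω] (c : ℝ) : BM (fun _ : Ω => c) :=
  ⟨measurable_const, |c|, fun _ => le_rfl⟩

lemma add {Ω : Type*} [MeasurableSpace Ω] {f g : Ω → ℝ} (hf : BM f) (hg : BM g) :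
    BM (fun x => f x + g x) := by
  obtain ⟨h1, C, hC⟩ := hf
  obtain ⟨h2, D, hD⟩ := hg
  exact ⟨h1.add h2, C + D, fun x => (abs_add_le _ _).trans (add_le_add (hC x) (hD x))⟩

lemma mul {Ω : Type*} [MeasurableSpace Ω] {f g : Ω → ℝ} (hf : BM f) (hg : BM g) :
    BM (fun x => f x * g x) := by
  obtain ⟨h1, C, hC⟩ := hf
  obtain ⟨h2, D, hD⟩ := hg
  refine ⟨h1.mul h2, C * D, fun x => ?_⟩
  rw [abs_mul]
  exact mul_le_mul (hC x) (hD x) (abs_nonneg _) ((abs_nonneg _).trans (hC x))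

lemma sub {Ω : Type*} [MeasurableSpace Ω] {f g : Ω → ℝ} (hf : BM f) (hg : BM g) :
    BM (fun x => f x - g x) := by
  have := hf.add ((BM.const (-1)).mul hg)
  simpa [sub_eq_add_neg] using this

lemma pow {Ω : Type*} [MeasurableSpace Ω] {f : Ω → ℝ} (hf : BM f) (k : ℕ) :
    BM (fun x => f x ^ k) := by
  obtain ⟨h1, C, hC⟩ := hf
  exact ⟨h1.pow_const k, C ^ k, fun x => by
    rw [abs_pow]; exact pow_le_pow_left₀ (abs_nonneg _) (hC x) k⟩

lemma abs {Ω : Type*} [MeasurableSpace Ω] {f : Ω → ℝ} (hf : BM f) :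
    BM (fun x => |f x|) := by
  obtain ⟨h1, C, hC⟩ := hf
  exact ⟨h1.abs, C, fun x => by rw [abs_abs]; exact hC x⟩

lemma sum {Ω ι : Type*} [MeasurableSpace Ω] (s : Finset ι) {f : ι → Ω → ℝ}
    (hf : ∀ i ∈ s, BM (f i)) : BM (fun x => ∑ i ∈ s, f i x) := by
  induction s using Finset.induction_on with
  | empty => simpa using BM.const (0:ℝ)
  | insert a s ha ih =>
    simp only [Finset.sum_insert ha]
    exact (hf a (Finset.mem_insert_self _ _)).add
      (ih fun i hi => hf i (Finset.mem_insert_of_mem hi))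

lemma prod {Ω ι : Type*} [MeasurableSpace Ω] (s : Finset ι) {f : ι → Ω → ℝ}
    (hf : ∀ i ∈ s, BM (f i)) : BM (fun x => ∏ i ∈ s, f i x) := by
  induction s using Finset.induction_on with
  | empty => simpa using BM.const (1:ℝ)
  | insert a s ha ih =>
    simp only [Finset.prod_insert ha]
    exact (hf a (Finset.mem_insert_self _ _)).mul
      (ih fun i hi => hf i (Finset.mem_insert_of_mem hi))

lemma comp {Ω Ω' : Type*} [MeasurableSpace Ω] [MeasurableSpace Ω'] {f : Ω → ℝ} (hf : BM f)
    {g : Ω' → Ω} (hg : Measurable g) : BM (fun x => f (g x)) := by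
  obtain ⟨h1, C, hC⟩ := hf
  exact ⟨h1.comp hg, C, fun x => hC _⟩

lemma ite {Ω : Type*} [MeasurableSpace Ω] {p : Ω → Prop} [DecidablePred p]
    (hp : MeasurableSet {x | p x}) :
    BM (fun x => if p x then (1:ℝ) else 0) :=
  ⟨Measurable.ite hp measurable_const measurable_const, 1, fun x => by beta_reduce; split_ifs <;> simp⟩

lemma integrable {Ω : Type*} [MeasurableSpace Ω] {f : Ω → ℝ} (hf : BM f) (μ : Measure Ω)
    [IsFiniteMeasure μ] : Integrable f μ := by
  obtain ⟨h1, C, hC⟩ := hf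
  exact Integrable.of_bound h1.aestronglyMeasurable C (ae_of_all _ hC)

lemma int {Ω Y : Type*} [MeasurableSpace Ω] [MeasurableSpace Y] {f : Ω × Y → ℝ} (hf : BM f)
    (ν : Measure Y) [IsProbabilityMeasure ν] : BM (fun x => ∫ y, f (x, y) ∂ν) := by
  obtain ⟨h1, C, hC⟩ := hf
  refine ⟨h1.stronglyMeasurable.integral_prod_right'.measurable, C, fun x => ?_⟩
  have := norm_integral_le_of_norm_le_const (μ := ν) (f := fun y => f (x, y)) (C := C)
    (ae_of_all _ fun y => hC _)
  simpa using this

lemma nat {Ω : Type*} [MeasurableSpace Ω] {N : Ω → ℕ} (hN : Measurable N) (w : ℕ → ℝ)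
    {C : ℝ} (hw : ∀ k, |w k| ≤ C) : BM (fun x => w (N x)) :=
  ⟨(measurable_from_top (f := w)).comp hN, C, fun x => hw _⟩
end BM

/-- product law -/
abbrev PL {X : Type*} [MeasurableSpace X] (ν : Measure X) (n : ℕ) : Measure (Fin n → X) :=
  Measure.pi fun _ => ν

lemma meas_update {X : Type*} [MeasurableSpace X] {n : ℕ} (j : Fin n) :
    Measurable (fun z : (Fin n → X) × X => Function.update z.1 j z.2) := by
  rw [measurable_pi_iff]
  intro i
  by_cases h : i = j
  · subst h; simpa using measurable_snd
  · simp only [Function.update_of_ne h]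
    exact (measurable_pi_apply i).comp measurable_fst

lemma mp_update {X : Type*} [MeasurableSpace X] (ν : Measure X) [IsProbabilityMeasure ν]
    {n : ℕ} (j : Fin n) :
    MeasurePreserving (fun z : (Fin n → X) × X => Function.update z.1 j z.2)
      ((PL ν n).prod ν) (PL ν n) := by
  refine ⟨meas_update j, ?_⟩
  symm
  apply Measure.pi_eq
  intro s hs
  rw [Measure.map_apply (meas_update j) (MeasurableSet.univ_pi hs)]
  have e : (fun z : (Fin n → X) × X => Function.update z.1 j z.2) ⁻¹' (univ.pi s) =
      (univ.pi (Function.update s j univ)) ×ˢ s j := by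
    ext z
    simp only [mem_preimage, Set.mem_pi, mem_univ, true_implies, mem_prod]
    constructor
    · intro h
      refine ⟨fun i => ?_, by simpa using h j⟩
      by_cases hi : i = j
      · subst hi; simp
      · simpa [Function.update_of_ne hi] using h i
    · rintro ⟨h1, h2⟩ i
      by_cases hi : i = j
      · subst hi; simpa using h2
      · simpa [Function.update_of_ne hi] using h1 i
  rw [e, Measure.prod_prod, Measure.pi_pi, ← Finset.prod_erase_mul _ _ (Finset.mem_univ j),
    ← Finset.prod_erase_mul (s := Finset.univ) (f := fun i => ν (s i)) (a := j)
      (Finset.mem_univ j)]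
  simp only [Function.update_self, measure_univ, mul_one]
  congr 1
  apply Finset.prod_congr rfl
  intro i hi
  rw [Function.update_of_ne (Finset.ne_of_mem_erase hi)]

/-- averaging of one coordinate -/
def AV {X : Type*} [MeasurableSpace X] (ν : Measure X) {n : ℕ} (j : Fin n)
    (f : (Fin n → X) → ℝ) (ω : Fin n → X) : ℝ := ∫ v, f (Function.update ω j v) ∂ν

lemma AV_BM {X : Type*} [MeasurableSpace X] (ν : Measure X) [IsProbabilityMeasure ν] {n : ℕ}
    (j : Fin n) {f : (Fin n → X) → ℝ} (hf : BM f) : BM (AV ν j f) :=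
  BM.int (f := fun z : (Fin n → X) × X => f (Function.update z.1 j z.2))
    (hf.comp (meas_update j)) ν

lemma int_AV {X : Type*} [MeasurableSpace X] (ν : Measure X) [IsProbabilityMeasure ν] {n : ℕ}
    (j : Fin n) {f : (Fin n → X) → ℝ} (hf : BM f) :
    ∫ ω, f ω ∂(PL ν n) = ∫ ω, AV ν j f ω ∂(PL ν n) := by
  unfold AV
  conv_lhs => rw [← (mp_update ν j).map_eq]
  rw [integral_map (meas_update j).aemeasurable hf.1.aestronglyMeasurable]
  exact integral_prod _ ((hf.comp (meas_update j)).integrable _)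

lemma int_swap {X : Type*} [MeasurableSpace X] (ν : Measure X) [IsProbabilityMeasure ν] {n : ℕ}
    (j : Fin n) {G : (Fin n → X) × X → ℝ} (hG : BM G) :
    ∫ ω, ∫ v, G (Function.update ω j v, ω j) ∂ν ∂(PL ν n) =
      ∫ ω, ∫ v, G (ω, v) ∂ν ∂(PL ν n) := by
  have m1 : Measurable (fun z : (Fin n → X) × X => (Function.update z.1 j z.2, z.1 j)) :=
    (meas_update j).prodMk ((measurable_pi_apply j).comp measurable_fst)
  rw [int_AV ν j (BM.int (hG.comp m1) ν), int_AV ν j (BM.int hG ν)]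
  congr 1
  ext ω
  unfold AV
  simp only [Function.update_idem, Function.update_self]
  have m2 : Measurable (fun z : X × X => (Function.update ω j z.2, z.1)) :=
    ((meas_update j).comp (measurable_const.prodMk measurable_snd)).prodMk measurable_fst
  exact integral_integral_swap (f := fun w v => G (Function.update ω j v, w))
    ((hG.comp m2).integrable _)

lemma const_of_inv {X : Type*} {n : ℕ} {F : (Fin n → X) → ℝ}
    (h : ∀ k ω v, F (Function.update ω k v) = F ω) (ω ω' : Fin n → X) : F ω = F ω' := by
  have : ∀ s : Finset (Fin n), F (s.piecewise ω' ω) = F ω := by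
    intro s
    induction s using Finset.induction_on with
    | empty => simp
    | insert a s ha ih => rw [Finset.piecewise_insert, h, ih]
  simpa using (this Finset.univ).symm

/-- iterated averaging -/
def AL {X : Type*} [MeasurableSpace X] (ν : Measure X) {n : ℕ} :
    List (Fin n) → ((Fin n → X) → ℝ) → (Fin n → X) → ℝ
  | [], f => f
  | k :: L, f => AL ν L (AV ν k f)

lemma AV_inv {X : Type*} [MeasurableSpace X] (ν : Measure X) {n : ℕ} (j k : Fin n)
    {f : (Fin n → X) → ℝ} (hf : ∀ ω v, f (Function.update ω k v) = f ω) (ω : Fin n → X) (v : X) :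
    AV ν j f (Function.update ω k v) = AV ν j f ω := by
  unfold AV
  by_cases h : j = k
  · subst h; simp
  · congr 1; ext w
    rw [Function.update_comm (Ne.symm h), hf]

lemma AV_self {X : Type*} [MeasurableSpace X] (ν : Measure X) {n : ℕ} (j : Fin n)
    (f : (Fin n → X) → ℝ) (ω : Fin n → X) (v : X) :
    AV ν j f (Function.update ω j v) = AV ν j f ω := by
  unfold AV; simp

lemma AL_inv {X : Type*} [MeasurableSpace X] (ν : Measure X) {n : ℕ} (k : Fin n) (L : List (Fin n)) :
    ∀ {f : (Fin n → X) → ℝ}, (k ∈ L ∨ ∀ ω v, f (Function.update ω k v) = f ω) →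
    ∀ ω v, AL ν L f (Function.update ω k v) = AL ν L f ω := by
  induction L with
  | nil => intro f h ω v; simpa [AL] using h.resolve_left (by simp) ω v
  | cons a L ih =>
    intro f h ω v
    simp only [AL]
    apply ih
    by_cases hk : k ∈ L
    · exact Or.inl hk
    · right
      rcases h with h | h
      · have : k = a := by simpa [hk] using h
        subst this
        exact AV_self ν k f
      · exact AV_inv ν a k h

lemma AL_BM {X : Type*} [MeasurableSpace X] (ν : Measure X) [IsProbabilityMeasure ν] {n : ℕ}
    (L : List (Fin n)) : ∀ {f : (Fin n → X) → ℝ}, BM f → BM (AL ν L f) ∧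
      ∫ ω, AL ν L f ω ∂(PL ν n) = ∫ ω, f ω ∂(PL ν n) := by
  induction L with
  | nil => intro f hf; exact ⟨hf, rfl⟩
  | cons a L ih => intro f hf; exact ⟨(ih (AV_BM ν a hf)).1, by
      rw [int_AV ν a hf]; exact (ih (AV_BM ν a hf)).2⟩

lemma sq_int_le {Ω : Type*} [MeasurableSpace Ω] (μ : Measure Ω) [IsProbabilityMeasure μ]
    {f : Ω → ℝ} (hf : BM f) : (∫ x, f x ∂μ) ^ 2 ≤ ∫ x, f x ^ 2 ∂μ := by
  set c := ∫ x, f x ∂μ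
  have h : 0 ≤ ∫ x, (f x - c) ^ 2 ∂μ := integral_nonneg fun _ => sq_nonneg _
  have e : ∫ x, (f x - c) ^ 2 ∂μ = ∫ x, f x ^ 2 ∂μ - c ^ 2 := by
    have e1 : ∀ x, (f x - c) ^ 2 = f x ^ 2 - 2 * c * f x + c ^ 2 := fun x => by ring
    simp_rw [e1]
    rw [integral_add (f := fun x => f x ^ 2 - 2 * c * f x)
      (((hf.pow 2).sub ((BM.const _).mul hf)).integrable μ) (integrable_const _),
      integral_sub ((hf.pow 2).integrable μ) (((BM.const (2 * c)).mul hf).integrable μ),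
      integral_const_mul]
    simp
    change _ - 2 * c * c + _ = _
    ring
  linarith

lemma AV_step {X : Type*} [MeasurableSpace X] (ν : Measure X) [IsProbabilityMeasure ν] {n : ℕ}
    (k : Fin n) {F G : (Fin n → X) → ℝ} (hF : BM F) (hG : BM G)
    (hk : ∀ ω v, G (Function.update ω k v) = G ω) :
    ∫ ω, F ω ^ 2 ∂(PL ν n) - ∫ ω, AV ν k F ω ^ 2 ∂(PL ν n) ≤
      ∫ ω, (F ω - G ω) ^ 2 ∂(PL ν n) := by
  rw [int_AV ν k (hF.pow 2), int_AV ν k ((hF.sub hG).pow 2),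
    ← integral_sub ((AV_BM ν k (hF.pow 2)).integrable _) (((AV_BM ν k hF).pow 2).integrable _)]
  apply integral_mono (((AV_BM ν k (hF.pow 2)).sub ((AV_BM ν k hF).pow 2)).integrable _)
    ((AV_BM ν k ((hF.sub hG).pow 2)).integrable _)
  intro ω
  simp only [AV, hk]
  have hF' : BM (fun v => F (Function.update ω k v)) :=
    hF.comp ((meas_update k).comp (measurable_const.prodMk measurable_id))
  have e1 : ∀ v, (F (Function.update ω k v) - G ω) ^ 2 = F (Function.update ω k v) ^ 2
      - 2 * G ω * F (Function.update ω k v) + G ω ^ 2 := fun x => by ring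
  simp_rw [e1]
  rw [integral_add (f := fun x => F (Function.update ω k x) ^ 2 - 2 * G ω * F (Function.update ω k x))
      (((hF'.pow 2).sub ((BM.const _).mul hF')).integrable ν) (integrable_const _),
      integral_sub ((hF'.pow 2).integrable ν) (((BM.const (2 * G ω)).mul hF').integrable ν),
      integral_const_mul]
  simp
  nlinarith [sq_nonneg (∫ v, F (Function.update ω k v) ∂ν - G ω)]

lemma AV_contr {X : Type*} [MeasurableSpace X] (ν : Measure X) [IsProbabilityMeasure ν] {n : ℕ}
    (k : Fin n) {F G : (Fin n → X) → ℝ} (hF : BM F) (hG : BM G) :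
    ∫ ω, (AV ν k F ω - AV ν k G ω) ^ 2 ∂(PL ν n) ≤ ∫ ω, (F ω - G ω) ^ 2 ∂(PL ν n) := by
  rw [int_AV ν k ((hF.sub hG).pow 2)]
  apply integral_mono ((((AV_BM ν k hF).sub (AV_BM ν k hG)).pow 2).integrable _)
    ((AV_BM ν k ((hF.sub hG).pow 2)).integrable _)
  intro ω
  have hm : Measurable (fun v : X => Function.update ω k v) :=
    (meas_update k).comp (measurable_const.prodMk measurable_id)
  simp only [AV]
  rw [← integral_sub ((hF.comp hm).integrable ν) ((hG.comp hm).integrable ν)]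
  exact sq_int_le ν ((hF.comp hm).sub (hG.comp hm))

lemma ES_list {X : Type*} [MeasurableSpace X] (ν : Measure X) [IsProbabilityMeasure ν] {n : ℕ}
    (L : List (Fin n)) : ∀ {F : (Fin n → X) → ℝ} {G : Fin n → (Fin n → X) → ℝ}, BM F →
    (∀ k, BM (G k)) → (∀ k ω v, G k (Function.update ω k v) = G k ω) →
    ∫ ω, F ω ^ 2 ∂(PL ν n) - ∫ ω, AL ν L F ω ^ 2 ∂(PL ν n) ≤
      (L.map fun k => ∫ ω, (F ω - G k ω) ^ 2 ∂(PL ν n)).sum := by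
  induction L with
  | nil => intro F G _ _ _; simp [AL]
  | cons a L ih =>
    intro F G hF hG hk
    have h1 := AV_step ν a hF (hG a) (hk a)
    have h2 := ih (F := AV ν a F) (G := fun k => AV ν a (G k)) (AV_BM ν a hF)
      (fun k => AV_BM ν a (hG k)) (fun k => AV_inv ν a k (hk k))
    have h3 : (L.map fun k => ∫ ω, (AV ν a F ω - AV ν a (G k) ω) ^ 2 ∂(PL ν n)).sum ≤
        (L.map fun k => ∫ ω, (F ω - G k ω) ^ 2 ∂(PL ν n)).sum :=
      List.sum_le_sum fun k _ => AV_contr ν a hF (hG k)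
    simp only [AL, List.map_cons, List.sum_cons]
    linarith

/-- Efron--Stein -/
lemma efron_stein {X : Type*} [MeasurableSpace X] (ν : Measure X) [IsProbabilityMeasure ν] {n : ℕ}
    {F : (Fin n → X) → ℝ} {G : Fin n → (Fin n → X) → ℝ} (hF : BM F)
    (hG : ∀ k, BM (G k)) (hk : ∀ k ω v, G k (Function.update ω k v) = G k ω) :
    ∫ ω, F ω ^ 2 ∂(PL ν n) - (∫ ω, F ω ∂(PL ν n)) ^ 2 ≤
      ∑ k, ∫ ω, (F ω - G k ω) ^ 2 ∂(PL ν n) := by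
  have h1 := ES_list ν (Finset.univ : Finset (Fin n)).toList hF hG hk
  have h2 := const_of_inv (F := AL ν (Finset.univ : Finset (Fin n)).toList F)
    (fun k => AL_inv ν k _ (Or.inl (by simp)))
  obtain ⟨ω0⟩ : Nonempty (Fin n → X) := (PL ν n).nonempty_of_neZero
  have h3 := (AL_BM ν (Finset.univ : Finset (Fin n)).toList hF).2
  have h4 : ∀ ω, AL ν (Finset.univ : Finset (Fin n)).toList F ω = ∫ ω, F ω ∂(PL ν n) := by
    intro ω
    rw [← h3]
    simp_rw [fun x => h2 x ω]
    simp
  simp_rw [h4] at h1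
  rw [Finset.sum_map_toList] at h1
  simpa using h1



lemma weights_exist {p : ℝ} (hp0 : 0 < p) (hp1 : p < 1) {m : ℕ} (hm : 1 ≤ m) :
    ∃ w : ℕ → ℝ, (∀ k, 0 ≤ w k) ∧ (∀ k, w k ≤ 1) ∧ w 0 = 1 ∧
      ∀ k : ℕ, 1 ≤ k → (k / m : ℝ) * w k + (k * (1 - p) / (m * p) : ℝ) * w (k - 1) - w k =
        (1 - p) ^ m / (1 - (1 - p) ^ m) := by
  set q := 1 - p with hq
  have hq0 : 0 < q := by linarith
  have hqm : q ^ m < 1 := pow_lt_one₀ hq0.le (by linarith) (by omega)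
  have hm0 : (0:ℝ) < m := by exact_mod_cast hm
  have hD : 0 < 1 - q ^ m := by linarith
  set u : ℝ → ℝ := fun t => (t / p) * (q / (1 - t)) with hu
  have hI : ∀ t ∈ uIcc 0 p, 0 ≤ t ∧ t ≤ p := by
    intro t ht; rw [uIcc_of_le hp0.le] at ht; exact ht
  have ud : ∀ t ∈ uIcc 0 p, HasDerivAt u ((q / p) / (1 - t) ^ 2) t := by
    intro t ht
    have h1 : (1 - t) ≠ 0 := by have := hI t ht; linarith
    have a1 : HasDerivAt (fun t : ℝ => t / p) (1 / p) t := (hasDerivAt_id t).div_const p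
    have a2 : HasDerivAt (fun t : ℝ => q / (1 - t)) ((0 * (1 - t) - q * (-1)) / (1 - t) ^ 2) t :=
      (hasDerivAt_const t q).div ((hasDerivAt_id t).const_sub 1) h1
    refine (a1.mul a2).congr_deriv ?_
    field_simp
    ring
  have uc : ContinuousOn u (uIcc 0 p) := fun t ht => (ud t ht).continuousAt.continuousWithinAt
  have u0 : ∀ t ∈ uIcc 0 p, 0 ≤ u t := by
    intro t ht
    have := hI t ht
    exact mul_nonneg (div_nonneg this.1 hp0.le) (div_nonneg hq0.le (by linarith))
  have u1 : ∀ t ∈ uIcc 0 p, u t ≤ 1 := by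
    intro t ht
    have := hI t ht
    exact mul_le_one₀ ((div_le_one hp0).2 this.2) (div_nonneg hq0.le (by linarith))
      ((div_le_one (by linarith)).2 (by linarith))
  have cc : ∀ k : ℕ, ContinuousOn (fun t => u t ^ k * (1 - t) ^ (m - 1)) (uIcc 0 p) := fun k =>
    (uc.pow k).mul (by fun_prop)
  have ci : ∀ k : ℕ, IntervalIntegrable (fun t => u t ^ k * (1 - t) ^ (m - 1)) volume 0 p :=
    fun k => (cc k).intervalIntegrable
  have i0 : ∫ t in (0:ℝ)..p, u t ^ 0 * (1 - t) ^ (m - 1) = (1 - q ^ m) / m := by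
    have h := intervalIntegral.integral_eq_sub_of_hasDerivAt (a := 0) (b := p)
      (f := fun t : ℝ => -(1 - t) ^ m / m) (f' := fun t => u t ^ 0 * (1 - t) ^ (m - 1))
      (fun t _ => by
        have := (((hasDerivAt_id t).const_sub 1).pow m).neg.div_const (m:ℝ)
        refine this.congr_deriv ?_
        simp
        field_simp) (ci 0)
    rw [h, ← hq]; simp; ring
  refine ⟨fun k => (m / (1 - q ^ m)) * ∫ t in (0:ℝ)..p, u t ^ k * (1 - t) ^ (m - 1), ?_, ?_, ?_, ?_⟩
  · intro k
    apply mul_nonneg (by positivity)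
    apply intervalIntegral.integral_nonneg hp0.le
    intro t ht
    rw [← uIcc_of_le hp0.le] at ht
    have := hI t ht
    exact mul_nonneg (pow_nonneg (u0 t ht) _) (pow_nonneg (by linarith) _)
  · intro k
    have : ∫ t in (0:ℝ)..p, u t ^ k * (1 - t) ^ (m - 1) ≤ (1 - q ^ m) / m := by
      rw [← i0]
      apply intervalIntegral.integral_mono_on hp0.le (ci k) (ci 0)
      intro t ht
      rw [← uIcc_of_le hp0.le] at ht
      have := hI t ht
      apply mul_le_mul_of_nonneg_right _ (pow_nonneg (by linarith) _)
      simpa using pow_le_one₀ (u0 t ht) (u1 t ht)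
    calc _ ≤ (m / (1 - q ^ m)) * ((1 - q ^ m) / m) := mul_le_mul_of_nonneg_left this (by positivity)
      _ = 1 := by field_simp
  · beta_reduce
    rw [i0]; field_simp
  · intro k hk
    have h := intervalIntegral.integral_eq_sub_of_hasDerivAt (a := 0) (b := p)
      (f := fun t : ℝ => u t ^ k * (1 - t) ^ m)
      (f' := fun t => (k * q / p) * (u t ^ (k - 1) * (1 - t) ^ (m - 1)) -
        (m - k) * (u t ^ k * (1 - t) ^ (m - 1)))
      (fun t ht => by
        have h1 : (1 - t) ≠ 0 := by have := hI t ht; linarith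
        have := ((ud t ht).pow k).mul (((hasDerivAt_id t).const_sub 1).pow m)
        refine this.congr_deriv ?_
        obtain ⟨k, rfl⟩ : ∃ k', k = k' + 1 := ⟨k - 1, by omega⟩
        obtain ⟨m, rfl⟩ : ∃ k', m = k' + 1 := ⟨m - 1, by omega⟩
        simp only [Nat.add_sub_cancel, Pi.pow_apply, id]
        have e : (q / p) / (1 - t) ^ 2 * (1 - t) ^ (m + 1) = (q / p + u t) * (1 - t) ^ m := by
          rw [pow_succ, hu]; field_simp; ring
        push_cast
        linear_combination ((k:ℝ) + 1) * u t ^ k * e)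
      (((ci (k - 1)).const_mul _).sub ((ci k).const_mul _))
    rw [intervalIntegral.integral_sub ((ci (k - 1)).const_mul _) ((ci k).const_mul _),
      intervalIntegral.integral_const_mul, intervalIntegral.integral_const_mul] at h
    have e1 : u p = 1 := by rw [hu]; beta_reduce; rw [← hq]; field_simp
    have e0 : u 0 = 0 := by simp [hu]
    rw [e1, e0, ← hq, zero_pow (by omega)] at h
    simp only [one_pow, one_mul, zero_mul, sub_zero] at h
    rw [← h]
    field_simp
    ring



/-- abstract geometric model -/
structure GM (X : Type*) [MeasurableSpace X] (ν : Measure X) where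
  rel : X → X → Prop
  rel3 : X → X → Prop
  p : ℝ
  p3 : ℝ
  κ : ℕ
  meas : MeasurableSet {z : X × X | rel z.1 z.2}
  meas3 : MeasurableSet {z : X × X | rel3 z.1 z.2}
  symm : ∀ x y, rel x y → rel y x
  refl : ∀ x, rel x x
  symm3 : ∀ x y, rel3 x y → rel3 y x
  trans3 : ∀ x y z w, rel x y → rel y z → rel z w → rel3 x w
  prob : ∀ x, ν.real {y | rel x y} = p
  prob3 : ∀ x, ν.real {y | rel3 x y} ≤ p3
  p_pos : 0 < p
  p_lt : p < 1
  pack : ∀ (n : ℕ) (v : X) (ω : Fin n → X) (s : Finset (Fin n)), (∀ i ∈ s, rel v (ω i)) →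
    (∀ i ∈ s, ∀ j ∈ s, i ≠ j → ¬ rel (ω i) (ω j)) → s.card ≤ κ

namespace GM

/-- neighbour count -/
def NN {X : Type*} [MeasurableSpace X] {ν : Measure X} (M : GM X ν) {n : ℕ}
    (J : Finset (Fin n)) (ω : Fin n → X) (i : Fin n) : ℕ :=
  (J.filter fun l => l ≠ i ∧ M.rel (ω i) (ω l)).card

/-- number of isolated points near v -/
def ss {X : Type*} [MeasurableSpace X] {ν : Measure X} (M : GM X ν) {n : ℕ}
    (J : Finset (Fin n)) (ω : Fin n → X) (v : X) : ℕ :=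
  (J.filter fun l => M.NN J ω l = 0 ∧ M.rel v (ω l)).card

/-- number of isolated points -/
def SJ {X : Type*} [MeasurableSpace X] {ν : Measure X} (M : GM X ν) {n : ℕ}
    (J : Finset (Fin n)) (ω : Fin n → X) : ℕ :=
  (J.filter fun l => M.NN J ω l = 0).card

lemma meas_rel {X Ω : Type*} [MeasurableSpace X] [MeasurableSpace Ω] {ν : Measure X}
    (M : GM X ν) {f g : Ω → X} (hf : Measurable f) (hg : Measurable g) :
    MeasurableSet {x | M.rel (f x) (g x)} := (hf.prodMk hg) M.meas

lemma meas_rel3 {X Ω : Type*} [MeasurableSpace X] [MeasurableSpace Ω] {ν : Measure X}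
    (M : GM X ν) {f g : Ω → X} (hf : Measurable f) (hg : Measurable g) :
    MeasurableSet {x | M.rel3 (f x) (g x)} := (hf.prodMk hg) M.meas3

lemma meas_NN {X : Type*} [MeasurableSpace X] {ν : Measure X} (M : GM X ν) {n : ℕ}
    (J : Finset (Fin n)) (i : Fin n) : Measurable (fun ω : Fin n → X => M.NN J ω i) := by
  unfold NN
  simp only [Finset.card_filter]
  refine Finset.measurable_sum _ fun l _ => ?_
  refine Measurable.ite ?_ measurable_const measurable_const
  exact (MeasurableSet.const _).inter
    (M.meas_rel (measurable_pi_apply i) (measurable_pi_apply l))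

lemma meas_NNz {X : Type*} [MeasurableSpace X] {ν : Measure X} (M : GM X ν) {n : ℕ}
    (J : Finset (Fin n)) (i : Fin n) (k : ℕ) : MeasurableSet {ω : Fin n → X | M.NN J ω i = k} :=
  M.meas_NN J i (measurableSet_singleton k)

lemma meas_ss {X : Type*} [MeasurableSpace X] {ν : Measure X} (M : GM X ν) {n : ℕ}
    (J : Finset (Fin n)) : Measurable (fun z : (Fin n → X) × X => M.ss J z.1 z.2) := by
  unfold ss
  simp only [Finset.card_filter]
  refine Finset.measurable_sum _ fun l _ => ?_
  refine Measurable.ite ?_ measurable_const measurable_const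
  exact (measurable_fst (M.meas_NNz J l 0)).inter
    (M.meas_rel measurable_snd ((measurable_pi_apply l).comp measurable_fst))

lemma meas_SJ {X : Type*} [MeasurableSpace X] {ν : Measure X} (M : GM X ν) {n : ℕ}
    (J : Finset (Fin n)) : Measurable (fun ω : Fin n → X => M.SJ J ω) := by
  unfold SJ
  simp only [Finset.card_filter]
  refine Finset.measurable_sum _ fun l _ => ?_
  exact Measurable.ite (M.meas_NNz J l 0) measurable_const measurable_const

lemma NN_upd {X : Type*} [MeasurableSpace X] {ν : Measure X} (M : GM X ν) {n : ℕ}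
    {J : Finset (Fin n)} (ω : Fin n → X) {i k : Fin n} (hk : k ∉ J) (hi : i ≠ k) (v : X) :
    M.NN J (Function.update ω k v) i = M.NN J ω i := by
  unfold NN
  congr 1
  apply Finset.filter_congr
  intro l hl
  have : l ≠ k := fun h => hk (h ▸ hl)
  rw [Function.update_of_ne hi, Function.update_of_ne this]

lemma ss_upd {X : Type*} [MeasurableSpace X] {ν : Measure X} (M : GM X ν) {n : ℕ}
    {J : Finset (Fin n)} (ω : Fin n → X) {k : Fin n} (hk : k ∉ J) (v w : X) :
    M.ss J (Function.update ω k v) w = M.ss J ω w := by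
  unfold ss
  congr 1
  apply Finset.filter_congr
  intro l hl
  have : l ≠ k := fun h => hk (h ▸ hl)
  rw [Function.update_of_ne this, M.NN_upd ω hk this]

lemma SJ_upd {X : Type*} [MeasurableSpace X] {ν : Measure X} (M : GM X ν) {n : ℕ}
    {J : Finset (Fin n)} (ω : Fin n → X) {k : Fin n} (hk : k ∉ J) (v : X) :
    M.SJ J (Function.update ω k v) = M.SJ J ω := by
  unfold SJ
  congr 1
  apply Finset.filter_congr
  intro l hl
  have : l ≠ k := fun h => hk (h ▸ hl)
  rw [M.NN_upd ω hk this]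

lemma ss_le {X : Type*} [MeasurableSpace X] {ν : Measure X} (M : GM X ν) {n : ℕ}
    (J : Finset (Fin n)) (ω : Fin n → X) (v : X) : M.ss J ω v ≤ M.κ := by
  apply M.pack n v ω
  · intro i hi; exact (Finset.mem_filter.1 hi).2.2
  · intro i hi j hj hij hr
    have h1 := (Finset.mem_filter.1 hi).2.1
    unfold NN at h1
    rw [Finset.card_eq_zero, Finset.filter_eq_empty_iff] at h1
    exact h1 (Finset.mem_filter.1 hj).1 ⟨hij.symm, hr⟩

lemma NN_erase {X : Type*} [MeasurableSpace X] {ν : Measure X} (M : GM X ν) {n : ℕ}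
    (ω : Fin n → X) {i k : Fin n} (hi : i ≠ k) :
    M.NN Finset.univ ω i = M.NN (Finset.univ.erase k) ω i +
      if M.rel (ω i) (ω k) then 1 else 0 := by
  unfold NN
  simp only [Finset.card_filter]
  rw [← Finset.sum_erase_add _ _ (Finset.mem_univ k)]
  simp [hi.symm]

lemma NN_erase_self {X : Type*} [MeasurableSpace X] {ν : Measure X} (M : GM X ν) {n : ℕ}
    (ω : Fin n → X) (k : Fin n) :
    M.NN Finset.univ ω k = M.NN (Finset.univ.erase k) ω k := by
  unfold NN
  congr 1
  ext l
  simp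

lemma S_decomp {X : Type*} [MeasurableSpace X] {ν : Measure X} (M : GM X ν) {n : ℕ}
    (ω : Fin n → X) (k : Fin n) :
    (M.SJ Finset.univ ω : ℝ) = M.SJ (Finset.univ.erase k) ω +
      (if M.NN Finset.univ ω k = 0 then 1 else 0) - M.ss (Finset.univ.erase k) ω (ω k) := by
  unfold SJ ss
  simp only [Finset.card_filter]
  rw [← Finset.sum_erase_add _ _ (Finset.mem_univ k)]
  push_cast
  have : ∀ l ∈ Finset.univ.erase k, (if M.NN Finset.univ ω l = 0 then (1:ℝ) else 0) =
      (if M.NN (Finset.univ.erase k) ω l = 0 then (1:ℝ) else 0) -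
      (if M.NN (Finset.univ.erase k) ω l = 0 ∧ M.rel (ω k) (ω l) then (1:ℝ) else 0) := by
    intro l hl
    rw [M.NN_erase ω (Finset.ne_of_mem_erase hl)]
    by_cases hr : M.rel (ω l) (ω k)
    · have hr' := M.symm _ _ hr
      simp [hr, hr']
    · have hr' : ¬ M.rel (ω k) (ω l) := fun h => hr (M.symm _ _ h)
      simp [hr, hr']
  rw [Finset.sum_congr rfl this, Finset.sum_sub_distrib]
  ring

/-- removal cost -/
def rr {X : Type*} [MeasurableSpace X] {ν : Measure X} (M : GM X ν) {n : ℕ}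
    (ω : Fin n → X) (k : Fin n) : ℝ :=
  1 - (if M.NN Finset.univ ω k = 0 then 1 else 0) + M.ss (Finset.univ.erase k) ω (ω k)

lemma rr_nonneg {X : Type*} [MeasurableSpace X] {ν : Measure X} (M : GM X ν) {n : ℕ}
    (ω : Fin n → X) (k : Fin n) : 0 ≤ M.rr ω k := by
  unfold rr
  have : (0:ℝ) ≤ M.ss (Finset.univ.erase k) ω (ω k) := Nat.cast_nonneg _
  split_ifs <;> linarith

lemma rr_le {X : Type*} [MeasurableSpace X] {ν : Measure X} (M : GM X ν) {n : ℕ}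
    (ω : Fin n → X) (k : Fin n) : M.rr ω k ≤ M.κ + 1 := by
  unfold rr
  have : (M.ss (Finset.univ.erase k) ω (ω k) : ℝ) ≤ M.κ := by exact_mod_cast M.ss_le _ _ _
  split_ifs <;> linarith

lemma S_diff {X : Type*} [MeasurableSpace X] {ν : Measure X} (M : GM X ν) {n : ℕ}
    (ω : Fin n → X) {i j : Fin n} (hij : j ≠ i) {v : X} (hv : M.rel (ω i) v) :
    (M.SJ Finset.univ ω : ℝ) - M.SJ Finset.univ (Function.update ω j v) =
      1 + M.ss (Finset.univ.erase j) ω v - M.rr ω j := by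
  rw [M.S_decomp ω j, M.S_decomp (Function.update ω j v) j,
    M.SJ_upd ω (Finset.notMem_erase _ _), M.ss_upd ω (Finset.notMem_erase _ _)]
  have : M.NN Finset.univ (Function.update ω j v) j ≠ 0 := by
    unfold NN
    rw [Finset.card_ne_zero]
    refine ⟨i, ?_⟩
    simp only [Finset.mem_filter, Finset.mem_univ, true_and]
    rw [Function.update_of_ne hij.symm]
    exact ⟨hij.symm, by simpa using M.symm _ _ hv⟩
  simp only [this, if_false, Function.update_self]
  unfold rr
  ring

lemma S_diff_le {X : Type*} [MeasurableSpace X] {ν : Measure X} (M : GM X ν) {n : ℕ}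
    (ω : Fin n → X) {i j : Fin n} (hij : j ≠ i) {v : X} (hv : M.rel (ω i) v) :
    |(M.SJ Finset.univ ω : ℝ) - M.SJ Finset.univ (Function.update ω j v)| ≤ M.κ + 1 := by
  rw [M.S_diff ω hij hv]
  have h1 := M.rr_le ω j
  have h2 := M.rr_nonneg ω j
  have h3 : (M.ss (Finset.univ.erase j) ω v : ℝ) ≤ M.κ := by exact_mod_cast M.ss_le _ _ _
  have h4 : (0:ℝ) ≤ M.ss (Finset.univ.erase j) ω v := Nat.cast_nonneg _
  rw [abs_le]; constructor <;> linarith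

lemma sum_rr {X : Type*} [MeasurableSpace X] {ν : Measure X} (M : GM X ν) {n : ℕ}
    (ω : Fin n → X) : ∑ k, M.rr ω k = ∑ k, ((1 - (if M.NN Finset.univ ω k = 0 then (1:ℝ) else 0)) +
      if M.NN Finset.univ ω k = 1 then 1 else 0) := by
  unfold rr
  rw [Finset.sum_add_distrib, Finset.sum_add_distrib]
  congr 1
  have h1 : ∀ k, (M.ss (Finset.univ.erase k) ω (ω k) : ℝ) = ∑ l,
      if M.NN Finset.univ ω l = 1 ∧ k ≠ l ∧ M.rel (ω l) (ω k) then (1:ℝ) else 0 := by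
    intro k
    unfold ss
    rw [Finset.card_filter, ← Finset.sum_erase_add _ _ (Finset.mem_univ k)]
    push_cast
    simp only [ne_eq, not_true_eq_false, false_and, and_false, if_false, add_zero]
    apply Finset.sum_congr rfl
    intro l hl
    rw [M.NN_erase ω (Finset.ne_of_mem_erase hl)]
    have hkl : ¬ (k = l) := (Finset.ne_of_mem_erase hl).symm
    by_cases hr : M.rel (ω l) (ω k)
    · have hr' := M.symm _ _ hr
      simp [hr, hr', hkl]
    · have hr' : ¬ M.rel (ω k) (ω l) := fun h => hr (M.symm _ _ h)
      simp [hr, hr']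
  simp_rw [h1]
  rw [Finset.sum_comm]
  apply Finset.sum_congr rfl
  intro l _
  by_cases h : M.NN Finset.univ ω l = 1
  · simp only [h, true_and, if_true]
    have h' := h
    unfold NN at h'
    rw [Finset.card_filter] at h'
    exact_mod_cast h'
  · simp [h]

end GM



namespace GM

/-- indicator of relation -/
def ri {X : Type*} [MeasurableSpace X] {ν : Measure X} (M : GM X ν) (x v : X) : ℝ :=
  if M.rel x v then 1 else 0

lemma int_ri {X : Type*} [MeasurableSpace X] {ν : Measure X} (M : GM X ν) (x : X) :
    ∫ v, M.ri x v ∂ν = M.p := by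
  have h : MeasurableSet {y | M.rel x y} := M.meas_rel measurable_const measurable_id
  rw [← M.prob x, ← integral_indicator_one h]
  rfl

lemma ri_BM {X Ω : Type*} [MeasurableSpace X] [MeasurableSpace Ω] {ν : Measure X}
    (M : GM X ν) {f g : Ω → X} (hf : Measurable f) (hg : Measurable g) :
    BM (fun x => M.ri (f x) (g x)) := BM.ite (M.meas_rel hf hg)

lemma ri_BM1 {X : Type*} [MeasurableSpace X] {ν : Measure X}
    (M : GM X ν) (x : X) : BM (fun v => M.ri x v) := M.ri_BM measurable_const measurable_id

lemma wint {X : Type*} [MeasurableSpace X] {ν : Measure X} [IsProbabilityMeasure ν] (M : GM X ν)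
    {n : ℕ} (w : ℕ → ℝ) (ω : Fin n → X) {i j : Fin n} (hij : i ≠ j) (hr : M.rel (ω i) (ω j)) :
    ∫ v, w (M.NN Finset.univ (Function.update ω j v) i) ∂ν =
      M.p * w (M.NN Finset.univ ω i) + (1 - M.p) * w (M.NN Finset.univ ω i - 1) := by
  set N := M.NN (Finset.univ.erase j) ω i with hN
  have e0 : M.NN Finset.univ ω i = N + 1 := by rw [M.NN_erase ω hij, if_pos hr]
  have e1 : ∀ v, w (M.NN Finset.univ (Function.update ω j v) i) =
      M.ri (ω i) v * (w (N + 1) - w N) + w N := by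
    intro v
    rw [M.NN_erase _ hij, M.NN_upd ω (Finset.notMem_erase _ _) hij, Function.update_self,
      Function.update_of_ne hij]
    unfold ri
    split_ifs <;> simp [hN]
  simp_rw [e1]
  rw [integral_add (((M.ri_BM1 _).mul (BM.const _)).integrable ν)
    (integrable_const _), integral_mul_const, M.int_ri, e0]
  simp
  ring

/-- the exchange operator -/
def DD {X : Type*} [MeasurableSpace X] {ν : Measure X} (M : GM X ν) {n : ℕ} (w : ℕ → ℝ)
    (F : (Fin n → X) → ℝ) (ω : Fin n → X) : ℝ :=
  ∑ i, w (M.NN Finset.univ ω i) * ((1 / ((n - 1 : ℕ) * M.p)) * ∑ j ∈ Finset.univ.erase i,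
    ∫ v, M.ri (ω i) v * (F ω - F (Function.update ω j v)) ∂ν)

lemma DD_term_BM {X : Type*} [MeasurableSpace X] {ν : Measure X} [IsProbabilityMeasure ν]
    (M : GM X ν) {n : ℕ} {F : (Fin n → X) → ℝ} (hF : BM F) (i j : Fin n) :
    BM (fun ω => ∫ v, M.ri (ω i) v * (F ω - F (Function.update ω j v)) ∂ν) := by
  refine BM.int (f := fun z : (Fin n → X) × X =>
    M.ri (z.1 i) z.2 * (F z.1 - F (Function.update z.1 j z.2))) ?_ ν
  exact (M.ri_BM ((measurable_pi_apply i).comp measurable_fst) measurable_snd).mul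
    ((hF.comp measurable_fst).sub (hF.comp (meas_update j)))

lemma DD_BM {X : Type*} [MeasurableSpace X] {ν : Measure X} [IsProbabilityMeasure ν]
    (M : GM X ν) {n : ℕ} {w : ℕ → ℝ} (hw : ∀ k, |w k| ≤ 1) {F : (Fin n → X) → ℝ} (hF : BM F) :
    BM (M.DD w F) := by
  unfold DD
  refine BM.sum _ fun i _ => (BM.nat (M.meas_NN _ i) w hw).mul ((BM.const _).mul
    (BM.sum _ fun j _ => M.DD_term_BM hF i j))

lemma DD_key_i {X : Type*} [MeasurableSpace X] {ν : Measure X} [IsProbabilityMeasure ν]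
    (M : GM X ν) {n : ℕ} (hn : 2 ≤ n) {w : ℕ → ℝ} (hw : ∀ k, |w k| ≤ 1) (hw0 : w 0 = 1)
    (hwr : ∀ k : ℕ, 1 ≤ k → (k / (n - 1 : ℕ) : ℝ) * w k +
      (k * (1 - M.p) / ((n - 1 : ℕ) * M.p) : ℝ) * w (k - 1) - w k =
        (1 - M.p) ^ (n - 1) / (1 - (1 - M.p) ^ (n - 1)))
    {F : (Fin n → X) → ℝ} (hF : BM F) (i : Fin n) :
    ∫ ω, ((if M.NN Finset.univ ω i = 0 then 1 else 0) - (1 - M.p) ^ (n - 1)) * F ω ∂(PL ν n) =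
      (1 - (1 - M.p) ^ (n - 1)) * ∫ ω, w (M.NN Finset.univ ω i) * ((1 / ((n - 1 : ℕ) * M.p)) *
        ∑ j ∈ Finset.univ.erase i,
        ∫ v, M.ri (ω i) v * (F ω - F (Function.update ω j v)) ∂ν) ∂(PL ν n) := by
  have hp := M.p_pos
  have hm : (0:ℝ) < (n - 1 : ℕ) := by exact_mod_cast (by omega : 0 < n - 1)
  have hD : 0 < 1 - (1 - M.p) ^ (n - 1) := by
    have : (1 - M.p) ^ (n - 1) < 1 :=
      pow_lt_one₀ (by have := M.p_lt; linarith) (by linarith) (by omega)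
    linarith
  set m : ℝ := ((n - 1 : ℕ) : ℝ) with hmdef
  have hwB : BM (fun ω : Fin n → X => w (M.NN Finset.univ ω i)) := BM.nat (M.meas_NN _ i) w hw
  have hm1 : ∀ j : Fin n, Measurable (fun ω : Fin n → X => ω j) := measurable_pi_apply
  -- swap step
  have sw : ∀ j ∈ Finset.univ.erase i,
      ∫ ω, w (M.NN Finset.univ ω i) * ∫ v, M.ri (ω i) v * F (Function.update ω j v) ∂ν ∂(PL ν n) =
      ∫ ω, F ω * (M.ri (ω i) (ω j) * (M.p * w (M.NN Finset.univ ω i) +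
        (1 - M.p) * w (M.NN Finset.univ ω i - 1))) ∂(PL ν n) := by
    intro j hj
    have hij : i ≠ j := (Finset.ne_of_mem_erase hj).symm
    have hG : BM (fun z : (Fin n → X) × X => w (M.NN Finset.univ (Function.update z.1 j z.2) i) *
        (M.ri (z.1 i) (z.1 j) * F z.1)) :=
      (hwB.comp (meas_update j)).mul
        ((M.ri_BM ((hm1 i).comp measurable_fst) ((hm1 j).comp measurable_fst)).mul
          (hF.comp measurable_fst))
    have := int_swap ν j hG
    simp only [Function.update_idem, Function.update_eq_self, Function.update_self,
      Function.update_of_ne hij] at this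
    simp_rw [← integral_const_mul]
    rw [this]
    congr 1
    ext ω
    rw [integral_mul_const]
    by_cases hr : M.rel (ω i) (ω j)
    · rw [M.wint w ω hij hr]; ring
    · simp [ri, hr]
  have hB1 : ∀ j, BM (fun ω => w (M.NN Finset.univ ω i) *
      ∫ v, M.ri (ω i) v * F (Function.update ω j v) ∂ν) := fun j =>
    hwB.mul (BM.int (f := fun z : (Fin n → X) × X => M.ri (z.1 i) z.2 * F (Function.update z.1 j z.2))
      ((M.ri_BM ((hm1 i).comp measurable_fst) measurable_snd).mul (hF.comp (meas_update j))) ν)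
  have e1 : ∀ ω, w (M.NN Finset.univ ω i) * ((1 / (m * M.p)) * ∑ j ∈ Finset.univ.erase i,
        ∫ v, M.ri (ω i) v * (F ω - F (Function.update ω j v)) ∂ν) =
      w (M.NN Finset.univ ω i) * F ω - (1 / (m * M.p)) * ∑ j ∈ Finset.univ.erase i,
        w (M.NN Finset.univ ω i) * ∫ v, M.ri (ω i) v * F (Function.update ω j v) ∂ν := by
    intro ω
    have : ∀ j ∈ Finset.univ.erase i, ∫ v, M.ri (ω i) v * (F ω - F (Function.update ω j v)) ∂ν =
        M.p * F ω - ∫ v, M.ri (ω i) v * F (Function.update ω j v) ∂ν := by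
      intro j _
      have hmu : Measurable (fun v : X => Function.update ω j v) :=
        (meas_update j).comp (measurable_const.prodMk measurable_id)
      simp_rw [mul_sub]
      rw [integral_sub (((M.ri_BM1 _).mul (BM.const _)).integrable ν)
        (((M.ri_BM1 _).mul (hF.comp hmu)).integrable ν),
        integral_mul_const, M.int_ri]
    rw [Finset.sum_congr rfl this, Finset.sum_sub_distrib, ← Finset.mul_sum]
    simp only [Finset.sum_const, Finset.card_erase_of_mem (Finset.mem_univ i), Finset.card_univ,
      Fintype.card_fin, nsmul_eq_mul]
    rw [← hmdef, ← Finset.mul_sum]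
    field_simp
  simp_rw [e1]
  rw [integral_sub ((hwB.mul hF).integrable _)
    (((BM.const _).mul (BM.sum _ fun j _ => hB1 j)).integrable _), integral_const_mul,
    integral_finsetSum _ (fun j _ => (hB1 j).integrable _), Finset.sum_congr rfl sw,
    ← integral_finsetSum _ (fun j _ => (hF.mul ((M.ri_BM (hm1 i) (hm1 j)).mul
      (((BM.const _).mul hwB).add ((BM.const _).mul
        (BM.nat (N := fun ω => M.NN Finset.univ ω i - 1)
          ((M.meas_NN _ i).sub_const 1) w hw))))).integrable _),
    ← integral_const_mul, ← integral_sub ((hwB.mul hF).integrable _)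
    (((BM.const _).mul (BM.sum _ fun j _ => (hF.mul ((M.ri_BM (hm1 i) (hm1 j)).mul
      (((BM.const _).mul hwB).add ((BM.const _).mul
        (BM.nat (N := fun ω => M.NN Finset.univ ω i - 1)
          ((M.meas_NN _ i).sub_const 1) w hw))))))).integrable _), ← integral_const_mul]
  congr 1
  ext ω
  have e2 : ∑ j ∈ Finset.univ.erase i, M.ri (ω i) (ω j) = M.NN Finset.univ ω i := by
    unfold NN
    rw [Finset.card_filter, ← Finset.sum_erase_add _ _ (Finset.mem_univ i)]
    push_cast
    simp only [ne_eq, not_true_eq_false, false_and, if_false, add_zero]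
    apply Finset.sum_congr rfl
    intro j hj
    have : ¬ (j = i) := Finset.ne_of_mem_erase hj
    simp [ri, this]
  rw [← Finset.mul_sum, ← Finset.sum_mul, e2]
  set N := M.NN Finset.univ ω i
  by_cases hN : N = 0
  · simp [hN, hw0]
  · have := hwr N (by omega)
    rw [eq_div_iff hD.ne'] at this
    have e3 : (N / m : ℝ) = N * M.p * (1 / (m * M.p)) := by field_simp
    have e4 : (N * (1 - M.p) / (m * M.p) : ℝ) = N * (1 - M.p) * (1 / (m * M.p)) := by ring
    rw [e3, e4] at this
    rw [if_neg hN]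
    linear_combination F ω * this

lemma DD_key {X : Type*} [MeasurableSpace X] {ν : Measure X} [IsProbabilityMeasure ν]
    (M : GM X ν) {n : ℕ} (hn : 2 ≤ n) {w : ℕ → ℝ} (hw : ∀ k, |w k| ≤ 1) (hw0 : w 0 = 1)
    (hwr : ∀ k : ℕ, 1 ≤ k → (k / (n - 1 : ℕ) : ℝ) * w k +
      (k * (1 - M.p) / ((n - 1 : ℕ) * M.p) : ℝ) * w (k - 1) - w k =
        (1 - M.p) ^ (n - 1) / (1 - (1 - M.p) ^ (n - 1)))
    {F : (Fin n → X) → ℝ} (hF : BM F) :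
    ∫ ω, ((M.SJ Finset.univ ω : ℝ) - n * (1 - M.p) ^ (n - 1)) * F ω ∂(PL ν n) =
      (1 - (1 - M.p) ^ (n - 1)) * ∫ ω, M.DD w F ω ∂(PL ν n) := by
  have e : ∀ ω : Fin n → X, ((M.SJ Finset.univ ω : ℝ) - n * (1 - M.p) ^ (n - 1)) * F ω =
      ∑ i, ((if M.NN Finset.univ ω i = 0 then 1 else 0) - (1 - M.p) ^ (n - 1)) * F ω := by
    intro ω
    unfold SJ
    rw [← Finset.sum_mul, Finset.sum_sub_distrib, Finset.card_filter]
    simp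
  simp_rw [e]
  unfold DD
  have hb : ∀ i, BM (fun ω : Fin n → X => ((if M.NN Finset.univ ω i = 0 then 1 else 0) -
      (1 - M.p) ^ (n - 1)) * F ω) := fun i =>
    ((BM.ite (M.meas_NNz _ i 0)).sub (BM.const _)).mul hF
  rw [integral_finsetSum _ fun i _ => (hb i).integrable _,
    integral_finsetSum _ fun i _ => ((BM.nat (M.meas_NN _ i) w hw).mul ((BM.const _).mul
    (BM.sum _ fun j _ => M.DD_term_BM hF i j))).integrable _, Finset.mul_sum]
  exact Finset.sum_congr rfl fun i _ => M.DD_key_i hn hw hw0 hwr hF i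

lemma DD_lin {X : Type*} [MeasurableSpace X] {ν : Measure X} [IsProbabilityMeasure ν]
    (M : GM X ν) {n : ℕ} (hn : 2 ≤ n) {w : ℕ → ℝ} (hw0 : ∀ k, 0 ≤ w k) (hw : ∀ k, w k ≤ 1)
    {F G : (Fin n → X) → ℝ} (hF : BM F) (hG : BM G) (ω : Fin n → X) (c r : ℝ)
    (h : ∀ i j v, j ≠ i → M.rel (ω i) v → |(F ω - F (Function.update ω j v)) -
      c * (G ω - G (Function.update ω j v))| ≤ r) :
    |M.DD w F ω - c * M.DD w G ω| ≤ n * r := by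
  have hp := M.p_pos
  have hm : (0:ℝ) < (n - 1 : ℕ) := by exact_mod_cast (by omega : 0 < n - 1)
  have hmu : ∀ j : Fin n, Measurable (fun v : X => Function.update ω j v) := fun j =>
    (meas_update j).comp (measurable_const.prodMk measurable_id)
  have hr : 0 ≤ r := (abs_nonneg _).trans
    (h ⟨0, by omega⟩ ⟨1, by omega⟩ (ω ⟨0, by omega⟩) (by simp) (M.refl _))
  unfold DD
  rw [Finset.mul_sum, ← Finset.sum_sub_distrib]
  refine (Finset.abs_sum_le_sum_abs _ _).trans ?_
  have hi : ∀ i ∈ (Finset.univ : Finset (Fin n)), |w (M.NN Finset.univ ω i) *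
      ((1 / ((n - 1 : ℕ) * M.p)) * ∑ j ∈ Finset.univ.erase i,
        ∫ v, M.ri (ω i) v * (F ω - F (Function.update ω j v)) ∂ν) -
      c * (w (M.NN Finset.univ ω i) * ((1 / ((n - 1 : ℕ) * M.p)) * ∑ j ∈ Finset.univ.erase i,
        ∫ v, M.ri (ω i) v * (G ω - G (Function.update ω j v)) ∂ν))| ≤ r := by
    intro i _
    have e : w (M.NN Finset.univ ω i) *
      ((1 / ((n - 1 : ℕ) * M.p)) * ∑ j ∈ Finset.univ.erase i,
        ∫ v, M.ri (ω i) v * (F ω - F (Function.update ω j v)) ∂ν) -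
      c * (w (M.NN Finset.univ ω i) * ((1 / ((n - 1 : ℕ) * M.p)) * ∑ j ∈ Finset.univ.erase i,
        ∫ v, M.ri (ω i) v * (G ω - G (Function.update ω j v)) ∂ν)) =
      w (M.NN Finset.univ ω i) *
      ((1 / ((n - 1 : ℕ) * M.p)) * ∑ j ∈ Finset.univ.erase i,
        (∫ v, M.ri (ω i) v * (F ω - F (Function.update ω j v)) ∂ν -
        c * ∫ v, M.ri (ω i) v * (G ω - G (Function.update ω j v)) ∂ν)) := by
      rw [Finset.sum_sub_distrib, ← Finset.mul_sum]; ring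
    rw [e, abs_mul, abs_mul, abs_of_nonneg (hw0 _), abs_of_nonneg (by positivity)]
    refine (mul_le_of_le_one_left (by positivity) (hw _)).trans ?_
    rw [one_div, inv_mul_le_iff₀ (by positivity)]
    refine (Finset.abs_sum_le_sum_abs _ _).trans ?_
    have : ∀ j ∈ Finset.univ.erase i,
        |∫ v, M.ri (ω i) v * (F ω - F (Function.update ω j v)) ∂ν -
        c * ∫ v, M.ri (ω i) v * (G ω - G (Function.update ω j v)) ∂ν| ≤ M.p * r := by
      intro j hj
      have b1 : BM (fun v => M.ri (ω i) v * (F ω - F (Function.update ω j v))) :=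
        (M.ri_BM1 _).mul ((BM.const _).sub (hF.comp (hmu j)))
      have b2 : BM (fun v => M.ri (ω i) v * (G ω - G (Function.update ω j v))) :=
        (M.ri_BM1 _).mul ((BM.const _).sub (hG.comp (hmu j)))
      rw [← integral_const_mul, ← integral_sub (b1.integrable ν)
        (((BM.const c).mul b2).integrable ν), ← M.int_ri (ω i), ← integral_mul_const]
      refine abs_integral_le_integral_abs.trans ?_
      apply integral_mono ((b1.sub ((BM.const c).mul b2)).abs.integrable ν)
        (((M.ri_BM1 _).mul (BM.const r)).integrable ν)
      intro v
      beta_reduce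
      by_cases hv : M.rel (ω i) v
      · simpa [ri, hv] using h i j v (Finset.ne_of_mem_erase hj) hv
      · simp [ri, hv]
    refine (Finset.sum_le_sum this).trans ?_
    simp only [Finset.sum_const, Finset.card_erase_of_mem (Finset.mem_univ i), Finset.card_univ,
      Fintype.card_fin, nsmul_eq_mul]
    exact le_of_eq (by ring)
  refine (Finset.sum_le_sum hi).trans ?_
  simp

end GM



namespace GM

/-- average near count -/
def tt {X : Type*} [MeasurableSpace X] {ν : Measure X} (M : GM X ν) {n : ℕ}
    (J : Finset (Fin n)) (ω : Fin n → X) (i : Fin n) : ℝ :=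
  (1 / M.p) * ∫ v, M.ri (ω i) v * M.ss J ω v ∂ν

/-- degree weight -/
def rho (k : ℕ) : ℝ := (1 - (if k = 0 then (1:ℝ) else 0)) + if k = 1 then 1 else 0

lemma rho_nonneg (k : ℕ) : 0 ≤ rho k := by
  unfold rho; split_ifs <;> norm_num
lemma rho_le (k : ℕ) : rho k ≤ 2 := by
  unfold rho; split_ifs <;> norm_num

/-- main part of H -/
def H0 {X : Type*} [MeasurableSpace X] {ν : Measure X} (M : GM X ν) {n : ℕ} (w : ℕ → ℝ)
    (J : Finset (Fin n)) (ω : Fin n → X) : ℝ :=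
  ∑ i ∈ J, w (M.NN J ω i) * (1 + M.tt J ω i) -
    (∑ i ∈ J, w (M.NN J ω i)) * (∑ i ∈ J, rho (M.NN J ω i)) / (n - 1 : ℕ)

/-- number of rel3 neighbours -/
def M3 {X : Type*} [MeasurableSpace X] {ν : Measure X} (M : GM X ν) {n : ℕ}
    (ω : Fin n → X) (k : Fin n) : ℝ :=
  ∑ l ∈ Finset.univ.erase k, if M.rel3 (ω k) (ω l) then (1:ℝ) else 0

lemma M3_nonneg {X : Type*} [MeasurableSpace X] {ν : Measure X} (M : GM X ν) {n : ℕ}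
    (ω : Fin n → X) (k : Fin n) : 0 ≤ M.M3 ω k :=
  Finset.sum_nonneg fun i _ => by split_ifs <;> norm_num

lemma M3_BM {X : Type*} [MeasurableSpace X] {ν : Measure X} (M : GM X ν) {n : ℕ}
    (k : Fin n) : BM (fun ω : Fin n → X => M.M3 ω k) :=
  BM.sum _ fun l _ => BM.ite (M.meas_rel3 (measurable_pi_apply k) (measurable_pi_apply l))

lemma ss_BM {X : Type*} [MeasurableSpace X] {ν : Measure X} (M : GM X ν) {n : ℕ}
    (J : Finset (Fin n)) : BM (fun z : (Fin n → X) × X => (M.ss J z.1 z.2 : ℝ)) :=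
  ⟨measurable_from_top.comp (M.meas_ss J), M.κ, fun z => by
    rw [abs_of_nonneg (Nat.cast_nonneg _)]; exact Nat.cast_le.2 (M.ss_le J z.1 z.2)⟩

lemma ss_BM1 {X : Type*} [MeasurableSpace X] {ν : Measure X} (M : GM X ν) {n : ℕ}
    (J : Finset (Fin n)) (ω : Fin n → X) : BM (fun v => (M.ss J ω v : ℝ)) :=
  (M.ss_BM J).comp (g := fun v => (ω, v)) (measurable_const.prodMk measurable_id)

lemma tt_BM {X : Type*} [MeasurableSpace X] {ν : Measure X} [IsProbabilityMeasure ν]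
    (M : GM X ν) {n : ℕ} (J : Finset (Fin n)) (i : Fin n) :
    BM (fun ω : Fin n → X => M.tt J ω i) :=
  (BM.const _).mul (BM.int (f := fun z : (Fin n → X) × X => M.ri (z.1 i) z.2 * M.ss J z.1 z.2)
    ((M.ri_BM ((measurable_pi_apply i).comp measurable_fst) measurable_snd).mul (M.ss_BM J)) ν)

lemma H0_BM {X : Type*} [MeasurableSpace X] {ν : Measure X} [IsProbabilityMeasure ν]
    (M : GM X ν) {n : ℕ} {w : ℕ → ℝ} (hw : ∀ k, |w k| ≤ 1) (J : Finset (Fin n)) :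
    BM (M.H0 w J) := by
  unfold H0
  simp only [div_eq_mul_inv]
  have h1 : ∀ i, BM (fun ω : Fin n → X => w (M.NN J ω i)) := fun i => BM.nat (M.meas_NN J i) w hw
  exact (BM.sum _ fun i _ => (h1 i).mul ((BM.const 1).add (M.tt_BM J i))).sub
    (((BM.sum _ fun i _ => h1 i).mul (BM.sum _ fun i _ => BM.nat (M.meas_NN J i) rho (C := 2)
      fun k => by rw [abs_of_nonneg (rho_nonneg k)]; exact rho_le k)).mul (BM.const _))

lemma tt_nonneg {X : Type*} [MeasurableSpace X] {ν : Measure X} (M : GM X ν) {n : ℕ}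
    (J : Finset (Fin n)) (ω : Fin n → X) (i : Fin n) : 0 ≤ M.tt J ω i := by
  have := M.p_pos
  refine mul_nonneg (by positivity) (integral_nonneg fun v => ?_)
  exact mul_nonneg (by unfold ri; split_ifs <;> norm_num) (Nat.cast_nonneg _)

lemma tt_le {X : Type*} [MeasurableSpace X] {ν : Measure X} [IsProbabilityMeasure ν]
    (M : GM X ν) {n : ℕ} (J : Finset (Fin n)) (ω : Fin n → X) (i : Fin n) : M.tt J ω i ≤ M.κ := by
  have := M.p_pos
  unfold tt
  rw [one_div, inv_mul_le_iff₀ M.p_pos, ← M.int_ri (ω i), ← integral_mul_const]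
  apply integral_mono (((M.ri_BM1 _).mul (M.ss_BM1 J ω)).integrable ν)
    (((M.ri_BM1 _).mul (BM.const _)).integrable ν)
  intro v
  apply mul_le_mul_of_nonneg_left _ (by unfold ri; split_ifs <;> norm_num)
  exact Nat.cast_le.2 (M.ss_le J ω v)

lemma H0_upd {X : Type*} [MeasurableSpace X] {ν : Measure X} (M : GM X ν) {n : ℕ} (w : ℕ → ℝ)
    (k : Fin n) (ω : Fin n → X) (v : X) : M.H0 w (Finset.univ.erase k) (Function.update ω k v) =
      M.H0 w (Finset.univ.erase k) ω := by
  have h1 : ∀ i ∈ Finset.univ.erase k, M.NN (Finset.univ.erase k) (Function.update ω k v) i =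
    M.NN (Finset.univ.erase k) ω i := fun i hi =>
      M.NN_upd ω (Finset.notMem_erase _ _) (Finset.ne_of_mem_erase hi) v
  have h2 : ∀ i ∈ Finset.univ.erase k, M.tt (Finset.univ.erase k) (Function.update ω k v) i =
    M.tt (Finset.univ.erase k) ω i := by
    intro i hi
    unfold tt
    rw [Function.update_of_ne (Finset.ne_of_mem_erase hi)]
    simp_rw [M.ss_upd ω (Finset.notMem_erase _ _)]
  unfold H0
  congr 1
  · exact Finset.sum_congr rfl fun i hi => by rw [h1 i hi, h2 i hi]
  · congr 2
    · exact Finset.sum_congr rfl fun i hi => by rw [h1 i hi]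
    · exact Finset.sum_congr rfl fun i hi => by rw [h1 i hi]

lemma diff_sum {X : Type*} [MeasurableSpace X] {ν : Measure X} (M : GM X ν) {n : ℕ}
    (ω : Fin n → X) (k : Fin n) (f g : Fin n → ℝ) {B : ℝ} (hf : ∀ i, 0 ≤ f i) (hf1 : ∀ i, f i ≤ B)
    (hg : ∀ i, 0 ≤ g i) (hg1 : ∀ i, g i ≤ B)
    (h : ∀ i, i ≠ k → ¬ M.rel3 (ω k) (ω i) → f i = g i) :
    |∑ i, f i - ∑ i ∈ Finset.univ.erase k, g i| ≤ B * (1 + M.M3 ω k) := by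
  rw [← Finset.sum_erase_add _ _ (Finset.mem_univ k)]
  have e : ∑ i ∈ Finset.univ.erase k, f i + f k - ∑ i ∈ Finset.univ.erase k, g i =
      f k + ∑ i ∈ Finset.univ.erase k, (f i - g i) := by rw [Finset.sum_sub_distrib]; ring
  rw [e]
  refine (abs_add_le _ _).trans ?_
  have h1 : |f k| ≤ B := by rw [abs_of_nonneg (hf k)]; exact hf1 k
  have h2 : |∑ i ∈ Finset.univ.erase k, (f i - g i)| ≤ B * M.M3 ω k := by
    refine (Finset.abs_sum_le_sum_abs _ _).trans ?_
    unfold M3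
    rw [Finset.mul_sum]
    apply Finset.sum_le_sum
    intro i hi
    by_cases hr : M.rel3 (ω k) (ω i)
    · simp only [hr, if_true, mul_one]
      rw [abs_le]
      have := hf i; have := hf1 i; have := hg i; have := hg1 i
      constructor <;> linarith
    · simp [hr, h i (Finset.ne_of_mem_erase hi) hr]
  linarith

lemma loc_NN {X : Type*} [MeasurableSpace X] {ν : Measure X} (M : GM X ν) {n : ℕ}
    (ω : Fin n → X) {i k : Fin n} (hik : i ≠ k) (h : ¬ M.rel3 (ω k) (ω i)) :
    M.NN Finset.univ ω i = M.NN (Finset.univ.erase k) ω i := by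
  have : ¬ M.rel (ω i) (ω k) := fun hr => h
    (M.trans3 _ _ _ _ (M.symm _ _ hr) (M.refl _) (M.refl _))
  rw [M.NN_erase ω hik, if_neg this, add_zero]

lemma loc_ss {X : Type*} [MeasurableSpace X] {ν : Measure X} (M : GM X ν) {n : ℕ}
    (ω : Fin n → X) {i k : Fin n} (h : ¬ M.rel3 (ω k) (ω i)) {v : X} (hv : M.rel (ω i) v) :
    M.ss Finset.univ ω v = M.ss (Finset.univ.erase k) ω v := by
  unfold ss
  rw [Finset.card_filter, Finset.card_filter, ← Finset.sum_erase_add _ _ (Finset.mem_univ k)]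
  have h1 : ¬ M.rel v (ω k) := fun hr => h
    (M.trans3 _ _ _ _ (M.symm _ _ hr) (M.symm _ _ hv) (M.refl _))
  simp only [h1, and_false, if_false, add_zero]
  apply Finset.sum_congr rfl
  intro l hl
  by_cases hlv : M.rel v (ω l)
  · have : ¬ M.rel (ω l) (ω k) := fun hr => h
      (M.trans3 _ _ _ _ (M.symm _ _ hr) (M.symm _ _ hlv) (M.symm _ _ hv))
    rw [M.NN_erase ω (Finset.ne_of_mem_erase hl), if_neg this, add_zero]
  · simp [hlv]

lemma H0_diff {X : Type*} [MeasurableSpace X] {ν : Measure X} [IsProbabilityMeasure ν]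
    (M : GM X ν) {n : ℕ} (hn : 2 ≤ n)
    {w : ℕ → ℝ} (hw0 : ∀ k, 0 ≤ w k) (hw : ∀ k, w k ≤ 1) (ω : Fin n → X) (k : Fin n) :
    |M.H0 w Finset.univ ω - M.H0 w (Finset.univ.erase k) ω| ≤
      (1 + M.κ + 4 * n / (n - 1 : ℕ)) * (1 + M.M3 ω k) := by
  have hm : (0:ℝ) < (n - 1 : ℕ) := by exact_mod_cast (by omega : 0 < n - 1)
  set m : ℝ := ((n - 1 : ℕ) : ℝ)
  have hM3 := M.M3_nonneg ω k
  have q1 := M.diff_sum ω k (fun i => w (M.NN Finset.univ ω i) * (1 + M.tt Finset.univ ω i))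
    (fun i => w (M.NN (Finset.univ.erase k) ω i) * (1 + M.tt (Finset.univ.erase k) ω i))
    (B := 1 + M.κ) (fun i => mul_nonneg (hw0 _) (by have := M.tt_nonneg Finset.univ ω i; linarith))
    (fun i => by
      have := M.tt_nonneg Finset.univ ω i; have := M.tt_le Finset.univ ω i
      exact (mul_le_of_le_one_left (by linarith) (hw _)).trans (by linarith))
    (fun i => mul_nonneg (hw0 _) (by have := M.tt_nonneg (Finset.univ.erase k) ω i; linarith))
    (fun i => by
      have := M.tt_nonneg (Finset.univ.erase k) ω i; have := M.tt_le (Finset.univ.erase k) ω i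
      exact (mul_le_of_le_one_left (by linarith) (hw _)).trans (by linarith))
    (fun i hi hr => by
      have : M.tt Finset.univ ω i = M.tt (Finset.univ.erase k) ω i := by
        unfold tt
        congr 2
        ext v
        by_cases hv : M.rel (ω i) v
        · rw [M.loc_ss ω hr hv]
        · simp [ri, hv]
      beta_reduce
      rw [M.loc_NN ω hi hr, this])
  have q2 := M.diff_sum ω k (fun i => w (M.NN Finset.univ ω i))
    (fun i => w (M.NN (Finset.univ.erase k) ω i)) (B := 1) (fun i => hw0 _) (fun i => hw _)
    (fun i => hw0 _) (fun i => hw _) (fun i hi hr => by beta_reduce; rw [M.loc_NN ω hi hr])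
  have q3 := M.diff_sum ω k (fun i => rho (M.NN Finset.univ ω i))
    (fun i => rho (M.NN (Finset.univ.erase k) ω i)) (B := 2) (fun i => rho_nonneg _)
    (fun i => rho_le _) (fun i => rho_nonneg _) (fun i => rho_le _)
    (fun i hi hr => by beta_reduce; rw [M.loc_NN ω hi hr])
  have b1 : |∑ i, rho (M.NN Finset.univ ω i)| ≤ 2 * n := by
    rw [abs_of_nonneg (Finset.sum_nonneg fun i _ => rho_nonneg _)]
    refine (Finset.sum_le_sum fun i _ => rho_le _).trans ?_
    simp [mul_comm]
  have b2 : |∑ i ∈ Finset.univ.erase k, w (M.NN (Finset.univ.erase k) ω i)| ≤ n := by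
    rw [abs_of_nonneg (Finset.sum_nonneg fun i _ => hw0 _)]
    refine (Finset.sum_le_sum fun i _ => hw _).trans ?_
    simp
  unfold H0
  beta_reduce at q1 q2 q3
  set Q := ∑ i, w (M.NN Finset.univ ω i) * (1 + M.tt Finset.univ ω i)
  set Q' := ∑ i ∈ Finset.univ.erase k, w (M.NN (Finset.univ.erase k) ω i) *
    (1 + M.tt (Finset.univ.erase k) ω i)
  set A := ∑ i, w (M.NN Finset.univ ω i)
  set A' := ∑ i ∈ Finset.univ.erase k, w (M.NN (Finset.univ.erase k) ω i)
  set R := ∑ i, rho (M.NN Finset.univ ω i)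
  set R' := ∑ i ∈ Finset.univ.erase k, rho (M.NN (Finset.univ.erase k) ω i)
  have e : Q - A * R / m - (Q' - A' * R' / m) =
    (Q - Q') - ((A - A') * R + A' * (R - R')) / m := by ring
  rw [e]
  have c1 : |((A - A') * R + A' * (R - R')) / m| ≤ 4 * n / m * (1 + M.M3 ω k) := by
    rw [abs_div, abs_of_pos hm, div_le_iff₀ hm]
    calc _ ≤ |A - A'| * |R| + |A'| * |R - R'| := by
          rw [← abs_mul, ← abs_mul]; exact abs_add_le _ _
      _ ≤ (1 * (1 + M.M3 ω k)) * (2 * n) + n * (2 * (1 + M.M3 ω k)) := by gcongr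
      _ = _ := by field_simp; ring
  calc _ ≤ _ := abs_sub _ _
    _ ≤ _ := add_le_add q1 c1
    _ = _ := by ring

lemma ss_sum_diff {X : Type*} [MeasurableSpace X] {ν : Measure X} (M : GM X ν) {n : ℕ}
    (ω : Fin n → X) {i : Fin n} {v : X} (hv : M.rel (ω i) v) :
    ∑ j, |(M.ss (Finset.univ.erase j) ω v : ℝ) - M.ss Finset.univ ω v| ≤ 1 + M.M3 ω i := by
  have h1 : ∀ j, |(M.ss (Finset.univ.erase j) ω v : ℝ) - M.ss Finset.univ ω v| ≤
      (if M.NN Finset.univ ω j = 0 ∧ M.rel v (ω j) then (1:ℝ) else 0) +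
      ∑ l, if (M.NN Finset.univ ω l = 1 ∧ M.rel v (ω l)) ∧ (j ≠ l ∧ M.rel (ω l) (ω j))
        then (1:ℝ) else 0 := by
    intro j
    unfold ss
    rw [Finset.card_filter, Finset.card_filter, ← Finset.sum_erase_add Finset.univ _ (Finset.mem_univ j),
      ← Finset.sum_erase_add Finset.univ (a := j) (fun l => if (M.NN Finset.univ ω l = 1 ∧ M.rel v (ω l)) ∧
        (j ≠ l ∧ M.rel (ω l) (ω j)) then (1:ℝ) else 0) (Finset.mem_univ j)]
    push_cast
    have : ∀ l ∈ Finset.univ.erase j, (if (M.NN Finset.univ ω l = 1 ∧ M.rel v (ω l)) ∧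
        (j ≠ l ∧ M.rel (ω l) (ω j)) then (1:ℝ) else 0) =
        (if M.NN (Finset.univ.erase j) ω l = 0 ∧ M.rel v (ω l) then (1:ℝ) else 0) -
        (if M.NN Finset.univ ω l = 0 ∧ M.rel v (ω l) then (1:ℝ) else 0) := by
      intro l hl
      have hjl : ¬ (j = l) := (Finset.ne_of_mem_erase hl).symm
      rw [M.NN_erase ω (Finset.ne_of_mem_erase hl)]
      by_cases hr : M.rel (ω l) (ω j) <;> by_cases hv : M.rel v (ω l) <;> simp [hr, hv, hjl]
    rw [Finset.sum_congr rfl this, Finset.sum_sub_distrib, abs_le]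
    have p1 : 0 ≤ ∑ l ∈ Finset.univ.erase j,
        (if M.NN (Finset.univ.erase j) ω l = 0 ∧ M.rel v (ω l) then (1:ℝ) else 0) -
        ∑ l ∈ Finset.univ.erase j,
        (if M.NN Finset.univ ω l = 0 ∧ M.rel v (ω l) then (1:ℝ) else 0) := by
      rw [← Finset.sum_sub_distrib]
      apply Finset.sum_nonneg
      intro l hl
      rw [← this l hl]; split_ifs <;> norm_num
    have p2 : (0:ℝ) ≤ if M.NN Finset.univ ω j = 0 ∧ M.rel v (ω j) then (1:ℝ) else 0 := by
      split_ifs <;> norm_num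
    simp only [ne_eq, not_true_eq_false, false_and, and_false, if_false, add_zero]
    constructor <;> linarith
  refine (Finset.sum_le_sum fun j _ => h1 j).trans ?_
  rw [Finset.sum_add_distrib, Finset.sum_comm, ← Finset.sum_add_distrib]
  have h2 : ∀ l : Fin n, ((if M.NN Finset.univ ω l = 0 ∧ M.rel v (ω l) then (1:ℝ) else 0) +
      ∑ j, if (M.NN Finset.univ ω l = 1 ∧ M.rel v (ω l)) ∧ (j ≠ l ∧ M.rel (ω l) (ω j))
        then (1:ℝ) else 0) ≤ if M.rel v (ω l) then (1:ℝ) else 0 := by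
    intro l
    by_cases hv : M.rel v (ω l)
    · by_cases hN : M.NN Finset.univ ω l = 1
      · have h' := hN
        unfold NN at h'
        rw [Finset.card_filter] at h'
        have h'' : ∑ j, (if j ≠ l ∧ M.rel (ω l) (ω j) then (1:ℝ) else 0) = 1 := by
          exact_mod_cast h'
        simp only [hN, hv, true_and, if_true, h'']
        norm_num
      · simp only [hN, hv, false_and, and_true, if_true, if_false]
        split_ifs <;> simp
    · simp [hv]
  refine (Finset.sum_le_sum fun j _ => h2 j).trans ?_
  rw [← Finset.sum_erase_add _ _ (Finset.mem_univ i), add_comm]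
  unfold M3
  apply add_le_add
  · split_ifs <;> norm_num
  · apply Finset.sum_le_sum
    intro l _
    by_cases h : M.rel v (ω l)
    · have := M.trans3 _ _ _ _ hv h (M.refl _)
      simp [h, this]
    · simp only [h, if_false]; split_ifs <;> norm_num

lemma H_H0 {X : Type*} [MeasurableSpace X] {ν : Measure X} [IsProbabilityMeasure ν]
    (M : GM X ν) {n : ℕ} (hn : 2 ≤ n)
    {w : ℕ → ℝ} (hw0 : ∀ k, 0 ≤ w k) (hw : ∀ k, w k ≤ 1) (ω : Fin n → X) :
    |M.DD w (fun ω => (M.SJ Finset.univ ω : ℝ)) ω - M.H0 w Finset.univ ω| ≤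
      (∑ i, (M.κ + 2 + M.M3 ω i)) / (n - 1 : ℕ) := by
  have hm : (0:ℝ) < (n - 1 : ℕ) := by exact_mod_cast (by omega : 0 < n - 1)
  have hp := M.p_pos
  unfold DD H0
  have eR : ∑ k, rho (M.NN Finset.univ ω k) = ∑ k, M.rr ω k := (M.sum_rr ω).symm
  rw [eR, Finset.sum_mul, Finset.sum_div, Finset.sum_div, ← Finset.sum_sub_distrib,
    ← Finset.sum_sub_distrib]
  refine (Finset.abs_sum_le_sum_abs _ _).trans (Finset.sum_le_sum fun i _ => ?_)
  have bs : ∀ J, BM (fun v => M.ri (ω i) v * (M.ss J ω v : ℝ)) := fun J =>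
    (M.ri_BM1 _).mul (M.ss_BM1 J ω)
  have e1 : ∀ j ∈ Finset.univ.erase i, ∫ v, M.ri (ω i) v * ((M.SJ Finset.univ ω : ℝ) -
      M.SJ Finset.univ (Function.update ω j v)) ∂ν =
      M.p + ∫ v, M.ri (ω i) v * M.ss (Finset.univ.erase j) ω v ∂ν - M.p * M.rr ω j := by
    intro j hj
    have : ∀ v, M.ri (ω i) v * ((M.SJ Finset.univ ω : ℝ) -
      M.SJ Finset.univ (Function.update ω j v)) = M.ri (ω i) v * (1 - M.rr ω j) +
        M.ri (ω i) v * M.ss (Finset.univ.erase j) ω v := by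
      intro v
      by_cases hv : M.rel (ω i) v
      · rw [M.S_diff ω (Finset.ne_of_mem_erase hj) hv]; ring
      · simp [ri, hv]
    simp_rw [this]
    rw [integral_add (((M.ri_BM1 _).mul (BM.const _)).integrable ν) ((bs _).integrable ν),
      integral_mul_const, M.int_ri]
    ring
  rw [Finset.sum_congr rfl e1, Finset.sum_sub_distrib, Finset.sum_add_distrib]
  set m : ℝ := ((n - 1 : ℕ) : ℝ) with hmdef
  have e2 : ∑ j ∈ Finset.univ.erase i, M.p = m * M.p := by
    simp [hmdef]
  have e3 : ∑ j ∈ Finset.univ.erase i, ∫ v, M.ri (ω i) v * M.ss Finset.univ ω v ∂ν =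
      m * M.p * M.tt Finset.univ ω i := by
    simp only [Finset.sum_const, Finset.card_erase_of_mem (Finset.mem_univ i), Finset.card_univ,
      Fintype.card_fin, nsmul_eq_mul, tt]
    rw [← hmdef]; field_simp
  have e4 : ∑ j ∈ Finset.univ.erase i, M.p * M.rr ω j = M.p * (∑ j, M.rr ω j - M.rr ω i) := by
    rw [← Finset.mul_sum, ← Finset.sum_erase_add Finset.univ _ (Finset.mem_univ i)]; ring
  rw [e2, e4]
  set A := ∑ j ∈ Finset.univ.erase i, ∫ v, M.ri (ω i) v * M.ss (Finset.univ.erase j) ω v ∂ν with hA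
  have e5 : |A - m * M.p * M.tt Finset.univ ω i| ≤ M.p * (1 + M.M3 ω i) := by
    rw [hA, ← e3, ← Finset.sum_sub_distrib]
    have : ∀ j ∈ Finset.univ.erase i, ∫ v, M.ri (ω i) v * M.ss (Finset.univ.erase j) ω v ∂ν -
        ∫ v, M.ri (ω i) v * M.ss Finset.univ ω v ∂ν = ∫ v, M.ri (ω i) v *
          ((M.ss (Finset.univ.erase j) ω v : ℝ) - M.ss Finset.univ ω v) ∂ν := by
      intro j _
      rw [← integral_sub ((bs _).integrable ν) ((bs _).integrable ν)]
      simp_rw [mul_sub]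
    rw [Finset.sum_congr rfl this, ← integral_finsetSum _ fun j _ => ((M.ri_BM1 _).mul
      ((M.ss_BM1 _ ω).sub (M.ss_BM1 _ ω))).integrable ν, ← M.int_ri (ω i), ← integral_mul_const]
    refine abs_integral_le_integral_abs.trans ?_
    apply integral_mono ((BM.sum _ fun j _ => ((M.ri_BM1 _).mul
      ((M.ss_BM1 _ ω).sub (M.ss_BM1 _ ω)))).abs.integrable ν)
        (((M.ri_BM1 _).mul (BM.const _)).integrable ν)
    intro v
    beta_reduce
    rw [← Finset.mul_sum]
    by_cases hv : M.rel (ω i) v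
    · simp only [ri, hv, if_true, one_mul]
      refine (Finset.abs_sum_le_sum_abs _ _).trans (le_trans ?_ (M.ss_sum_diff ω hv))
      exact Finset.sum_le_sum_of_subset_of_nonneg (Finset.erase_subset _ _)
        fun _ _ _ => abs_nonneg _
    · simp [ri, hv]
  have e6 : w (M.NN Finset.univ ω i) * (1 / (m * M.p) * (m * M.p + A -
      M.p * (∑ j, M.rr ω j - M.rr ω i))) - (w (M.NN Finset.univ ω i) * (1 + M.tt Finset.univ ω i) -
      (w (M.NN Finset.univ ω i) * ∑ k, M.rr ω k) / m) =
      w (M.NN Finset.univ ω i) * (((A - m * M.p * M.tt Finset.univ ω i) + M.p * M.rr ω i) /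
        (m * M.p)) := by
    field_simp
    ring
  rw [e6]
  rw [abs_mul, abs_of_nonneg (hw0 _)]
  refine (mul_le_of_le_one_left (abs_nonneg _) (hw _)).trans ?_
  rw [abs_div, abs_of_pos (mul_pos hm hp), div_le_div_iff₀ (mul_pos hm hp) hm]
  have h1 := M.rr_le ω i
  have h2 := M.rr_nonneg ω i
  have h3 : |A - m * M.p * M.tt Finset.univ ω i + M.p * M.rr ω i| ≤
      M.p * (M.κ + 2 + M.M3 ω i) := by
    refine (abs_add_le _ _).trans ?_
    rw [abs_of_nonneg (mul_nonneg hp.le h2)]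
    have := mul_le_mul_of_nonneg_left h1 hp.le
    linarith
  calc _ ≤ M.p * (M.κ + 2 + M.M3 ω i) * m := by gcongr
    _ = _ := by ring

end GM



namespace GM

/-- rel3 indicator -/
def r3 {X : Type*} [MeasurableSpace X] {ν : Measure X} (M : GM X ν) (x v : X) : ℝ :=
  if M.rel3 x v then 1 else 0

lemma r3_BM {X Ω : Type*} [MeasurableSpace X] [MeasurableSpace Ω] {ν : Measure X}
    (M : GM X ν) {f g : Ω → X} (hf : Measurable f) (hg : Measurable g) :
    BM (fun x => M.r3 (f x) (g x)) := BM.ite (M.meas_rel3 hf hg)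

lemma r3_nonneg {X : Type*} [MeasurableSpace X] {ν : Measure X} (M : GM X ν) (x v : X) :
    0 ≤ M.r3 x v := by unfold r3; split_ifs <;> norm_num

lemma int_r3 {X : Type*} [MeasurableSpace X] {ν : Measure X} (M : GM X ν) (x : X) :
    ∫ v, M.r3 x v ∂ν ≤ M.p3 := by
  have h : MeasurableSet {y | M.rel3 x y} := M.meas_rel3 measurable_const measurable_id
  refine le_trans (le_of_eq ?_) (M.prob3 x)
  rw [← integral_indicator_one h]
  rfl

lemma p3_nonneg {X : Type*} [MeasurableSpace X] {ν : Measure X} [IsProbabilityMeasure ν]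
    (M : GM X ν) : 0 ≤ M.p3 := by
  obtain ⟨x⟩ : Nonempty X := by
    by_contra h
    rw [not_nonempty_iff] at h
    have := measure_univ (μ := ν)
    rw [Set.univ_eq_empty_iff.2 h] at this
    simp at this
  exact measureReal_nonneg.trans (M.prob3 x)

lemma int_r3_mul {X : Type*} [MeasurableSpace X] {ν : Measure X} [IsProbabilityMeasure ν]
    (M : GM X ν) {n : ℕ} {k l : Fin n} (hl : l ≠ k) {G : (Fin n → X) → ℝ} (hG : BM G)
    (hG0 : ∀ ω, 0 ≤ G ω) (hGl : ∀ ω v, G (Function.update ω l v) = G ω) :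
    ∫ ω, G ω * M.r3 (ω k) (ω l) ∂(PL ν n) ≤ (∫ ω, G ω ∂(PL ν n)) * M.p3 := by
  have b1 : BM (fun ω : Fin n → X => G ω * M.r3 (ω k) (ω l)) :=
    hG.mul (M.r3_BM (measurable_pi_apply k) (measurable_pi_apply l))
  rw [int_AV ν l b1, ← integral_mul_const]
  refine integral_mono ((AV_BM ν l b1).integrable _) ((hG.mul (BM.const _)).integrable _) ?_
  intro ω
  simp only [AV, hGl, Function.update_self, Function.update_of_ne hl.symm]
  rw [integral_const_mul]
  exact mul_le_mul_of_nonneg_left (M.int_r3 _) (hG0 ω)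

lemma M3_eq {X : Type*} [MeasurableSpace X] {ν : Measure X} (M : GM X ν) {n : ℕ}
    (ω : Fin n → X) (k : Fin n) : M.M3 ω k = ∑ l ∈ Finset.univ.erase k, M.r3 (ω k) (ω l) := rfl

lemma r3_int {X : Type*} [MeasurableSpace X] {ν : Measure X} [IsProbabilityMeasure ν]
    (M : GM X ν) {n : ℕ} {k l : Fin n} (hl : l ≠ k) :
    ∫ ω, M.r3 (ω k) (ω l) ∂(PL ν n) ≤ M.p3 := by
  have := M.int_r3_mul hl (G := fun _ => 1) (BM.const 1) (fun _ => zero_le_one) (fun _ _ => rfl)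
  simpa using this

lemma M3_int {X : Type*} [MeasurableSpace X] {ν : Measure X} [IsProbabilityMeasure ν]
    (M : GM X ν) {n : ℕ} (k : Fin n) :
    ∫ ω, M.M3 ω k ∂(PL ν n) ≤ (n - 1 : ℕ) * M.p3 := by
  simp only [M3_eq]
  rw [integral_finsetSum _ fun l _ =>
    (M.r3_BM (measurable_pi_apply k) (measurable_pi_apply l)).integrable _]
  refine (Finset.sum_le_card_nsmul _ _ M.p3 fun l hl => M.r3_int (Finset.ne_of_mem_erase hl)).trans ?_
  simp

lemma M3_sq {X : Type*} [MeasurableSpace X] {ν : Measure X} [IsProbabilityMeasure ν]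
    (M : GM X ν) {n : ℕ} (k : Fin n) :
    ∫ ω, (M.M3 ω k) ^ 2 ∂(PL ν n) ≤ (n - 1 : ℕ) * M.p3 + ((n - 1 : ℕ) * M.p3) ^ 2 := by
  have hb : ∀ l, BM (fun ω : Fin n → X => M.r3 (ω k) (ω l)) := fun l =>
    M.r3_BM (measurable_pi_apply k) (measurable_pi_apply l)
  have h3 := M.p3_nonneg
  simp only [M3_eq, sq (∑ l ∈ _, _), Finset.sum_mul_sum]
  rw [integral_finsetSum _ fun l _ => (BM.sum _ fun j _ => (hb l).mul (hb j)).integrable _]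
  have : ∀ l ∈ Finset.univ.erase k, ∫ ω, ∑ j ∈ Finset.univ.erase k,
      M.r3 (ω k) (ω l) * M.r3 (ω k) (ω j) ∂(PL ν n) ≤ M.p3 + (n - 1 : ℕ) * M.p3 ^ 2 := by
    intro l hl
    rw [integral_finsetSum _ fun j _ => ((hb l).mul (hb j)).integrable _,
      ← Finset.add_sum_erase _ _ hl]
    have e1 : ∫ ω, M.r3 (ω k) (ω l) * M.r3 (ω k) (ω l) ∂(PL ν n) ≤ M.p3 := by
      refine le_trans (le_of_eq ?_) (M.r3_int (Finset.ne_of_mem_erase hl))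
      congr 1; ext ω; unfold r3; split_ifs <;> norm_num
    have e2 : ∀ j ∈ (Finset.univ.erase k).erase l,
        ∫ ω, M.r3 (ω k) (ω l) * M.r3 (ω k) (ω j) ∂(PL ν n) ≤ M.p3 ^ 2 := by
      intro j hj
      rw [Finset.mem_erase] at hj
      have hjk := Finset.ne_of_mem_erase hj.2
      refine (M.int_r3_mul hjk (hb l) (fun ω => M.r3_nonneg _ _) ?_).trans ?_
      · intro ω v
        rw [Function.update_of_ne hjk.symm, Function.update_of_ne hj.1.symm]
      · rw [sq]
        exact mul_le_mul_of_nonneg_right (M.r3_int (Finset.ne_of_mem_erase hl)) h3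
    refine add_le_add e1 ((Finset.sum_le_card_nsmul _ _ _ e2).trans ?_)
    rw [nsmul_eq_mul]
    apply mul_le_mul_of_nonneg_right _ (sq_nonneg _)
    rw [Finset.card_erase_of_mem hl]
    simp only [Finset.card_erase_of_mem (Finset.mem_univ k), Finset.card_univ, Fintype.card_fin]
    exact_mod_cast Nat.sub_le _ _
  refine (Finset.sum_le_card_nsmul _ _ _ this).trans (le_of_eq ?_)
  simp only [Finset.card_erase_of_mem (Finset.mem_univ k), Finset.card_univ, Fintype.card_fin,
    nsmul_eq_mul]
  ring

lemma M3_one_sq {X : Type*} [MeasurableSpace X] {ν : Measure X} [IsProbabilityMeasure ν]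
    (M : GM X ν) {n : ℕ} (k : Fin n) :
    ∫ ω, (1 + M.M3 ω k) ^ 2 ∂(PL ν n) ≤
      1 + 3 * ((n - 1 : ℕ) * M.p3) + ((n - 1 : ℕ) * M.p3) ^ 2 := by
  have hb := M.M3_BM (n := n) k
  have e : ∀ ω : Fin n → X, (1 + M.M3 ω k) ^ 2 = (1 + 2 * M.M3 ω k) + (M.M3 ω k) ^ 2 := by
    intro ω; ring
  simp_rw [e]
  rw [integral_add (((BM.const 1).add ((BM.const 2).mul hb)).integrable _) ((hb.pow 2).integrable _),
    integral_add (integrable_const _) (((BM.const 2).mul hb).integrable _), integral_const_mul]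
  have h1 := M.M3_int (n := n) k
  have h2 := M.M3_sq (n := n) k
  simp only [integral_const, probReal_univ, smul_eq_mul]
  linarith

lemma var_H0 {X : Type*} [MeasurableSpace X] {ν : Measure X} [IsProbabilityMeasure ν]
    (M : GM X ν) {n : ℕ} (hn : 2 ≤ n)
    {w : ℕ → ℝ} (hw0 : ∀ k, 0 ≤ w k) (hw : ∀ k, w k ≤ 1) :
    ∫ ω, (M.H0 w Finset.univ ω) ^ 2 ∂(PL ν n) - (∫ ω, M.H0 w Finset.univ ω ∂(PL ν n)) ^ 2 ≤
      n * ((1 + M.κ + 4 * n / (n - 1 : ℕ)) ^ 2 *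
        (1 + 3 * ((n - 1 : ℕ) * M.p3) + ((n - 1 : ℕ) * M.p3) ^ 2)) := by
  have hwa : ∀ k, |w k| ≤ 1 := fun k => by rw [abs_of_nonneg (hw0 k)]; exact hw k
  have hb : ∀ J : Finset (Fin n), BM (M.H0 w J) := fun J => M.H0_BM hwa J
  refine (efron_stein ν (hb _) (fun k => hb (Finset.univ.erase k))
    (fun k ω v => M.H0_upd w k ω v)).trans ?_
  refine (Finset.sum_le_card_nsmul _ _ ((1 + M.κ + 4 * n / (n - 1 : ℕ)) ^ 2 *
        (1 + 3 * ((n - 1 : ℕ) * M.p3) + ((n - 1 : ℕ) * M.p3) ^ 2)) fun k _ => ?_).trans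
          (le_of_eq (by simp))
  refine le_trans ?_ (mul_le_mul_of_nonneg_left (M.M3_one_sq k) (sq_nonneg _))
  rw [← integral_const_mul]
  refine integral_mono ((((hb _).sub (hb _)).pow 2).integrable _)
    (((BM.const _).mul (((BM.const 1).add (M.M3_BM k)).pow 2)).integrable _) ?_
  intro ω
  beta_reduce
  rw [← mul_pow, ← sq_abs]
  exact pow_le_pow_left₀ (abs_nonneg _) (M.H0_diff hn hw0 hw ω k) 2

lemma abs_dev {X : Type*} [MeasurableSpace X] {ν : Measure X} [IsProbabilityMeasure ν]
    (M : GM X ν) {n : ℕ} (hn : 2 ≤ n)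
    {w : ℕ → ℝ} (hw0 : ∀ k, 0 ≤ w k) (hw : ∀ k, w k ≤ 1)
    {H : (Fin n → X) → ℝ} (hH : H = M.DD w (fun ω => (M.SJ Finset.univ ω : ℝ))) (hHB : BM H) :
    ∫ ω, |H ω - ∫ ω, H ω ∂(PL ν n)| ∂(PL ν n) ≤
      Real.sqrt n * ((1 + M.κ + 4 * n / (n - 1 : ℕ)) *
        Real.sqrt (1 + 3 * ((n - 1 : ℕ) * M.p3) + ((n - 1 : ℕ) * M.p3) ^ 2)) +
      2 * ((n / (n - 1 : ℕ)) * (M.κ + 2 + (n - 1 : ℕ) * M.p3)) := by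
  have hwa : ∀ k, |w k| ≤ 1 := fun k => by rw [abs_of_nonneg (hw0 k)]; exact hw k
  have hb : BM (M.H0 (n := n) w Finset.univ) := M.H0_BM hwa _
  have hv := M.var_H0 hn hw0 hw
  have hE : ∀ ω, |H ω - M.H0 w Finset.univ ω| ≤ (∑ i, (M.κ + 2 + M.M3 ω i)) / (n - 1 : ℕ) := by
    intro ω; rw [hH]; exact M.H_H0 hn hw0 hw ω
  have hm : (0:ℝ) < (n - 1 : ℕ) := by exact_mod_cast (by omega : 0 < n - 1)
  set m : ℝ := ((n - 1 : ℕ) : ℝ) with hmdef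
  set K := M.H0 (n := n) w Finset.univ with hK
  set e := ∫ ω, H ω ∂(PL ν n)
  set a := ∫ ω, K ω ∂(PL ν n) with ha
  have b1 : BM (fun ω => |H ω - K ω|) := (hHB.sub hb).abs
  have b2 : BM (fun ω => |K ω - a|) := (hb.sub (BM.const a)).abs
  have h1 : ∫ ω, |H ω - K ω| ∂(PL ν n) ≤ (n / m) * (M.κ + 2 + m * M.p3) := by
    have bb : ∀ i, BM (fun ω : Fin n → X => (M.κ + 2 + M.M3 ω i : ℝ)) := fun i =>
      ((BM.const ((M.κ : ℝ) + 2)).add (M.M3_BM i))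
    refine (integral_mono (b1.integrable _) (((BM.sum Finset.univ fun i _ => bb i).mul
      (BM.const m⁻¹)).integrable _) (g := fun ω => (∑ i, (M.κ + 2 + M.M3 ω i)) * m⁻¹) ?_).trans ?_
    · intro ω; exact hE ω
    · rw [integral_mul_const, integral_finsetSum _ fun i _ => (bb i).integrable _]
      have : ∀ i ∈ Finset.univ, ∫ ω : Fin n → X, (M.κ + 2 + M.M3 ω i : ℝ) ∂(PL ν n) ≤
          M.κ + 2 + m * M.p3 := by
        intro i _
        rw [integral_add (integrable_const _) ((M.M3_BM i).integrable _)]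
        simpa using M.M3_int (n := n) i
      have h := Finset.sum_le_card_nsmul _ _ _ this
      simp only [Finset.card_univ, Fintype.card_fin, nsmul_eq_mul] at h
      calc _ ≤ (n * (M.κ + 2 + m * M.p3)) * m⁻¹ := by gcongr
        _ = _ := by ring
  have h2 : ∫ ω, |K ω - a| ∂(PL ν n) ≤ Real.sqrt n * ((1 + M.κ + 4 * n / m) *
        Real.sqrt (1 + 3 * (m * M.p3) + (m * M.p3) ^ 2)) := by
    have hc : 0 ≤ 1 + (M.κ:ℝ) + 4 * n / m := by positivity
    have h3 := M.p3_nonneg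
    have : (∫ ω, |K ω - a| ∂(PL ν n)) ^ 2 ≤ n * ((1 + M.κ + 4 * n / m) ^ 2 *
        (1 + 3 * (m * M.p3) + (m * M.p3) ^ 2)) := by
      refine (sq_int_le _ b2).trans ?_
      refine le_trans (le_of_eq ?_) hv
      have e1 : ∀ ω, |K ω - a| ^ 2 = K ω ^ 2 - 2 * a * K ω + a ^ 2 := by
        intro ω; rw [sq_abs]; ring
      simp_rw [e1]
      rw [integral_add (((hb.pow 2).sub ((BM.const (2 * a)).mul hb)).integrable _)
        (integrable_const _), integral_sub ((hb.pow 2).integrable _)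
        (((BM.const (2 * a)).mul hb).integrable _), integral_const_mul, ← ha]
      simp only [integral_const, probReal_univ, smul_eq_mul]
      ring
    have := Real.abs_le_sqrt this
    refine (le_abs_self _).trans (this.trans (le_of_eq ?_))
    rw [Real.sqrt_mul (Nat.cast_nonneg _), Real.sqrt_mul (sq_nonneg _), Real.sqrt_sq hc]
  have h4 : |a - e| ≤ ∫ ω, |H ω - K ω| ∂(PL ν n) := by
    rw [abs_sub_comm, ha, ← integral_sub (hHB.integrable _) (hb.integrable _)]
    exact abs_integral_le_integral_abs
  have h5 : ∫ ω, |H ω - e| ∂(PL ν n) ≤ ∫ ω, (|H ω - K ω| + |K ω - a| + |a - e|) ∂(PL ν n) := by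
    refine integral_mono ((hHB.sub (BM.const e)).abs.integrable _)
      (((b1.add b2).add (BM.const _)).integrable _) ?_
    intro ω
    beta_reduce
    have := abs_add_three (H ω - K ω) (K ω - a) (a - e)
    rwa [show H ω - K ω + (K ω - a) + (a - e) = H ω - e by ring] at this
  rw [integral_add ((b1.add b2).integrable _) (integrable_const _),
    integral_add (b1.integrable _) (b2.integrable _)] at h5
  simp only [integral_const, probReal_univ, smul_eq_mul] at h5
  linarith

end GM



namespace GM

lemma S_BM {X : Type*} [MeasurableSpace X] {ν : Measure X} (M : GM X ν) {n : ℕ}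
    (h : ℕ → ℝ) : BM (fun ω : Fin n → X => h (M.SJ Finset.univ ω)) := by
  refine ⟨(measurable_from_top (f := h)).comp (M.meas_SJ Finset.univ),
    ∑ k ∈ Finset.range (n + 1), |h k|, fun ω => ?_⟩
  have hle : M.SJ Finset.univ ω ≤ n := by
    unfold SJ
    exact (Finset.card_filter_le _ _).trans (by simp)
  exact Finset.single_le_sum (f := fun k => |h k|) (fun k _ => abs_nonneg _)
    (Finset.mem_range.2 (Nat.lt_succ_of_le hle))

lemma ES_eq {X : Type*} [MeasurableSpace X] {ν : Measure X} [IsProbabilityMeasure ν]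
    (M : GM X ν) {n : ℕ} (hn : 2 ≤ n) :
    ∫ ω, (M.SJ Finset.univ ω : ℝ) ∂(PL ν n) = n * (1 - M.p) ^ (n - 1) := by
  obtain ⟨w, hw0, hw1, hw, hwr⟩ := weights_exist M.p_pos M.p_lt (m := n - 1) (by omega)
  have hwa : ∀ k, |w k| ≤ 1 := fun k => by rw [abs_of_nonneg (hw0 k)]; exact hw1 k
  have h := M.DD_key hn hwa hw hwr (F := fun _ => 1) (BM.const 1)
  have e : ∀ ω : Fin n → X, M.DD w (fun _ => 1) ω = 0 := by
    intro ω; simp [DD]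
  simp only [e, mul_one, integral_zero, mul_zero] at h
  rw [integral_sub ((M.S_BM (fun k => (k:ℝ))).integrable _) (integrable_const _)] at h
  simp only [integral_const, probReal_univ, smul_eq_mul, one_mul] at h
  linarith

lemma kol_bound {X : Type*} [MeasurableSpace X] {ν : Measure X} [IsProbabilityMeasure ν]
    (M : GM X ν) {n : ℕ} (hn : 2 ≤ n) {v : ℝ} (hv : 0 < v)
    (hvar : variance (fun ω : Fin n → X => (M.SJ Finset.univ ω : ℝ)) (PL ν n) = v) :
    kolDist (PL ν n) (fun ω : Fin n → X => (M.SJ Finset.univ ω : ℝ)) ≤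
      (Real.sqrt (0.8 * ((n * (1 - (1 - M.p) ^ (n - 1)) / √v) * ((M.κ + 1) / √v) ^ 2 / 2)) +
       Real.sqrt (4.4 * ((n * (1 - (1 - M.p) ^ (n - 1)) / √v) * ((M.κ + 1) / √v) ^ 2 / 2) +
        (1 - (1 - M.p) ^ (n - 1)) / v *
      (Real.sqrt n * ((1 + M.κ + 4 * n / (n - 1 : ℕ)) *
        Real.sqrt (1 + 3 * ((n - 1 : ℕ) * M.p3) + ((n - 1 : ℕ) * M.p3) ^ 2)) +
      2 * ((n / (n - 1 : ℕ)) * (M.κ + 2 + (n - 1 : ℕ) * M.p3))))) ^ 2 := by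
  obtain ⟨w, hw0, hw1, hw, hwr⟩ := weights_exist M.p_pos M.p_lt (m := n - 1) (by omega)
  have hwa : ∀ k, |w k| ≤ 1 := fun k => by rw [abs_of_nonneg (hw0 k)]; exact hw1 k
  set S : (Fin n → X) → ℝ := fun ω => (M.SJ Finset.univ ω : ℝ) with hS
  have bS : BM S := M.S_BM (fun k => (k:ℝ))
  set H := M.DD w S with hH
  have bH : BM H := M.DD_BM hwa bS
  have hES := M.ES_eq (n := n) hn
  have hdev := M.abs_dev hn hw0 hw1 hH bH
  set Q := 1 - (1 - M.p) ^ (n - 1) with hQ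
  have hQ0 : 0 < Q := by
    have := pow_lt_one₀ (n := n - 1) (by linarith [M.p_lt] : 0 ≤ 1 - M.p)
      (by linarith [M.p_pos]) (by omega)
    linarith
  set e := ∫ ω, S ω ∂(PL ν n) with he
  have key : ∀ {F : (Fin n → X) → ℝ}, BM F → ∫ ω, (S ω - e) * F ω ∂(PL ν n) =
      Q * ∫ ω, M.DD w F ω ∂(PL ν n) := by
    intro F hF
    have := M.DD_key hn hwa hw hwr hF
    rw [← hES] at this
    exact this
  have hv2 : v = ∫ ω, (S ω - e) ^ 2 ∂(PL ν n) := by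
    rw [← hvar, variance_eq_integral bS.1.aemeasurable]
  have hvH : v = Q * ∫ ω, H ω ∂(PL ν n) := by
    rw [hv2, ← key bS]
    have e1 : ∀ ω, (S ω - e) ^ 2 = (S ω - e) * S ω - e * (S ω - e) := by intro ω; ring
    simp_rw [e1]
    have bb : BM (fun ω => S ω - e) := bS.sub (BM.const e)
    rw [integral_sub ((bb.mul bS).integrable _) (((BM.const e).mul bb).integrable _),
      integral_const_mul, integral_sub (bS.integrable _) (integrable_const _)]
    simp [← he]
  set σ := √v with hσ
  have hσ0 : 0 < σ := Real.sqrt_pos.2 hv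
  have hσ2 : σ ^ 2 = v := Real.sq_sqrt hv.le
  have hn0 : (0:ℝ) < n := by exact_mod_cast (by omega : 0 < n)
  set W : (Fin n → X) → ℝ := fun ω => (S ω - e) / σ with hW
  set T : (Fin n → X) → ℝ := fun ω => Q / v * H ω with hT
  have bfW : ∀ f : ℝ → ℝ, BM (fun ω => f (W ω)) := fun f =>
    M.S_BM (fun k => f (((k:ℝ) - e) / σ))
  have bW : BM W := bfW id
  have bT : BM T := (BM.const _).mul bH
  have hHle : ∀ ω, |H ω| ≤ n * (M.κ + 1) := by
    intro ω
    have := M.DD_lin hn hw0 hw1 bS bS ω 0 (M.κ + 1) (fun i j v hj hv => by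
      simpa using M.S_diff_le ω hj hv)
    simpa using this
  have := stein_bound (PL ν n) W T bW.1 (bW.integrable _) ?_ (bT.integrable _)
    (b := (M.κ + 1) / σ) (l := n * Q / σ) (D := Q / v * (Real.sqrt n * ((1 + M.κ + 4 * n / (n - 1 : ℕ)) *
        Real.sqrt (1 + 3 * ((n - 1 : ℕ) * M.p3) + ((n - 1 : ℕ) * M.p3) ^ 2)) +
      2 * ((n / (n - 1 : ℕ)) * (M.κ + 2 + (n - 1 : ℕ) * M.p3)))) (by positivity) ?_ ?_ ?_
  · unfold kolDist
    rw [hvar]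
    exact this
  · have h1 : (∫ ω, |W ω| ∂(PL ν n)) ^ 2 ≤ 1 := by
      refine (sq_int_le _ bW.abs).trans (le_of_eq ?_)
      have e1 : ∀ ω, |W ω| ^ 2 = (S ω - e) ^ 2 / v := by
        intro ω; rw [sq_abs, hW]; simp only [div_pow, hσ2]
      simp_rw [e1]
      rw [integral_div, ← hv2, div_self hv.ne']
    exact (abs_le_one_iff_mul_self_le_one.2 (by rwa [← sq])) |> (le_abs_self _).trans
  · rw [div_mul_div_comm, ← sq, hσ2, one_le_div hv, hvH]
    have : ∫ ω, H ω ∂(PL ν n) ≤ n * (M.κ + 1) := by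
      have := integral_mono (bH.integrable (PL ν n)) (integrable_const (n * (M.κ + 1 : ℝ)))
        (fun ω => (le_abs_self _).trans (hHle ω))
      simpa using this
    calc _ ≤ Q * (n * (M.κ + 1 : ℝ)) := by gcongr
      _ = _ := by ring
  · have e1 : ∀ ω, |T ω - 1| = Q / v * |H ω - ∫ ω, H ω ∂(PL ν n)| := by
      intro ω
      rw [← abs_of_pos (div_pos hQ0 hv), ← abs_mul, mul_sub]
      congr 2
      rw [div_mul_eq_mul_div, ← hvH, div_self hv.ne']
    simp_rw [e1]
    rw [integral_const_mul]
    exact mul_le_mul_of_nonneg_left hdev (div_pos hQ0 hv).le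
  · intro f g R _ _ _ hfg
    have bF := bfW f
    have bg := bfW g
    have bR := bfW R
    have bD := M.DD_BM hwa bF
    have i1 : ∫ ω, W ω * f (W ω) ∂(PL ν n) =
        Q / σ * ∫ ω, M.DD w (fun ω => f (W ω)) ω ∂(PL ν n) := by
      have e1 : ∀ ω, W ω * f (W ω) = σ⁻¹ * ((S ω - e) * f (W ω)) := by
        intro ω; rw [hW]; ring
      simp_rw [e1]
      rw [integral_const_mul, key bF]; ring
    have i2 : ∫ ω, g (W ω) * T ω ∂(PL ν n) =
        Q / σ * ∫ ω, (g (W ω) / σ) * H ω ∂(PL ν n) := by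
      rw [← integral_const_mul]
      congr 1; ext ω
      rw [hT, ← hσ2]; field_simp
    have bgH : BM (fun ω => (g (W ω) / σ) * H ω) := by
      simp only [div_eq_mul_inv]
      exact (bg.mul (BM.const _)).mul bH
    rw [i1, i2, ← mul_sub, ← integral_sub (bD.integrable _) (bgH.integrable _), abs_mul,
      abs_of_pos (div_pos hQ0 hσ0)]
    have i3 : |∫ ω, (M.DD w (fun ω => f (W ω)) ω - (g (W ω) / σ) * H ω) ∂(PL ν n)| ≤
        n * ∫ ω, R (W ω) ∂(PL ν n) := by
      rw [← integral_const_mul]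
      refine abs_integral_le_integral_abs.trans ?_
      refine integral_mono ((bD.sub bgH).abs.integrable _) (((BM.const _).mul bR).integrable _) ?_
      intro ω
      refine M.DD_lin hn hw0 hw1 bF bS ω _ (R (W ω)) ?_
      intro i j v hj hr
      have hd := M.S_diff_le ω hj hr
      set ω' := Function.update ω j v
      have ht : |W ω' - W ω| ≤ (M.κ + 1) / σ := by
        have : W ω' - W ω = -((S ω - S ω') / σ) := by simp only [hW]; ring
        rw [this, abs_neg, abs_div, abs_of_pos hσ0]
        gcongr
      have := hfg (W ω) (W ω' - W ω) ht
      rw [add_sub_cancel] at this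
      rw [← abs_neg]
      convert this using 2
      simp only [hW]
      field_simp
      ring
    calc _ ≤ Q / σ * (n * ∫ ω, R (W ω) ∂(PL ν n)) := by gcongr
      _ = _ := by ring

end GM



namespace GM

/-- probability of avoiding both balls -/
def hh {X : Type*} [MeasurableSpace X] {ν : Measure X} (M : GM X ν) (x y : X) : ℝ :=
  ∫ v, (1 - M.ri x v) * (1 - M.ri y v) ∂ν

lemma hh_BM {X Ω : Type*} [MeasurableSpace X] [MeasurableSpace Ω] {ν : Measure X}
    [IsProbabilityMeasure ν] (M : GM X ν) {f g : Ω → X} (hf : Measurable f) (hg : Measurable g) :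
    BM (fun x => M.hh (f x) (g x)) :=
  BM.int (f := fun z : Ω × X => (1 - M.ri (f z.1) z.2) * (1 - M.ri (g z.1) z.2))
    (((BM.const 1).sub (M.ri_BM (hf.comp measurable_fst) measurable_snd)).mul
      ((BM.const 1).sub (M.ri_BM (hg.comp measurable_fst) measurable_snd))) ν

lemma int_prod {X : Type*} [MeasurableSpace X] {ν : Measure X} [IsProbabilityMeasure ν]
    (M : GM X ν) {n : ℕ} (i k : Fin n) (J : Finset (Fin n)) (hi : i ∉ J) (hk : k ∉ J) :
    ∀ G : (Fin n → X) → ℝ, BM G → (∀ j ∈ J, ∀ ω v, G (Function.update ω j v) = G ω) →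
    ∫ ω, G ω * ∏ j ∈ J, ((1 - M.ri (ω i) (ω j)) * (1 - M.ri (ω k) (ω j))) ∂(PL ν n) =
      ∫ ω, G ω * M.hh (ω i) (ω k) ^ J.card ∂(PL ν n) := by
  induction J using Finset.induction_on with
  | empty => intro G _ _; simp
  | insert a J ha ih =>
    intro G hG hinv
    have hia : i ≠ a := fun h => hi (h ▸ Finset.mem_insert_self _ _)
    have hka : k ≠ a := fun h => hk (h ▸ Finset.mem_insert_self _ _)
    have bh : BM (fun ω : Fin n → X => M.hh (ω i) (ω k)) :=
      M.hh_BM (measurable_pi_apply i) (measurable_pi_apply k)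
    have bc : ∀ j, BM (fun ω : Fin n → X => (1 - M.ri (ω i) (ω j)) * (1 - M.ri (ω k) (ω j))) :=
      fun j => ((BM.const 1).sub (M.ri_BM (measurable_pi_apply i) (measurable_pi_apply j))).mul
        ((BM.const 1).sub (M.ri_BM (measurable_pi_apply k) (measurable_pi_apply j)))
    rw [int_AV ν a (hG.mul (BM.prod _ fun j _ => bc j))]
    have e : ∀ ω, AV ν a (fun ω => G ω * ∏ j ∈ insert a J, ((1 - M.ri (ω i) (ω j)) *
        (1 - M.ri (ω k) (ω j)))) ω = (G ω * M.hh (ω i) (ω k)) *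
          ∏ j ∈ J, ((1 - M.ri (ω i) (ω j)) * (1 - M.ri (ω k) (ω j))) := by
      intro ω
      unfold AV
      have e1 : ∀ v, G (Function.update ω a v) * ∏ j ∈ insert a J,
          ((1 - M.ri (Function.update ω a v i) (Function.update ω a v j)) *
          (1 - M.ri (Function.update ω a v k) (Function.update ω a v j))) =
          (G ω * ∏ j ∈ J, ((1 - M.ri (ω i) (ω j)) * (1 - M.ri (ω k) (ω j)))) *
            ((1 - M.ri (ω i) v) * (1 - M.ri (ω k) v)) := by
        intro v
        rw [hinv a (Finset.mem_insert_self _ _), Finset.prod_insert ha, Function.update_self,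
          Function.update_of_ne hia, Function.update_of_ne hka]
        have : ∀ j ∈ J, ((1 - M.ri (ω i) (Function.update ω a v j)) *
          (1 - M.ri (ω k) (Function.update ω a v j))) =
            (1 - M.ri (ω i) (ω j)) * (1 - M.ri (ω k) (ω j)) := by
          intro j hj
          rw [Function.update_of_ne (show j ≠ a from fun h => ha (h ▸ hj))]
        rw [Finset.prod_congr rfl this]
        ring
      simp_rw [e1]
      rw [integral_const_mul]
      unfold hh
      ring
    simp_rw [e]
    rw [ih (fun h => hi (Finset.mem_insert_of_mem h)) (fun h => hk (Finset.mem_insert_of_mem h))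
      (fun ω => G ω * M.hh (ω i) (ω k)) (hG.mul bh) ?_, Finset.card_insert_of_notMem ha]
    · congr 1; ext ω; ring
    · intro j hj ω v
      have h1 : i ≠ j := fun h => hi (h ▸ Finset.mem_insert_of_mem hj)
      have h2 : k ≠ j := fun h => hk (h ▸ Finset.mem_insert_of_mem hj)
      rw [hinv j (Finset.mem_insert_of_mem hj), Function.update_of_ne h1, Function.update_of_ne h2]

/-- isolation indicator -/
def XI {X : Type*} [MeasurableSpace X] {ν : Measure X} (M : GM X ν) {n : ℕ}
    (ω : Fin n → X) (i : Fin n) : ℝ := ∏ j ∈ Finset.univ.erase i, (1 - M.ri (ω i) (ω j))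

lemma XI_eq {X : Type*} [MeasurableSpace X] {ν : Measure X} (M : GM X ν) {n : ℕ}
    (ω : Fin n → X) (i : Fin n) :
    M.XI ω i = if M.NN Finset.univ ω i = 0 then 1 else 0 := by
  unfold XI NN
  split_ifs with h
  · rw [Finset.card_eq_zero, Finset.filter_eq_empty_iff] at h
    apply Finset.prod_eq_one
    intro j hj
    have := h (Finset.mem_univ j)
    have h2 : ¬ M.rel (ω i) (ω j) := fun h3 => this ⟨Finset.ne_of_mem_erase hj, h3⟩
    simp [ri, h2]
  · have h := Finset.card_pos.1 (Nat.pos_of_ne_zero h)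
    obtain ⟨j, hj⟩ := h
    simp only [Finset.mem_filter, Finset.mem_univ, true_and] at hj
    apply Finset.prod_eq_zero (Finset.mem_erase.2 ⟨hj.1, Finset.mem_univ j⟩)
    simp [ri, hj.2]

lemma SJ_XI {X : Type*} [MeasurableSpace X] {ν : Measure X} (M : GM X ν) {n : ℕ}
    (ω : Fin n → X) : (M.SJ Finset.univ ω : ℝ) = ∑ i, M.XI ω i := by
  simp only [XI_eq]
  unfold SJ
  simp

lemma XI_BM {X : Type*} [MeasurableSpace X] {ν : Measure X} (M : GM X ν) {n : ℕ}
    (i : Fin n) : BM (fun ω : Fin n → X => M.XI ω i) :=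
  BM.prod _ fun j _ => (BM.const 1).sub (M.ri_BM (measurable_pi_apply i) (measurable_pi_apply j))

lemma XI_mul {X : Type*} [MeasurableSpace X] {ν : Measure X} (M : GM X ν) {n : ℕ}
    (ω : Fin n → X) {i k : Fin n} (h : i ≠ k) : M.XI ω i * M.XI ω k =
      (1 - M.ri (ω i) (ω k)) * ∏ j ∈ (Finset.univ.erase i).erase k,
        ((1 - M.ri (ω i) (ω j)) * (1 - M.ri (ω k) (ω j))) := by
  unfold XI
  rw [← Finset.mul_prod_erase (Finset.univ.erase i) _
    (Finset.mem_erase.2 ⟨h.symm, Finset.mem_univ k⟩),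
    ← Finset.mul_prod_erase (Finset.univ.erase k) _
    (Finset.mem_erase.2 ⟨h, Finset.mem_univ i⟩), Finset.erase_right_comm, Finset.prod_mul_distrib]
  have : M.ri (ω k) (ω i) = M.ri (ω i) (ω k) := by
    unfold ri
    have : M.rel (ω k) (ω i) ↔ M.rel (ω i) (ω k) := ⟨M.symm _ _, M.symm _ _⟩
    simp [this]
  rw [this]
  have h2 : (1 - M.ri (ω i) (ω k)) * (1 - M.ri (ω i) (ω k)) = (1 - M.ri (ω i) (ω k)) := by
    unfold ri; split_ifs <;> norm_num
  linear_combination (∏ j ∈ (Finset.univ.erase k).erase i, (1 - M.ri (ω i) (ω j))) *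
    (∏ j ∈ (Finset.univ.erase k).erase i, (1 - M.ri (ω k) (ω j))) * h2

lemma var_lower {X : Type*} [MeasurableSpace X] {ν : Measure X} [IsProbabilityMeasure ν]
    (M : GM X ν) {n : ℕ} (hn : 2 ≤ n) (B : ℝ)
    (hB : ∀ x, B ≤ ∫ y, (1 - M.ri x y) * M.hh x y ^ (n - 2) ∂ν) :
    n * (1 - M.p) ^ (n - 1) + n * (n - 1) * B - (n * (1 - M.p) ^ (n - 1)) ^ 2 ≤
      variance (fun ω : Fin n → X => (M.SJ Finset.univ ω : ℝ)) (PL ν n) := by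
  have bS : BM (fun ω : Fin n → X => (M.SJ Finset.univ ω : ℝ)) := M.S_BM (fun k => (k:ℝ))
  have hES := M.ES_eq (n := n) hn
  have hm : MemLp (fun ω : Fin n → X => (M.SJ Finset.univ ω : ℝ)) 2 (PL ν n) := by
    obtain ⟨h1, C, hC⟩ := bS
    exact MemLp.of_bound h1.aestronglyMeasurable C (ae_of_all _ hC)
  rw [variance_eq_sub hm, hES]
  apply sub_le_sub_right
  have e1 : ∀ ω : Fin n → X, ((fun ω : Fin n → X => (M.SJ Finset.univ ω : ℝ)) ^ 2) ω =
      (M.SJ Finset.univ ω : ℝ) + ∑ i, ∑ k ∈ Finset.univ.erase i, M.XI ω i * M.XI ω k := by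
    intro ω
    simp only [Pi.pow_apply]
    rw [M.SJ_XI, sq, Finset.sum_mul_sum, ← Finset.sum_add_distrib]
    refine Finset.sum_congr rfl fun i _ => ?_
    rw [← Finset.add_sum_erase _ _ (Finset.mem_univ i)]
    congr 1
    rw [XI_eq]; split_ifs <;> norm_num
  have bb : ∀ i k, BM (fun ω : Fin n → X => M.XI ω i * M.XI ω k) := fun i k =>
    (M.XI_BM i).mul (M.XI_BM k)
  simp_rw [e1]
  rw [integral_add (bS.integrable _)
    ((BM.sum _ fun i _ => BM.sum _ fun k _ => bb i k).integrable _), hES,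
    integral_finsetSum _ fun i _ => (BM.sum _ fun k _ => bb i k).integrable _]
  have e2 : ∀ i ∈ (Finset.univ : Finset (Fin n)), ((n - 1 : ℕ) : ℝ) * B ≤
      ∫ ω, ∑ k ∈ Finset.univ.erase i, M.XI ω i * M.XI ω k ∂(PL ν n) := by
    intro i _
    rw [integral_finsetSum _ fun k _ => (bb i k).integrable _]
    have e3 : ∀ k ∈ Finset.univ.erase i, B ≤ ∫ ω, M.XI ω i * M.XI ω k ∂(PL ν n) := by
      intro k hk
      have hki := Finset.ne_of_mem_erase hk
      simp_rw [M.XI_mul _ hki.symm]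
      have bG : BM (fun ω : Fin n → X => 1 - M.ri (ω i) (ω k)) :=
        (BM.const 1).sub (M.ri_BM (measurable_pi_apply i) (measurable_pi_apply k))
      rw [M.int_prod i k ((Finset.univ.erase i).erase k) (by simp) (by simp)
        (fun ω => 1 - M.ri (ω i) (ω k)) bG ?_]
      · have hc : ((Finset.univ.erase i).erase k).card = n - 2 := by
          rw [Finset.card_erase_of_mem hk, Finset.card_erase_of_mem (Finset.mem_univ i)]
          simp; omega
        have b3 : BM (fun ω : Fin n → X => (1 - M.ri (ω i) (ω k)) * M.hh (ω i) (ω k) ^ (n - 2)) :=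
          bG.mul ((M.hh_BM (measurable_pi_apply i) (measurable_pi_apply k)).pow _)
        rw [hc, int_AV ν k b3]
        have : ∫ _ω : Fin n → X, B ∂(PL ν n) ≤ _ :=
          integral_mono (integrable_const B) ((AV_BM ν k b3).integrable (PL ν n)) (fun ω => by
            simp only [AV, Function.update_self, Function.update_of_ne hki.symm]
            exact hB (ω i))
        simpa using this
      · intro j hj ω v
        rw [Finset.mem_erase] at hj
        have hji := Finset.ne_of_mem_erase hj.2
        rw [Function.update_of_ne hji.symm, Function.update_of_ne hj.1.symm]
    have := Finset.card_nsmul_le_sum _ _ _ e3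
    simpa [Finset.card_erase_of_mem (Finset.mem_univ i)] using this
  have := Finset.card_nsmul_le_sum _ _ _ e2
  simp only [Finset.card_univ, Fintype.card_fin, nsmul_eq_mul] at this
  rw [Nat.cast_sub (by omega : 1 ≤ n)] at this
  push_cast at this
  linarith

end GM



lemma iInf_round {L : ℝ} (hL : 0 < L) (u : ℝ) :
    ⨅ k : ℤ, |u - k * L| = |u - round (u / L) * L| := by
  have key : ∀ k : ℤ, |u - k * L| = L * |u / L - k| := by
    intro k
    rw [← abs_of_pos hL, ← abs_mul, abs_of_pos hL, mul_sub, mul_div_cancel₀ _ hL.ne', mul_comm]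
  apply le_antisymm
  · exact ciInf_le ⟨0, by rintro _ ⟨k, rfl⟩; exact abs_nonneg _⟩ (round (u / L))
  · apply le_ciInf
    intro k
    rw [key, key]
    exact mul_le_mul_of_nonneg_left (round_le _ _) hL.le

/-- lift of a difference -/
def lft {d : ℕ} (L : ℝ) (x y : Fin d → ℝ) (k : Fin d → ℤ) : EuclideanSpace ℝ (Fin d) :=
  WithLp.toLp 2 (fun i => x i - y i - k i * L)

lemma tor_le {d : ℕ} {L : ℝ} (hL : 0 < L) (x y : Fin d → ℝ) (k : Fin d → ℤ) :
    torDist L x y ≤ ‖lft L x y k‖ := by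
  unfold torDist lft
  rw [EuclideanSpace.norm_eq]
  apply Real.sqrt_le_sqrt
  apply Finset.sum_le_sum
  intro i _
  simp only [Real.norm_eq_abs]
  apply pow_le_pow_left₀ (Real.iInf_nonneg fun k => abs_nonneg _)
  exact ciInf_le ⟨0, by rintro _ ⟨k, rfl⟩; exact abs_nonneg _⟩ (k i)

lemma tor_ex {d : ℕ} {L : ℝ} (hL : 0 < L) (x y : Fin d → ℝ) :
    ∃ k, torDist L x y = ‖lft L x y k‖ := by
  refine ⟨fun i => round ((x i - y i) / L), ?_⟩
  unfold torDist lft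
  rw [EuclideanSpace.norm_eq]
  simp only [iInf_round hL, Real.norm_eq_abs]

lemma tor_symm {d : ℕ} {L : ℝ} (hL : 0 < L) (x y : Fin d → ℝ) :
    torDist L y x ≤ torDist L x y := by
  obtain ⟨k, hk⟩ := tor_ex hL x y
  rw [hk]
  refine (tor_le hL y x (-k)).trans (le_of_eq ?_)
  rw [← norm_neg]
  congr 1
  ext i
  simp [lft]
  ring

lemma tor_tri {d : ℕ} {L : ℝ} (hL : 0 < L) (x y z : Fin d → ℝ) :
    torDist L x z ≤ torDist L x y + torDist L y z := by
  obtain ⟨k, hk⟩ := tor_ex hL x y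
  obtain ⟨l, hl⟩ := tor_ex hL y z
  rw [hk, hl]
  refine (tor_le hL x z (k + l)).trans (le_trans (le_of_eq ?_) (norm_add_le _ _))
  congr 1
  ext i
  simp [lft]
  ring

lemma tor_self {d : ℕ} {L : ℝ} (hL : 0 < L) (x : Fin d → ℝ) : torDist L x x = 0 := by
  apply le_antisymm _ (Real.sqrt_nonneg _)
  refine (tor_le hL x x 0).trans (le_of_eq ?_)
  rw [norm_eq_zero]
  ext i
  simp [lft]

lemma tor_per {d : ℕ} {L : ℝ} (hL : 0 < L) (x y : Fin d → ℝ) (z : Fin d → ℤ) :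
    torDist L x (fun i => z i * L + y i) = torDist L x y := by
  have h : ∀ (y : Fin d → ℝ) (z : Fin d → ℤ),
      torDist L x (fun i => z i * L + y i) ≤ torDist L x y := by
    intro y z
    obtain ⟨k, hk⟩ := tor_ex hL x y
    rw [hk]
    refine (tor_le hL _ _ (k - z)).trans (le_of_eq ?_)
    congr 1
    ext i
    simp [lft]
    ring
  refine le_antisymm (h y z) ?_
  have := h (fun i => z i * L + y i) (-z)
  have e : (fun i => (((-z) i : ℤ) : ℝ) * L + (z i * L + y i)) = y := by
    funext i
    simp
  rwa [e] at this

lemma tor_meas {d : ℕ} {L : ℝ} (hL : 0 < L) :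
    Measurable (fun z : (Fin d → ℝ) × (Fin d → ℝ) => torDist L z.1 z.2) := by
  unfold torDist
  simp only [iInf_round hL]
  refine Real.continuous_sqrt.measurable.comp ?_
  refine Finset.measurable_sum _ fun i _ => ?_
  have h1 : Measurable (fun z : (Fin d → ℝ) × (Fin d → ℝ) => z.1 i - z.2 i) :=
    ((measurable_pi_apply i).comp measurable_fst).sub ((measurable_pi_apply i).comp measurable_snd)
  have h2 : Measurable (fun u : ℝ => ((round u : ℤ) : ℝ)) := by
    simp only [round_eq]
    exact (measurable_from_top (f := fun k : ℤ => (k : ℝ))).comp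
      (Int.measurable_floor.comp (measurable_id.add measurable_const))
  have h3 : Measurable (fun u : ℝ => |u - (round (u / L) : ℤ) * L| ^ 2) :=
    ((measurable_id.sub ((h2.comp (measurable_id.div_const L)).mul_const L)).abs).pow_const 2
  exact h3.comp h1

/-- centered box -/
def cbox (d : ℕ) (L : ℝ) : Set (EuclideanSpace ℝ (Fin d)) := {z | ∀ i, z i ∈ Ico (-(L/2)) (L/2)}

lemma cbox_meas (d : ℕ) (L : ℝ) : MeasurableSet (cbox d L) := by
  have : cbox d L = ⋂ i, {z | z i ∈ Ico (-(L/2)) (L/2)} := by ext; simp [cbox]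
  rw [this]
  refine MeasurableSet.iInter fun i => ?_
  have : Measurable (fun z : EuclideanSpace ℝ (Fin d) => z i) := by fun_prop
  exact this measurableSet_Ico

open scoped Pointwise in
lemma int_box {d : ℕ} {L : ℝ} (hL : 0 < L) (x : Fin d → ℝ) (f : (Fin d → ℝ) → ℝ)
    (hf : ∀ (z : Fin d → ℤ) y, f (fun i => z i * L + y i) = f y) :
    ∫ y in box d L, f y = ∫ z in cbox d L, f (fun i => x i + z i) := by
  set b : Module.Basis (Fin d) ℝ (Fin d → ℝ) := (Pi.basisFun ℝ (Fin d)).unitsSMul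
    (fun _ => Units.mk0 L hL.ne') with hb
  have hfd : ZSpan.fundamentalDomain b = box d L := by
    ext y
    simp only [ZSpan.fundamentalDomain, box, hb, Module.Basis.repr_unitsSMul, Set.mem_univ_pi]
    refine forall_congr' fun i => ?_
    simp only [Units.smul_def, Units.val_inv_eq_inv_val, Units.val_mk0, Pi.basisFun_repr,
      smul_eq_mul, Set.mem_Ico]
    rw [inv_mul_lt_iff₀ hL, mul_one, mul_nonneg_iff_of_pos_left (inv_pos.2 hL)]
  have h1 : IsAddFundamentalDomain (Submodule.span ℤ (range b)).toAddSubgroup (box d L) volume := by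
    rw [← hfd]
    exact ZSpan.isAddFundamentalDomain' b volume
  have h2 : IsAddFundamentalDomain (Submodule.span ℤ (range b)).toAddSubgroup
      ((fun i => x i - L / 2 : Fin d → ℝ) +ᵥ box d L) volume := h1.vadd_of_comm _
  have hper : ∀ (g : (Submodule.span ℤ (range b)).toAddSubgroup) (y : Fin d → ℝ),
      f (g +ᵥ y) = f y := by
    rintro ⟨g, hg⟩ y
    have hg' : ∀ y, f (g + y) = f y := by
      rw [Submodule.mem_toAddSubgroup] at hg
      induction hg using Submodule.span_induction with
      | mem g hg =>
        obtain ⟨i, rfl⟩ := hg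
        intro y
        rw [← hf (Pi.single i 1) y]
        congr 1
        ext j
        simp only [hb, Module.Basis.unitsSMul_apply, Pi.basisFun_apply, Pi.add_apply,
          Units.smul_def, Units.val_mk0, Pi.smul_apply, smul_eq_mul]
        by_cases h : j = i
        · subst h; simp
        · simp [h]
      | zero => intro y; simp
      | add a b _ _ ha hb => intro y; rw [add_assoc, ha, hb]
      | smul a g _ hg =>
        have h1 : ∀ (k : ℕ) y, f (k • g + y) = f y := by
          intro k
          induction k with
          | zero => intro y; simp
          | succ k ih => intro y; rw [succ_nsmul, add_assoc, ih, hg]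
        intro y
        obtain ⟨k, rfl | rfl⟩ := a.eq_nat_or_neg
        · simpa using h1 k y
        · have := h1 k (-(k • g) + y)
          rw [add_neg_cancel_left] at this
          simpa using this.symm
    exact hg' y
  haveI : Countable (Submodule.span ℤ (range b)).toAddSubgroup :=
    inferInstanceAs (Countable (Submodule.span ℤ (range b)))
  rw [h1.setIntegral_eq h2 hper]
  have e1 : MeasurePreserving (fun z : EuclideanSpace ℝ (Fin d) => (x + WithLp.ofLp z)) volume volume :=
    (measurePreserving_add_left volume x).comp (PiLp.volume_preserving_ofLp (Fin d))
  have e2 : MeasurableEmbedding (fun z : EuclideanSpace ℝ (Fin d) => (x + WithLp.ofLp z)) :=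
    (measurableEmbedding_addLeft x).comp (MeasurableEquiv.toLp 2 (Fin d → ℝ)).symm.measurableEmbedding
  rw [← e1.setIntegral_preimage_emb e2]
  have e3 : (fun z : EuclideanSpace ℝ (Fin d) => (x + WithLp.ofLp z)) ⁻¹'
      ((fun i => x i - L / 2 : Fin d → ℝ) +ᵥ box d L) = cbox d L := by
    ext z
    rw [Set.mem_preimage, Set.mem_vadd_set_iff_neg_vadd_mem]
    simp only [box, cbox, Set.mem_univ_pi, vadd_eq_add, Pi.add_apply, Pi.neg_apply]
    refine forall_congr' fun i => ?_
    simp only [Set.mem_Ico]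
    constructor <;> rintro ⟨h1, h2⟩ <;> constructor <;> linarith
  rw [e3]
  rfl



lemma ub_prob (d : ℕ) {L : ℝ} (hL : 0 < L) : IsProbabilityMeasure (uniformBox d L) := by
  constructor
  unfold uniformBox box
  rw [Measure.smul_apply, Measure.restrict_apply_univ, Real.volume_pi_Ico]
  simp only [sub_zero, Finset.prod_const, Finset.card_univ, Fintype.card_fin, ENNReal.smul_def,
    smul_eq_mul]
  rw [ENNReal.ofReal, ← ENNReal.coe_pow, ← ENNReal.coe_mul, inv_mul_cancel₀]
  · rfl
  · exact pow_ne_zero _ (Real.toNNReal_pos.2 hL).ne'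

lemma int_ub {d : ℕ} {L : ℝ} (hL : 0 < L) (x : Fin d → ℝ) (f : (Fin d → ℝ) → ℝ)
    (hf : ∀ (z : Fin d → ℤ) y, f (fun i => z i * L + y i) = f y) :
    ∫ y, f y ∂(uniformBox d L) = (L ^ d)⁻¹ * ∫ z in cbox d L, f (fun i => x i + z i) := by
  unfold uniformBox
  rw [integral_smul_nnreal_measure, int_box hL x f hf, NNReal.smul_def, smul_eq_mul]
  congr 1
  rw [NNReal.coe_inv, NNReal.coe_pow, Real.coe_toNNReal _ hL.le]

lemma tor_cbox {d : ℕ} {L : ℝ} (hL : 0 < L) (x : Fin d → ℝ) {z : EuclideanSpace ℝ (Fin d)}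
    (hz : z ∈ cbox d L) : torDist L x (fun i => x i + z i) = ‖z‖ := by
  apply le_antisymm
  · refine (tor_le hL _ _ 0).trans (le_of_eq ?_)
    rw [← norm_neg]
    congr 1
    ext i
    simp [lft]
  · unfold torDist
    rw [EuclideanSpace.norm_eq]
    apply Real.sqrt_le_sqrt
    refine Finset.sum_le_sum fun i _ => ?_
    simp only [Real.norm_eq_abs]
    apply pow_le_pow_left₀ (abs_nonneg _)
    apply le_ciInf
    intro k
    obtain ⟨h1, h2⟩ := hz i
    have hzi : |z i| ≤ L / 2 := abs_le.2 ⟨h1, h2.le⟩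
    rw [show x i - (x i + z i) - k * L = -(z i + k * L) by ring, abs_neg]
    by_cases hk : k = 0
    · subst hk; simp
    · have h3 : (1:ℝ) ≤ |(k:ℝ)| := by exact_mod_cast Int.one_le_abs hk
      have h4 : L ≤ |(k:ℝ) * L| := by
        rw [abs_mul, abs_of_pos hL]; nlinarith
      have h5 := abs_sub_abs_le_abs_sub (k * L) (-(z i))
      rw [abs_neg, sub_neg_eq_add, add_comm (_ * L)] at h5
      linarith

lemma ball_cbox {d : ℕ} {L r : ℝ} (hr : r < L / 2) :
    closedBall (0 : EuclideanSpace ℝ (Fin d)) r ⊆ cbox d L := by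
  intro z hz i
  rw [mem_closedBall_zero_iff] at hz
  have h := (PiLp.norm_apply_le z i).trans hz
  rw [Real.norm_eq_abs, abs_le] at h
  exact ⟨by linarith, by linarith⟩

lemma vol_ball (d : ℕ) {r : ℝ} (hr : 0 ≤ r) (x : EuclideanSpace ℝ (Fin d)) :
    volume.real (closedBall x r) = phi d r := by
  unfold phi unitBallVol Measure.real
  rw [Measure.addHaar_closedBall _ _ hr, ENNReal.toReal_mul, ENNReal.toReal_ofReal (by positivity),
    mul_comm]
  rw [Measure.addHaar_unitClosedBall_eq_addHaar_unitBall, finrank_euclideanSpace_fin]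

lemma ubv_pos (d : ℕ) : 0 < unitBallVol d := by
  unfold unitBallVol
  exact ENNReal.toReal_pos (measure_closedBall_pos _ _ one_pos).ne' measure_closedBall_lt_top.ne

lemma phi_pos (d : ℕ) {r : ℝ} (hr : 0 < r) : 0 < phi d r := mul_pos (ubv_pos d) (by positivity)

lemma tor_prob {d : ℕ} {L r : ℝ} (hL : 0 < L) (hr0 : 0 ≤ r) (hr : r < L / 2) (x : Fin d → ℝ) :
    (uniformBox d L).real {y | torDist L x y ≤ r} = phi d r / L ^ d := by
  have hm : MeasurableSet {y | torDist L x y ≤ r} :=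
    ((tor_meas hL).comp (measurable_const.prodMk measurable_id)) measurableSet_Iic
  rw [← integral_indicator_one hm, int_ub hL x]
  · have : ∀ z ∈ cbox d L, ({y | torDist L x y ≤ r}.indicator (1 : (Fin d → ℝ) → ℝ))
        (fun i => x i + z i) = (closedBall (0 : EuclideanSpace ℝ (Fin d)) r).indicator 1 z := by
      intro z hz
      simp only [Set.indicator, mem_ofPred_eq, tor_cbox hL x hz, mem_closedBall_zero_iff, Pi.one_apply]
    rw [setIntegral_congr_fun (cbox_meas d L) this, integral_indicator_one measurableSet_closedBall,
      measureReal_restrict_apply measurableSet_closedBall,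
      Set.inter_eq_self_of_subset_left (ball_cbox hr), vol_ball d hr0]
    rw [div_eq_inv_mul]
  · intro z y
    simp only [Set.indicator, mem_ofPred_eq, tor_per hL, Pi.one_apply]

/-- packing set -/
def kset (d : ℕ) : Set ℕ := {k : ℕ | ∃ c : Fin k → EuclideanSpace ℝ (Fin d),
    (∀ i, (Metric.closedBall (c i) 1 ∩ Metric.closedBall 0 1).Nonempty) ∧
    Pairwise fun i j => Disjoint (Metric.closedBall (c i) 1) (Metric.closedBall (c j) 1)}

lemma kset_bdd (d : ℕ) : BddAbove (kset d) := by
  obtain ⟨N, hN⟩ := exists_nat_ge ((3:ℝ) ^ d)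
  refine ⟨N, ?_⟩
  rintro k ⟨c, h1, h2⟩
  have hU : (⋃ i, closedBall (c i) 1) ⊆ closedBall (0 : EuclideanSpace ℝ (Fin d)) 3 := by
    intro z hz
    obtain ⟨i, hi⟩ := Set.mem_iUnion.1 hz
    obtain ⟨y, hy1, hy2⟩ := h1 i
    rw [mem_closedBall] at *
    have := dist_triangle z (c i) 0
    have := dist_triangle (c i) y 0
    rw [dist_comm] at hy1
    linarith
  have h3 := measureReal_mono (μ := volume) hU measure_closedBall_lt_top.ne
  rw [measureReal_iUnion_fintype h2 (fun i => measurableSet_closedBall)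
    (fun i => measure_closedBall_lt_top.ne), vol_ball d (by norm_num)] at h3
  simp only [vol_ball d zero_le_one, Finset.sum_const, Finset.card_univ, Fintype.card_fin,
    nsmul_eq_mul, phi, one_pow, mul_one] at h3
  have := ubv_pos d
  have h4 : (k:ℝ) ≤ 3 ^ d := by
    rw [mul_comm] at h3
    exact le_of_mul_le_mul_left h3 this
  exact_mod_cast h4.trans hN

lemma mem_kset {d : ℕ} {k : ℕ} (c : Fin k → EuclideanSpace ℝ (Fin d)) (h1 : ∀ i, ‖c i‖ ≤ 2)
    (h2 : ∀ i j, i ≠ j → 2 < ‖c i - c j‖) : k ≤ kappa d := by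
  apply le_csSup (kset_bdd d)
  refine ⟨c, fun i => ?_, fun i j hij => ?_⟩
  · refine ⟨(1/2 : ℝ) • c i, ?_, ?_⟩
    · rw [mem_closedBall, dist_eq_norm, show (1/2:ℝ) • c i - c i = (-(1/2):ℝ) • c i by module,
        norm_smul]
      have := h1 i
      norm_num
      linarith
    · rw [mem_closedBall_zero_iff, norm_smul]
      have := h1 i
      norm_num
      linarith
  · apply closedBall_disjoint_closedBall
    rw [dist_eq_norm]
    have := h2 i j hij
    linarith

lemma kappa_ge {d : ℕ} (hd : 1 ≤ d) : 2 ≤ kappa d := by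
  set e : EuclideanSpace ℝ (Fin d) := EuclideanSpace.single ⟨0, hd⟩ 1
  have he : ‖e‖ = 1 := by simp [e]
  refine mem_kset (fun i : Fin 2 => if i = 0 then (2:ℝ) • e else (-2:ℝ) • e) ?_ ?_
  · intro i; beta_reduce; split_ifs <;> rw [norm_smul, he] <;> norm_num
  · intro i j hij
    have h1 : ‖(2:ℝ) • e - (-2:ℝ) • e‖ = 4 := by
      rw [show (2:ℝ) • e - (-2:ℝ) • e = (4:ℝ) • e by module, norm_smul, he]; norm_num
    fin_cases i <;> fin_cases j
    · exact absurd rfl hij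
    · simp only [Fin.mk_one, Fin.isValue, one_ne_zero, if_false, Fin.zero_eta, if_true]
      rw [h1]; norm_num
    · simp only [Fin.mk_one, Fin.isValue, one_ne_zero, if_false, Fin.zero_eta, if_true]
      rw [norm_sub_rev, h1]; norm_num
    · exact absurd rfl hij

lemma tor_pack {d : ℕ} {L ρ : ℝ} (hL : 0 < L) (hρ : 0 < ρ) (n : ℕ) (v : Fin d → ℝ)
    (ω : Fin n → Fin d → ℝ) (s : Finset (Fin n)) (h1 : ∀ i ∈ s, torDist L v (ω i) ≤ ρ)
    (h2 : ∀ i ∈ s, ∀ j ∈ s, i ≠ j → ¬ torDist L (ω i) (ω j) ≤ ρ) : s.card ≤ kappa d := by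
  choose k hk using fun i => tor_ex hL v (ω i)
  let f : Fin s.card → Fin n := fun a => (s.equivFin.symm a).1
  have hf : ∀ a, f a ∈ s := fun a => (s.equivFin.symm a).2
  have hfi : ∀ a b, a ≠ b → f a ≠ f b := by
    intro a b hab h
    exact hab (s.equivFin.symm.injective (Subtype.ext h))
  refine mem_kset (fun a => (2 / ρ) • lft L v (ω (f a)) (k (f a))) ?_ ?_
  · intro a
    beta_reduce
    rw [norm_smul, ← hk, Real.norm_eq_abs, abs_of_pos (by positivity), div_mul_eq_mul_div,
      div_le_iff₀ hρ]
    have := h1 _ (hf a)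
    linarith
  · intro a b hab
    beta_reduce
    rw [← smul_sub, norm_smul, Real.norm_eq_abs, abs_of_pos (by positivity), div_mul_eq_mul_div,
      lt_div_iff₀ hρ]
    have h3 := not_le.1 (h2 _ (hf b) _ (hf a) (hfi b a hab.symm))
    have h4 := tor_le hL (ω (f b)) (ω (f a)) (k (f a) - k (f b))
    have h5 : lft L (ω (f b)) (ω (f a)) (k (f a) - k (f b)) =
        lft L v (ω (f a)) (k (f a)) - lft L v (ω (f b)) (k (f b)) := by
      ext i
      simp [lft]
      ring
    rw [h5] at h4
    linarith

/-- the torus model -/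
def torGM (d : ℕ) (L ρ : ℝ) (hL : 0 < L) (hρ : 0 < ρ) (h3 : 3 * ρ < L / 2)
    (hp : phi d ρ / L ^ d < 1) : GM (Fin d → ℝ) (uniformBox d L) where
  rel x y := torDist L x y ≤ ρ
  rel3 x y := torDist L x y ≤ 3 * ρ
  p := phi d ρ / L ^ d
  p3 := 3 ^ d * phi d ρ / L ^ d
  κ := kappa d
  meas := (tor_meas hL) measurableSet_Iic
  meas3 := (tor_meas hL) measurableSet_Iic
  symm x y h := (tor_symm hL x y).trans h
  refl x := by rw [tor_self hL]; exact hρ.le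
  symm3 x y h := (tor_symm hL x y).trans h
  trans3 x y z w h1 h2 h3 := by
    have := tor_tri hL x y w
    have := tor_tri hL y z w
    linarith
  prob x := tor_prob hL hρ.le (by linarith) x
  prob3 x := by
    rw [tor_prob hL (by positivity) h3 x]
    unfold phi
    rw [mul_pow]
    apply le_of_eq
    ring
  p_pos := div_pos (phi_pos d hρ) (by positivity)
  p_lt := hp
  pack := fun n v ω s h1 h2 => tor_pack hL hρ n v ω s h1 h2



/-- volume of union of two balls -/
def UU (d : ℕ) (ρ : ℝ) (z : EuclideanSpace ℝ (Fin d)) : ℝ :=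
  volume.real (closedBall (0 : EuclideanSpace ℝ (Fin d)) ρ ∪ closedBall z ρ)

lemma UU_nonneg (d : ℕ) (ρ : ℝ) (z : EuclideanSpace ℝ (Fin d)) : 0 ≤ UU d ρ z :=
  measureReal_nonneg

lemma UU_le (d : ℕ) {ρ : ℝ} (hρ : 0 < ρ) (z : EuclideanSpace ℝ (Fin d)) :
    UU d ρ z ≤ 2 * phi d ρ := by
  refine (measureReal_union_le _ _).trans (le_of_eq ?_)
  rw [vol_ball d hρ.le, vol_ball d hρ.le]; ring

lemma UU_meas (d : ℕ) (ρ : ℝ) : Measurable (UU d ρ) := by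
  have hs : MeasurableSet {q : EuclideanSpace ℝ (Fin d) × EuclideanSpace ℝ (Fin d) |
      ‖q.2‖ ≤ ρ ∨ dist q.2 q.1 ≤ ρ} :=
    (measurableSet_le measurable_snd.norm measurable_const).union
      (measurableSet_le (measurable_snd.dist measurable_fst) measurable_const)
  have := measurable_measure_prodMk_left (ν := (volume : Measure (EuclideanSpace ℝ (Fin d)))) hs
  have h2 := this.ennreal_toReal
  convert h2 using 2 with z
  unfold UU Measure.real
  congr 2
  ext u
  simp [mem_closedBall]

lemma tor_per_left {d : ℕ} {L : ℝ} (hL : 0 < L) (x y : Fin d → ℝ) (z : Fin d → ℤ) :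
    torDist L (fun i => z i * L + y i) x = torDist L y x := by
  have e : ∀ a b : Fin d → ℝ, torDist L a b = torDist L b a := fun a b =>
    le_antisymm (tor_symm hL _ _) (tor_symm hL _ _)
  rw [e, tor_per hL, e]

lemma tor_near {d : ℕ} {L ρ : ℝ} (hL : 0 < L) (h3 : 3 * ρ < L / 2) (x : Fin d → ℝ)
    {z u : EuclideanSpace ℝ (Fin d)} (hz : ‖z‖ ≤ 2 * ρ) (hu : u ∈ cbox d L)
    (h : torDist L (fun i => x i + z i) (fun i => x i + u i) ≤ ρ) : dist u z ≤ ρ := by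
  obtain ⟨k, hk⟩ := tor_ex hL (fun i => x i + z i) (fun i => x i + u i)
  rw [hk] at h
  have hk0 : k = 0 := by
    funext i
    by_contra hne
    have h1 := (PiLp.norm_apply_le (lft L (fun i => x i + z i) (fun i => x i + u i) k) i).trans h
    have h2 := (PiLp.norm_apply_le z i).trans hz
    have h4 : |u i| ≤ L / 2 := abs_le.2 ⟨(hu i).1, (hu i).2.le⟩
    simp only [lft, Real.norm_eq_abs] at h1 h2
    rw [show x i + z i - (x i + u i) - k i * L = z i - u i - k i * L by ring] at h1
    have h5 : (1:ℝ) ≤ |(k i:ℝ)| := by exact_mod_cast Int.one_le_abs hne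
    have h6 : L ≤ |(k i:ℝ) * L| := by
      rw [abs_mul, abs_of_pos hL]; nlinarith
    rw [abs_le] at h1 h2 h4
    have h7 : |(k i:ℝ) * L| ≤ 3 * ρ + L / 2 := abs_le.2 ⟨by linarith, by linarith⟩
    linarith
  rw [dist_comm, dist_eq_norm]
  refine le_trans (le_of_eq ?_) h
  congr 1
  ext i
  simp [lft, hk0]

lemma hh_ge {X : Type*} [MeasurableSpace X] {ν : Measure X} [IsProbabilityMeasure ν]
    (M : GM X ν) (x y : X) : 1 - 2 * M.p ≤ M.hh x y := by
  have e : ∫ v, (1 - M.ri x v - M.ri y v) ∂ν = 1 - 2 * M.p := by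
    rw [integral_sub (((BM.const 1).sub (M.ri_BM1 x)).integrable _) ((M.ri_BM1 y).integrable _),
      integral_sub (integrable_const _) ((M.ri_BM1 x).integrable _), M.int_ri, M.int_ri]
    simp
    ring
  rw [← e]
  refine integral_mono ((((BM.const 1).sub (M.ri_BM1 x)).sub (M.ri_BM1 y)).integrable _)
    ((((BM.const 1).sub (M.ri_BM1 x)).mul ((BM.const 1).sub (M.ri_BM1 y))).integrable _) ?_
  intro v
  simp only [GM.ri]
  split_ifs <;> norm_num

lemma hh_ge2 {d : ℕ} {L ρ : ℝ} (hL : 0 < L) (hρ : 0 < ρ) (h3 : 3 * ρ < L / 2)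
    (hp : phi d ρ / L ^ d < 1) (x : Fin d → ℝ) {z : EuclideanSpace ℝ (Fin d)}
    (hz : ‖z‖ ≤ 2 * ρ) :
    1 - UU d ρ z / L ^ d ≤ (torGM d L ρ hL hρ h3 hp).hh x (fun i => x i + z i) := by
  haveI := ub_prob d hL
  set M := torGM d L ρ hL hρ h3 hp with hM
  set y : Fin d → ℝ := fun i => x i + z i with hy
  have bx := M.ri_BM1 x
  have bY := M.ri_BM1 y
  set f : (Fin d → ℝ) → ℝ := fun v => 1 - (1 - M.ri x v) * (1 - M.ri y v) with hf
  have bf : BM f := (BM.const 1).sub (((BM.const 1).sub bx).mul ((BM.const 1).sub bY))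
  have e1 : M.hh x y = 1 - ∫ v, f v ∂(uniformBox d L) := by
    unfold GM.hh
    rw [hf, integral_sub (integrable_const _)
      ((((BM.const 1).sub bx).mul ((BM.const 1).sub bY)).integrable _)]
    simp
  rw [e1, int_ub hL x f ?_]
  · apply sub_le_sub_left
    rw [div_eq_inv_mul]
    apply mul_le_mul_of_nonneg_left _ (by positivity)
    have hA : MeasurableSet (closedBall (0 : EuclideanSpace ℝ (Fin d)) ρ ∪ closedBall z ρ) :=
      measurableSet_closedBall.union measurableSet_closedBall
    have hAf : volume (closedBall (0 : EuclideanSpace ℝ (Fin d)) ρ ∪ closedBall z ρ) ≠ ⊤ :=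
      (measure_union_lt_top measure_closedBall_lt_top measure_closedBall_lt_top).ne
    have e2 : ∫ u in cbox d L, f (fun i => x i + u i) ≤
        ∫ u in cbox d L, (closedBall (0 : EuclideanSpace ℝ (Fin d)) ρ ∪ closedBall z ρ).indicator
          (1 : EuclideanSpace ℝ (Fin d) → ℝ) u := by
      apply integral_mono_of_nonneg
      · refine ae_of_all _ fun u => ?_
        simp only [hf, GM.ri, Pi.zero_apply]
        split_ifs <;> norm_num
      · exact ((integrable_indicator_iff hA).2 (integrableOn_const hAf)).restrict
      · refine (ae_restrict_iff' (cbox_meas d L)).2 (ae_of_all _ fun u hu => ?_)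
        by_cases hr : u ∈ closedBall (0 : EuclideanSpace ℝ (Fin d)) ρ ∪ closedBall z ρ
        · rw [Set.indicator_of_mem hr]
          simp only [hf, GM.ri, Pi.one_apply]
          split_ifs <;> norm_num
        · rw [Set.indicator_of_notMem hr]
          rw [Set.mem_union, not_or, mem_closedBall_zero_iff, mem_closedBall] at hr
          have r1 : ¬ M.rel x (fun i => x i + u i) := by
            change ¬ torDist L x _ ≤ ρ
            rw [tor_cbox hL x hu]; exact hr.1
          have r2 : ¬ M.rel y (fun i => x i + u i) := by
            change ¬ torDist L y _ ≤ ρ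
            exact fun h => hr.2 (tor_near hL h3 x hz hu h)
          simp [hf, GM.ri, r1, r2]
    refine e2.trans ?_
    rw [integral_indicator_one hA, measureReal_restrict_apply hA]
    exact measureReal_mono Set.inter_subset_left hAf
  · intro k v
    have r : ∀ a, M.ri a (fun i => k i * L + v i) = M.ri a v := by
      intro a
      unfold GM.ri
      have : M.rel a (fun i => k i * L + v i) ↔ M.rel a v := by
        change torDist L a _ ≤ ρ ↔ torDist L a v ≤ ρ
        rw [tor_per hL]
      simp [this]
    simp only [hf, r]

lemma one_sub_ge {t : ℝ} (h0 : 0 ≤ t) (h1 : t ≤ 1 / 2) : Real.exp (-(t + t ^ 2)) ≤ 1 - t := by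
  rw [Real.exp_neg, inv_le_comm₀ (Real.exp_pos _) (by linarith)]
  have h := Real.quadratic_le_exp_of_nonneg (x := t + t ^ 2) (by positivity)
  refine le_trans ?_ h
  rw [inv_le_iff_one_le_mul₀ (by linarith)]
  have h2 : 0 ≤ 1 - t - t ^ 2 - t ^ 3 := by nlinarith [pow_le_pow_left₀ h0 h1 2, pow_le_pow_left₀ h0 h1 3]
  nlinarith [mul_nonneg (sq_nonneg t) h2]

lemma tor_B {d : ℕ} {L ρ : ℝ} (hL : 0 < L) (hρ : 0 < ρ) (h3 : 3 * ρ < L / 2)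
    (hp : phi d ρ / L ^ d < 1) (hp2 : 4 * phi d ρ ≤ L ^ d) (N : ℕ) (hN : (N:ℝ) ≤ L ^ d)
    (x : Fin d → ℝ) :
    (1 - 2 ^ d * phi d ρ / L ^ d) * (1 - 2 * (phi d ρ / L ^ d)) ^ N + (L ^ d)⁻¹ *
      (Real.exp (-(4 * phi d ρ ^ 2 / L ^ d)) *
        ∫ z in closedBall (0 : EuclideanSpace ℝ (Fin d)) (2 * ρ) \ closedBall 0 ρ,
          Real.exp (-UU d ρ z)) ≤
      ∫ y, (1 - (torGM d L ρ hL hρ h3 hp).ri x y) * (torGM d L ρ hL hρ h3 hp).hh x y ^ N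
        ∂(uniformBox d L) := by
  haveI := ub_prob d hL
  set M := torGM d L ρ hL hρ h3 hp with hM
  set V := L ^ d with hV
  have hV0 : 0 < V := by positivity
  have hφ := phi_pos d hρ
  set φ := phi d ρ with hφd
  have hrel : ∀ a b, M.rel a b ↔ torDist L a b ≤ ρ := fun a b => Iff.rfl
  have hhp : M.p = φ / V := rfl
  set A := closedBall (0 : EuclideanSpace ℝ (Fin d)) (2 * ρ) with hA
  set A1 := closedBall (0 : EuclideanSpace ℝ (Fin d)) ρ with hA1
  have mA : MeasurableSet A := measurableSet_closedBall
  have mA1 : MeasurableSet A1 := measurableSet_closedBall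
  have mC := cbox_meas d L
  have hAC : A ⊆ cbox d L := ball_cbox (by linarith)
  have vC : volume.real (cbox d L) = V := by
    have := int_ub hL (0 : Fin d → ℝ) (fun _ => 1) (fun _ _ => rfl)
    simp only [integral_const, probReal_univ, smul_eq_mul, mul_one, measureReal_restrict_apply_univ]
      at this
    rw [← hV] at this
    field_simp at this
    exact this.symm
  have fC : volume (cbox d L) ≠ ⊤ := by
    intro h
    have : volume.real (cbox d L) = 0 := by simp [Measure.real, h]
    linarith
  rw [int_ub hL x (fun y => (1 - M.ri x y) * M.hh x y ^ N) ?_]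
  · have q0 : 0 ≤ 1 - 2 * (φ / V) := by
      have : φ / V ≤ 1 / 4 := by rw [div_le_iff₀ hV0]; linarith
      linarith
    have hmt : Measurable (fun z : EuclideanSpace ℝ (Fin d) => (fun i => x i + z i : Fin d → ℝ)) := by
      fun_prop
    have bI : BM (fun z : EuclideanSpace ℝ (Fin d) => (1 - M.ri x (fun i => x i + z i)) *
        M.hh x (fun i => x i + z i) ^ N) :=
      (((BM.const 1).sub (M.ri_BM measurable_const measurable_id)).mul
        ((M.hh_BM measurable_const measurable_id).pow N)).comp hmt
    have iI : ∀ s, volume s ≠ ⊤ → IntegrableOn (fun z : EuclideanSpace ℝ (Fin d) =>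
        (1 - M.ri x (fun i => x i + z i)) * M.hh x (fun i => x i + z i) ^ N) s := by
      intro s hs
      haveI : IsFiniteMeasure (volume.restrict s) := ⟨by simpa using hs.lt_top⟩
      exact bI.integrable _
    have s1 : volume (cbox d L \ A) ≠ ⊤ := ne_top_of_le_ne_top fC (measure_mono Set.diff_subset)
    have s2 : volume (A \ A1) ≠ ⊤ :=
      ne_top_of_le_ne_top measure_closedBall_lt_top.ne (measure_mono (Set.diff_subset : A \ A1 ⊆ A))
    have hdis : Disjoint (cbox d L \ A) (A \ A1) :=
      Set.disjoint_left.2 fun z h1 h2 => h1.2 h2.1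
    have step1 : ∫ z in (cbox d L \ A) ∪ (A \ A1), (1 - M.ri x (fun i => x i + z i)) *
        M.hh x (fun i => x i + z i) ^ N ≤
        ∫ z in cbox d L, (1 - M.ri x (fun i => x i + z i)) * M.hh x (fun i => x i + z i) ^ N := by
      refine setIntegral_mono_set (iI _ fC) (ae_of_all _ fun z => ?_) (ae_of_all _ ?_)
      · apply mul_nonneg
        · unfold GM.ri; split_ifs <;> norm_num
        · apply pow_nonneg
          exact q0.trans (hhp ▸ hh_ge M _ _)
      · intro z hz
        rcases hz with h | h
        · exact h.1
        · exact hAC h.1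
    rw [setIntegral_union hdis (mA.diff mA1) (iI _ s1) (iI _ s2)] at step1
    have ri0 : ∀ z ∈ cbox d L, z ∉ A1 → M.ri x (fun i => x i + z i) = 0 := by
      intro z hz h
      unfold GM.ri
      rw [if_neg]
      rw [hrel, tor_cbox hL x hz]
      rwa [hA1, mem_closedBall_zero_iff] at h
    have step2 : (V - 2 ^ d * φ) * (1 - 2 * (φ / V)) ^ N ≤
        ∫ z in cbox d L \ A, (1 - M.ri x (fun i => x i + z i)) *
          M.hh x (fun i => x i + z i) ^ N := by
      have : ∫ z in cbox d L \ A, (1 - 2 * (φ / V)) ^ N ≤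
        ∫ z in cbox d L \ A, (1 - M.ri x (fun i => x i + z i)) *
          M.hh x (fun i => x i + z i) ^ N := by
        refine setIntegral_mono_on (integrableOn_const s1) (iI _ s1) (mC.diff mA) ?_
        intro z hz
        have hz1 : z ∉ A1 := fun h => hz.2 (closedBall_subset_closedBall (by linarith) h)
        rw [ri0 z hz.1 hz1, sub_zero, one_mul]
        exact pow_le_pow_left₀ q0 (hhp ▸ hh_ge M _ _) N
      refine le_trans (le_of_eq ?_) this
      rw [setIntegral_const, smul_eq_mul, measureReal_sdiff hAC mA fC, vC, hA,
        vol_ball d (by positivity)]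
      congr 2
      rw [hφd]
      unfold phi
      rw [mul_pow]; ring
    have step3 : Real.exp (-(4 * φ ^ 2 / V)) * ∫ z in A \ A1, Real.exp (-UU d ρ z) ≤
        ∫ z in A \ A1, (1 - M.ri x (fun i => x i + z i)) *
          M.hh x (fun i => x i + z i) ^ N := by
      rw [← integral_const_mul]
      have bE : BM (fun z : EuclideanSpace ℝ (Fin d) =>
          Real.exp (-(4 * φ ^ 2 / V)) * Real.exp (-UU d ρ z)) := by
        refine (BM.const _).mul ⟨(UU_meas d ρ).neg.exp, 1, fun z => ?_⟩
        rw [abs_of_pos (Real.exp_pos _), Real.exp_le_one_iff]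
        linarith [UU_nonneg d ρ z]
      haveI : IsFiniteMeasure (volume.restrict (A \ A1)) := ⟨by simpa using s2.lt_top⟩
      refine setIntegral_mono_on (bE.integrable _) (iI _ s2) (mA.diff mA1) ?_
      intro z hz
      rw [ri0 z (hAC hz.1) hz.2, sub_zero, one_mul]
      have hz2 : ‖z‖ ≤ 2 * ρ := by simpa [hA] using hz.1
      have u1 := UU_nonneg d ρ z
      have u2 := UU_le d hρ z
      have t0 : 0 ≤ UU d ρ z / V := by positivity
      have t1 : UU d ρ z / V ≤ 1 / 2 := by rw [div_le_iff₀ hV0]; linarith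
      have g1 := hh_ge2 hL hρ h3 hp x hz2
      have g2 := one_sub_ge t0 t1
      refine le_trans ?_ (pow_le_pow_left₀ (by linarith) g1 N)
      refine le_trans ?_ (pow_le_pow_left₀ (Real.exp_pos _).le g2 N)
      rw [← Real.exp_nat_mul, ← Real.exp_add, Real.exp_le_exp]
      have a1 : N * (UU d ρ z / V) ≤ UU d ρ z := by
        rw [← mul_div_assoc, div_le_iff₀ hV0, mul_comm]
        exact mul_le_mul_of_nonneg_left hN u1
      have a2 : N * (UU d ρ z / V) ^ 2 ≤ 4 * φ ^ 2 / V := by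
        calc N * (UU d ρ z / V) ^ 2 ≤ V * (2 * φ / V) ^ 2 := by gcongr
          _ = _ := by field_simp; ring
      have a3 : (N:ℝ) * -(UU d ρ z / V + (UU d ρ z / V) ^ 2) =
        -(N * (UU d ρ z / V)) - N * (UU d ρ z / V) ^ 2 := by ring
      rw [a3]
      linarith
    have : (1 - 2 ^ d * φ / V) * (1 - 2 * (φ / V)) ^ N =
        V⁻¹ * ((V - 2 ^ d * φ) * (1 - 2 * (φ / V)) ^ N) := by
      have : V⁻¹ * V = 1 := inv_mul_cancel₀ hV0.ne'
      linear_combination (-(1 - 2 * (φ / V)) ^ N) * this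
    rw [this, ← mul_add]
    apply mul_le_mul_of_nonneg_left _ (by positivity)
    linarith
  · intro k y
    have r1 : M.ri x (fun i => k i * L + y i) = M.ri x y := by
      unfold GM.ri
      simp only [hrel, tor_per hL]
    have r2 : M.hh x (fun i => k i * L + y i) = M.hh x y := by
      unfold GM.hh GM.ri
      simp only [hrel, tor_per_left hL]
    rw [r1, r2]



lemma unitVec_norm {d : ℕ} (hd : 1 ≤ d) : ‖unitVec d‖ = 1 := by
  unfold unitVec
  rw [dif_pos (by omega : 0 < d)]
  simp

lemma UU_rot {d : ℕ} (ρ : ℝ) {z w : EuclideanSpace ℝ (Fin d)} (h : ‖z‖ = ‖w‖) :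
    UU d ρ z = UU d ρ w := by
  have hR := Submodule.reflection_sub h
  set R := Submodule.reflection (Submodule.span ℝ {z - w})ᗮ
  have hm := R.measurePreserving
  have hs : MeasurableSet (closedBall (0 : EuclideanSpace ℝ (Fin d)) ρ ∪ closedBall w ρ) :=
    measurableSet_closedBall.union measurableSet_closedBall
  have := hm.measure_preimage hs.nullMeasurableSet
  unfold UU Measure.real
  rw [← this, preimage_union, R.preimage_closedBall, R.preimage_closedBall, map_zero, ← hR,
    R.symm_apply_apply]

open scoped Pointwise in
lemma UU_scale {d : ℕ} {ρ : ℝ} (hρ : 0 < ρ) (w : EuclideanSpace ℝ (Fin d)) :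
    UU d ρ (ρ • w) = ρ ^ d * UU d 1 w := by
  unfold UU Measure.real
  have e : closedBall (0 : EuclideanSpace ℝ (Fin d)) ρ ∪ closedBall (ρ • w) ρ =
      ρ • (closedBall (0 : EuclideanSpace ℝ (Fin d)) 1 ∪ closedBall w 1) := by
    rw [smul_set_union, smul_closedBall' hρ.ne', smul_closedBall' hρ.ne']
    simp [abs_of_pos hρ]
  rw [e, Measure.addHaar_smul, ENNReal.toReal_mul, finrank_euclideanSpace_fin,
    ENNReal.toReal_ofReal (abs_nonneg _), abs_of_pos (by positivity)]

lemma omega_UU (d : ℕ) (t : ℝ) : omegaVol d t = UU d 1 (t • unitVec d) := rfl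

lemma UU_omega {d : ℕ} (hd : 1 ≤ d) {ρ : ℝ} (hρ : 0 < ρ) (z : EuclideanSpace ℝ (Fin d)) :
    UU d ρ z = ρ ^ d * omegaVol d (‖z‖ / ρ) := by
  rw [omega_UU, ← UU_scale hρ, smul_smul, mul_div_cancel₀ _ hρ.ne']
  refine UU_rot ρ ?_
  rw [norm_smul, unitVec_norm hd]; simp

lemma omega_meas (d : ℕ) : Measurable (omegaVol d) := by
  have : omegaVol d = fun t => UU d 1 (t • unitVec d) := rfl
  rw [this]
  exact (UU_meas d 1).comp (measurable_id.smul_const _)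

lemma omega_nonneg (d : ℕ) (t : ℝ) : 0 ≤ omegaVol d t := UU_nonneg d 1 _

lemma Jint_sub {d : ℕ} (ρ : ℝ) (hρ : 0 < ρ) : Jint 2 d ρ - Jint 1 d ρ =
    d * unitBallVol d * ∫ t in (1:ℝ)..2, Real.exp (-(ρ ^ d * omegaVol d t)) * t ^ (d - 1) := by
  have hi : ∀ a b : ℝ, IntervalIntegrable
      (fun t => Real.exp (-(ρ ^ d * omegaVol d t)) * t ^ (d - 1)) volume a b := by
    intro a b
    have h2 : IntervalIntegrable (fun t : ℝ => t ^ (d - 1)) volume a b :=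
      (continuous_pow _).intervalIntegrable _ _
    refine h2.mono_fun ?_ ?_
    · exact (((((omega_meas d).const_mul _).neg).exp).mul (measurable_id.pow_const _)).aestronglyMeasurable
    · refine Eventually.of_forall fun t => ?_
      beta_reduce; rw [norm_mul]
      refine mul_le_of_le_one_left (norm_nonneg _) ?_
      rw [Real.norm_eq_abs, Real.abs_exp, Real.exp_le_one_iff, neg_nonpos]
      exact mul_nonneg (by positivity) (omega_nonneg d t)
  unfold Jint
  rw [← mul_sub, intervalIntegral.integral_interval_sub_left (hi _ _) (hi _ _)]

lemma I_eq {d : ℕ} (hd : 1 ≤ d) {ρ : ℝ} (hρ : 0 < ρ) :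
    ∫ z in closedBall (0 : EuclideanSpace ℝ (Fin d)) (2*ρ) \ closedBall 0 ρ, Real.exp (-UU d ρ z)
      = ρ ^ d * (Jint 2 d ρ - Jint 1 d ρ) := by
  have : Nontrivial (EuclideanSpace ℝ (Fin d)) := by
    refine ⟨unitVec d, 0, fun h => ?_⟩
    have := unitVec_norm hd
    rw [h] at this; simp at this
  rw [Jint_sub ρ hρ]
  set f : ℝ → ℝ := (Ioc ρ (2*ρ)).indicator fun y => Real.exp (-(ρ ^ d * omegaVol d (y / ρ))) with hf
  rw [← integral_indicator (measurableSet_closedBall.diff measurableSet_closedBall)]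
  have e1 : ∀ z : EuclideanSpace ℝ (Fin d),
      (closedBall (0 : EuclideanSpace ℝ (Fin d)) (2*ρ) \ closedBall 0 ρ).indicator
        (fun z => Real.exp (-UU d ρ z)) z = f ‖z‖ := by
    intro z
    by_cases hz : z ∈ closedBall (0 : EuclideanSpace ℝ (Fin d)) (2*ρ) \ closedBall 0 ρ
    · rw [indicator_of_mem hz, hf, indicator_of_mem, UU_omega hd hρ]
      simpa [and_comm] using hz
    · rw [indicator_of_notMem hz, hf, indicator_of_notMem]
      simpa [and_comm, imp_iff_not_or, or_comm] using hz
  simp_rw [e1]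
  rw [integral_fun_norm_addHaar, finrank_euclideanSpace_fin]
  have e2 : volume.real (ball (0 : EuclideanSpace ℝ (Fin d)) 1) = unitBallVol d := by
    unfold unitBallVol Measure.real
    rw [Measure.addHaar_closedBall_eq_addHaar_ball]
  rw [e2, nsmul_eq_mul, smul_eq_mul]
  have e3 : ∫ y in Ioi (0:ℝ), y ^ (d - 1) • f y =
      ∫ y in ρ..(2*ρ), y ^ (d - 1) * Real.exp (-(ρ ^ d * omegaVol d (y / ρ))) := by
    rw [intervalIntegral.integral_of_le (by linarith)]
    have : ∀ y, y ^ (d - 1) • f y = (Ioc ρ (2*ρ)).indicator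
        (fun y => y ^ (d - 1) * Real.exp (-(ρ ^ d * omegaVol d (y / ρ)))) y := by
      intro y
      simp only [hf, indicator, smul_eq_mul, mul_ite, mul_zero]
    simp_rw [this]
    rw [setIntegral_indicator measurableSet_Ioc]
    congr 2
    ext y
    simp only [mem_inter_iff, mem_Ioi, mem_Ioc]
    constructor
    · exact fun h => h.2
    · exact fun h => ⟨by linarith [h.1], h⟩
  have e4 := intervalIntegral.mul_integral_comp_mul_left (a := 1) (b := 2)
    (f := fun y => y ^ (d - 1) * Real.exp (-(ρ ^ d * omegaVol d (y / ρ)))) ρ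
  rw [mul_one, mul_comm ρ 2] at e4
  rw [e3, ← e4]
  have e5 : ∀ x : ℝ, (ρ * x) ^ (d-1) * Real.exp (-(ρ ^ d * omegaVol d (ρ * x / ρ))) =
      ρ ^ (d-1) * (Real.exp (-(ρ ^ d * omegaVol d x)) * x ^ (d - 1)) := by
    intro x
    rw [mul_div_cancel_left₀ _ hρ.ne', mul_pow]; ring
  simp_rw [e5]
  rw [intervalIntegral.integral_const_mul]
  have e6 : ρ ^ d = ρ * ρ ^ (d-1) := by
    rw [← pow_succ']; congr 1; omega
  rw [e6]; ring

/-- lower bound for the integral -/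
lemma I_ge {d : ℕ} (hd : 1 ≤ d) {ρ : ℝ} (hρ : 0 < ρ) :
    Real.exp (-(2 * phi d ρ)) * ((2 ^ d - 1) * phi d ρ) ≤
      ρ ^ d * (Jint 2 d ρ - Jint 1 d ρ) := by
  rw [← I_eq hd hρ]
  have hss : closedBall (0 : EuclideanSpace ℝ (Fin d)) ρ ⊆ closedBall 0 (2*ρ) :=
    closedBall_subset_closedBall (by linarith)
  have hfin : volume (closedBall (0 : EuclideanSpace ℝ (Fin d)) (2*ρ)) ≠ ⊤ :=
    measure_closedBall_lt_top.ne
  have hfin2 : volume (closedBall (0 : EuclideanSpace ℝ (Fin d)) (2*ρ) \ closedBall 0 ρ) ≠ ⊤ :=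
    ne_top_of_le_ne_top hfin (measure_mono sdiff_subset)
  have : ∫ z in closedBall (0 : EuclideanSpace ℝ (Fin d)) (2*ρ) \ closedBall 0 ρ,
      Real.exp (-(2 * phi d ρ)) ≤ ∫ z in closedBall (0 : EuclideanSpace ℝ (Fin d)) (2*ρ) \ closedBall 0 ρ,
      Real.exp (-UU d ρ z) := by
    refine setIntegral_mono_on (integrableOn_const hfin2) ?_
      (measurableSet_closedBall.diff measurableSet_closedBall) ?_
    · refine Measure.integrableOn_of_bounded (M := 1) hfin2
        ((UU_meas d ρ).neg.exp).aestronglyMeasurable ?_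
      refine Eventually.of_forall fun z => ?_
      rw [Real.norm_eq_abs, Real.abs_exp, Real.exp_le_one_iff, neg_nonpos]
      exact UU_nonneg d ρ z
    · intro z _
      exact Real.exp_le_exp.2 (neg_le_neg (UU_le d hρ z))
  refine le_trans (le_of_eq ?_) this
  rw [setIntegral_const, smul_eq_mul, measureReal_sdiff hss measurableSet_closedBall hfin,
    vol_ball d hρ.le, vol_ball d (by positivity), mul_comm]
  unfold phi
  rw [mul_pow]; ring

lemma gS_pos {d : ℕ} (hd : 1 ≤ d) {ρ : ℝ} (hρ : 0 < ρ) : 0 < gS d ρ := by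
  have h1 := I_ge hd hρ
  have hφ : 0 < phi d ρ := phi_pos d hρ
  set φ := phi d ρ
  have e1 : Real.exp (-φ) = Real.exp φ * Real.exp (-(2*φ)) := by
    rw [← Real.exp_add]; congr 1; ring
  unfold gS
  change 0 < Real.exp (-φ) - (1 + (2 ^ d - 2) * φ + φ ^ 2) * Real.exp (-(2 * φ)) + _
  have h2 : 0 < Real.exp (-(2*φ)) := Real.exp_pos _
  have h3 : 1 + φ + φ^2/2 + φ^3/6 ≤ Real.exp φ := by
    have := Real.sum_le_exp_of_nonneg hφ.le 4
    simp [Finset.sum_range_succ, Nat.factorial] at this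
    linarith
  have h4 : 0 < Real.exp φ - 1 + φ - φ^2 := by
    nlinarith [sq_nonneg (φ - 3/2), sq_nonneg (φ-3), mul_pos hφ hφ, mul_nonneg hφ.le (sq_nonneg (φ - 3/2))]
  have : 0 < Real.exp (-(2*φ)) * (Real.exp φ - 1 + φ - φ^2) := mul_pos h2 h4
  rw [e1]
  nlinarith



lemma ub_singleton {d : ℕ} (hd : 1 ≤ d) (L : ℝ) (a : Fin d → ℝ) : uniformBox d L {a} = 0 := by
  have : Nonempty (Fin d) := ⟨⟨0, hd⟩⟩
  have h0 : (volume : Measure (Fin d → ℝ)) {a} = 0 := measure_singleton a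
  unfold uniformBox
  rw [Measure.smul_apply]
  have : (volume.restrict (box d L)) {a} = 0 :=
    le_antisymm ((Measure.restrict_apply_le _ _).trans h0.le) bot_le
  rw [this, smul_zero]

lemma ub_box (d : ℕ) (L : ℝ) : ∀ᵐ x ∂uniformBox d L, x ∈ box d L := by
  have hm : MeasurableSet (box d L) := MeasurableSet.univ_pi fun _ => measurableSet_Ico
  unfold uniformBox
  exact Measure.ae_smul_measure (ae_restrict_mem hm) _

lemma PL_ne {X : Type*} [MeasurableSpace X] [MeasurableEq X] (ν : Measure X)
    [IsProbabilityMeasure ν] (h0 : ∀ a, ν {a} = 0) {n : ℕ} {i j : Fin n} (hij : i ≠ j) :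
    ∀ᵐ ω ∂(PL ν n), ω i ≠ ω j := by
  have hs : MeasurableSet {ω : Fin n → X | ω i = ω j} :=
    measurableSet_eq_fun (measurable_pi_apply i) (measurable_pi_apply j)
  rw [ae_iff]
  simp only [ne_eq, not_not]
  rw [← (mp_update ν j).measure_preimage hs.nullMeasurableSet,
    Measure.measure_prod_null ((meas_update j) hs)]
  refine Eventually.of_forall fun ω => ?_
  simp only [Pi.zero_apply]
  refine measure_mono_null ?_ (h0 (ω i))
  intro v hv
  have : Function.update ω j v i = Function.update ω j v j := hv
  rw [Function.update_of_ne hij, Function.update_self] at this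
  exact this.symm

lemma kolDist_congr {Ω : Type*} [MeasurableSpace Ω] {P : Measure Ω} {X Y : Ω → ℝ}
    (h : X =ᵐ[P] Y) : kolDist P X = kolDist P Y := by
  unfold kolDist
  rw [integral_congr_ae h, variance_congr h]
  congr 1
  ext t
  congr 3
  refine measure_congr ?_
  filter_upwards [h] with ω hω
  apply propext
  change (X ω - _) / _ ≤ t ↔ (Y ω - _) / _ ≤ t
  rw [hω]

lemma isol_ae {d n : ℕ} (hd : 1 ≤ d) {ρ : ℝ} (hL : 0 < sideLen d n) (hρ : 0 < ρ)
    (h3 : 3 * ρ < sideLen d n / 2) (hp : phi d ρ / sideLen d n ^ d < 1) :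
    isolCount d n ρ =ᵐ[PL (uniformBox d (sideLen d n)) n]
      fun ω => ((torGM d (sideLen d n) ρ hL hρ h3 hp).SJ Finset.univ ω : ℝ) := by
  set L := sideLen d n with hLd
  have := ub_prob d hL
  have h1 : ∀ᵐ ω ∂(PL (uniformBox d L) n), ∀ i j : Fin n, i ≠ j → ω i ≠ ω j := by
    rw [ae_all_iff]; intro i
    rw [ae_all_iff]; intro j
    by_cases hij : i = j
    · exact Eventually.of_forall fun ω h => absurd hij h
    · filter_upwards [PL_ne (uniformBox d L) (ub_singleton hd L) hij] with ω h _
      exact h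
  have h2 : ∀ᵐ ω ∂(PL (uniformBox d L) n), ∀ i : Fin n, ω i ∈ box d L := by
    rw [ae_all_iff]; intro i
    exact (measurePreserving_eval (fun _ : Fin n => uniformBox d L) i).quasiMeasurePreserving.ae
      (ub_box d L)
  filter_upwards [h1, h2] with ω h1 h2
  unfold isolCount GM.SJ
  rw [Finset.sum_boole]
  congr 2
  ext i
  simp only [Finset.mem_filter, Finset.mem_univ, true_and]
  unfold GM.NN
  rw [Finset.card_eq_zero, Finset.filter_eq_empty_iff]
  constructor
  · intro h l _ ⟨hl, hr⟩
    have : ω l ∈ Set.range ω ∩ torBall L (ω i) ρ := ⟨⟨l, rfl⟩, h2 l, hr⟩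
    rw [h] at this
    exact h1 l i hl this
  · intro h
    ext y
    constructor
    · rintro ⟨⟨l, rfl⟩, _, hr⟩
      by_contra hl
      exact h (Finset.mem_univ l) ⟨fun e => hl (by rw [e]; rfl), hr⟩
    · rintro rfl
      exact ⟨⟨i, rfl⟩, h2 i, by rw [tor_self hL]; exact hρ.le⟩

lemma sideLen_pow {d : ℕ} (hd : 1 ≤ d) (n : ℕ) : sideLen d n ^ d = n := by
  unfold sideLen
  exact Real.rpow_inv_natCast_pow (by positivity) (by omega)

lemma sideLen_tendsto {d : ℕ} (hd : 1 ≤ d) : Tendsto (sideLen d) atTop atTop := by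
  unfold sideLen
  exact (tendsto_rpow_atTop (by positivity)).comp tendsto_natCast_atTop_atTop



lemma inv_n_tendsto (c : ℝ) : Tendsto (fun n : ℕ => c / (n : ℝ)) atTop (nhds 0) :=
  tendsto_const_nhds.div_atTop tendsto_natCast_atTop_atTop

lemma pow_sub_tendsto (t : ℝ) (k : ℕ) :
    Tendsto (fun n : ℕ => (1 + t / (n:ℝ)) ^ (n - k)) atTop (nhds (Real.exp t)) := by
  have h1 := Real.tendsto_one_add_div_pow_exp t
  have h0 : Tendsto (fun n : ℕ => 1 + t / (n:ℝ)) atTop (nhds 1) := by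
    simpa using (inv_n_tendsto t).const_add 1
  have h2 : Tendsto (fun n : ℕ => (1 + t / (n:ℝ)) ^ k) atTop (nhds 1) := by
    simpa using h0.pow k
  have h3 := h1.div h2 one_ne_zero
  rw [div_one] at h3
  refine h3.congr' ?_
  filter_upwards [h0.eventually_ne one_ne_zero, eventually_ge_atTop k] with n hn hk
  rw [Pi.div_apply, pow_sub₀ _ hn hk, div_eq_mul_inv]

/-- asymptotic lower variance density -/
def gn (d : ℕ) (ρ : ℝ) (n : ℕ) : ℝ :=
  (1 + (-phi d ρ) / n) ^ (n - 1) - (1 + (-(2 * phi d ρ)) / n) ^ (n - 2) *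
      (1 + 2 ^ d * phi d ρ * (1 - 1 / n)) +
    (1 - 1 / n) * (Real.exp (-(4 * phi d ρ ^ 2) / n) * (ρ ^ d * (Jint 2 d ρ - Jint 1 d ρ))) +
    ((1 + (-phi d ρ) / n) ^ (n - 2)) ^ 2 * (2 * phi d ρ - phi d ρ ^ 2 / n -
      (1 - 2 / n) * phi d ρ ^ 2 / (1 - phi d ρ / n) ^ 2)

lemma gn_tendsto (d : ℕ) (ρ : ℝ) : Tendsto (gn d ρ) atTop (nhds (gS d ρ)) := by
  unfold gn
  set φ := phi d ρ
  set I := ρ ^ d * (Jint 2 d ρ - Jint 1 d ρ) with hI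
  have a1 := pow_sub_tendsto (-φ) 1
  have a2 := pow_sub_tendsto (-(2*φ)) 2
  have a3 := pow_sub_tendsto (-φ) 2
  have b1 := (inv_n_tendsto 1).const_sub 1
  have b2 := (inv_n_tendsto 2).const_sub 1
  have b3 := (inv_n_tendsto φ).const_sub 1
  have b4 := inv_n_tendsto (φ ^ 2)
  have b5 := (inv_n_tendsto (-(4 * φ ^ 2))).rexp
  have c1 := (((a1.sub (a2.mul ((b1.const_mul (2 ^ d * φ)).const_add 1))).add
    (b1.mul (b5.mul_const I))).add ((a3.pow 2).mul ((b4.const_sub (2*φ)).sub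
      ((b2.mul_const (φ^2)).div (b3.pow 2) (by norm_num)))))
  have e : gS d ρ = Real.exp (-φ) - Real.exp (-(2 * φ)) * (1 + 2 ^ d * φ * (1 - 0)) +
      (1 - 0) * (Real.exp 0 * I) + Real.exp (-φ) ^ 2 * (2 * φ - 0 - (1 - 0) * φ ^ 2 / (1 - 0) ^ 2) := by
    have : Real.exp (-φ) ^ 2 = Real.exp (-(2 * φ)) := by
      rw [← Real.exp_nat_mul]; congr 1; push_cast; ring
    rw [this, Real.exp_zero]
    unfold gS
    rw [← hI]
    ring
  rw [e]
  exact c1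

lemma gn_alg {φ I a q s E : ℝ} {n : ℕ} (hn : 2 ≤ n) (hφ : 0 < φ) (hφn : 4 * φ ≤ n)
    (hq : q = 1 - φ / n) (hs : s = 1 - 2 * (φ / n)) :
    n * (q ^ (n-1) - s ^ (n - 2) * (1 + a * (1 - 1 / n)) + (1 - 1 / n) * (E * I) +
      (q ^ (n-2)) ^ 2 * (2 * φ - φ ^ 2 / n - (1 - 2 / n) * φ ^ 2 / q ^ 2)) ≤
    n * q ^ (n-1) + n * (n - 1) * ((1 - a / n) * s ^ (n-2) + (n:ℝ)⁻¹ * (E * I)) -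
      (n * q ^ (n-1)) ^ 2 := by
  have hn0 : (0:ℝ) < n := by positivity
  have hq0 : 0 < q := by
    rw [hq, sub_pos, div_lt_one hn0]; linarith
  obtain ⟨m, rfl⟩ : ∃ m, n = m + 2 := ⟨n - 2, by omega⟩
  simp only [Nat.add_sub_cancel, show m + 2 - 1 = m + 1 by omega]
  set N : ℝ := ((m + 2 : ℕ) : ℝ) with hN
  have hm : (m : ℝ) = N - 2 := by rw [hN]; push_cast; ring
  have hs2 : s = q ^ 2 * (1 + -(φ / N / q) ^ 2) := by
    field_simp
    rw [hs, hq]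
    field_simp
    ring
  have hr : 1 + m * (-(φ / N / q) ^ 2) ≤ (1 + -(φ / N / q) ^ 2) ^ m := by
    refine one_add_mul_le_pow ?_ m
    have : φ / N / q ≤ 1 := by
      rw [div_le_one hq0, hq, le_sub_iff_add_le, ← add_div, div_le_one hn0]; linarith
    have h0 : 0 ≤ φ / N / q := by positivity
    nlinarith
  have hsm : (q ^ m) ^ 2 * (1 + m * (-(φ / N / q) ^ 2)) ≤ s ^ m := by
    rw [hs2, mul_pow (q ^ 2), ← pow_mul, ← pow_mul, mul_comm 2 m]
    gcongr
  have key : N ^ 2 * ((q ^ m) ^ 2 * (1 + m * (-(φ / N / q) ^ 2))) ≤ N ^ 2 * s ^ m := by gcongr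
  have e1 : (q ^ (m+1)) = q ^ m * q := pow_succ _ _
  rw [e1, hm] at *
  set Q := q ^ m
  set S := s ^ m
  have e2 : N * (Q ^ 2 * (2 * φ - φ ^ 2 / N - (1 - 2 / N) * φ ^ 2 / q ^ 2)) =
      N ^ 2 * (Q ^ 2 * (1 + (N - 2) * (-(φ / N / q) ^ 2))) - (N * (Q * q)) ^ 2 := by
    have hq2 : q = (N - φ) / N := by rw [hq]; field_simp
    have : N - φ ≠ 0 := by
      have : 0 < N - φ := by linarith
      exact this.ne'
    rw [hq2]
    field_simp
    ring
  have e3 : N * (Q * q - S * (1 + a * (1 - 1 / N)) + (1 - 1 / N) * (E * I)) =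
    N * (Q * q) + N * (N - 1) * ((1 - a / N) * S + N⁻¹ * (E * I)) - N ^ 2 * S := by
    field_simp
    ring
  rw [mul_add, e2, e3]
  linarith



/-- first coefficient -/
def cn (d : ℕ) (ρ : ℝ) (n : ℕ) : ℝ :=
  (1 - (1 + (-phi d ρ) / n) ^ (n - 1)) * (1 + kappa d) ^ 2 / (2 * (gn d ρ n * Real.sqrt (gn d ρ n)))

/-- second coefficient -/
def Dn (d : ℕ) (ρ : ℝ) (n : ℕ) : ℝ :=
  (1 - (1 + (-phi d ρ) / n) ^ (n - 1)) / gn d ρ n *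
    ((1 + kappa d + 4 * (n / (n - 1 : ℕ))) *
        Real.sqrt (1 + 3 * ((n - 1 : ℕ) * (3 ^ d * phi d ρ / n)) +
          ((n - 1 : ℕ) * (3 ^ d * phi d ρ / n)) ^ 2) +
      2 * ((n / (n - 1 : ℕ)) * (kappa d + 2 + (n - 1 : ℕ) * (3 ^ d * phi d ρ / n))) / Real.sqrt n)

lemma scale_alg {n A w k K1 K2 : ℝ} (hn : 0 < n) (hA : 0 ≤ A) (hw : 0 < w) :
    Real.sqrt n * (Real.sqrt (0.8 * (n * A / Real.sqrt (n * w) * (k / Real.sqrt (n * w)) ^ 2 / 2)) +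
      Real.sqrt (4.4 * (n * A / Real.sqrt (n * w) * (k / Real.sqrt (n * w)) ^ 2 / 2) +
        A / (n * w) * (Real.sqrt n * K1 + K2))) ^ 2 =
    (Real.sqrt (0.8 * (A * k ^ 2 / (2 * (w * Real.sqrt w)))) +
      Real.sqrt (4.4 * (A * k ^ 2 / (2 * (w * Real.sqrt w))) + A / w * (K1 + K2 / Real.sqrt n))) ^ 2 := by
  have hr : 0 < Real.sqrt n := Real.sqrt_pos.2 hn
  have hsw : 0 < Real.sqrt w := Real.sqrt_pos.2 hw
  have hn2 : n = Real.sqrt n ^ 2 := (Real.sq_sqrt hn.le).symm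
  have hw2 : Real.sqrt w ^ 2 = w := Real.sq_sqrt hw.le
  have e1 : ∀ a b : ℝ, Real.sqrt n * (Real.sqrt a + Real.sqrt b) ^ 2 =
      (Real.sqrt (Real.sqrt n * a) + Real.sqrt (Real.sqrt n * b)) ^ 2 := by
    intro a b
    rw [Real.sqrt_mul hr.le, Real.sqrt_mul hr.le, ← mul_add, mul_pow, Real.sq_sqrt hr.le]
  have e2 : Real.sqrt n * (n * A / Real.sqrt (n * w) * (k / Real.sqrt (n * w)) ^ 2 / 2) =
      A * k ^ 2 / (2 * (w * Real.sqrt w)) := by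
    rw [Real.sqrt_mul hn.le]
    set r := Real.sqrt n
    rw [hn2]
    set u := Real.sqrt w
    rw [← hw2]
    field_simp
  have e3 : Real.sqrt n * (A / (n * w) * (Real.sqrt n * K1 + K2)) =
      A / w * (K1 + K2 / Real.sqrt n) := by
    set r := Real.sqrt n
    rw [hn2]
    field_simp
  rw [e1]
  congr 3
  · rw [← e2]; ring
  · congr 1
    rw [mul_add, e3, ← e2]; ring

lemma main_bound {d : ℕ} (hd : 1 ≤ d) {ρ : ℝ} (hρ : 0 < ρ) :
    ∀ᶠ n : ℕ in atTop, Real.sqrt n * kolDist (binppLaw d n) (isolCount d n ρ) ≤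
      (Real.sqrt (0.8 * cn d ρ n) + Real.sqrt (4.4 * cn d ρ n + Dn d ρ n)) ^ 2 := by
  have hφ := phi_pos d hρ
  filter_upwards [eventually_ge_atTop 2, (sideLen_tendsto hd).eventually_gt_atTop (6 * ρ),
    tendsto_natCast_atTop_atTop.eventually_ge_atTop (4 * phi d ρ),
    (gn_tendsto d ρ).eventually_const_lt (gS_pos hd hρ)] with n hn hL6 hφn hg
  have hL : 0 < sideLen d n := by linarith
  have h3 : 3 * ρ < sideLen d n / 2 := by linarith
  have hn0 : (0:ℝ) < n := by positivity
  have hV := sideLen_pow hd n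
  have hp : phi d ρ / sideLen d n ^ d < 1 := by
    rw [hV, div_lt_one hn0]; linarith
  have := ub_prob d hL
  set M := torGM d (sideLen d n) ρ hL hρ h3 hp with hM
  have hMp : M.p = phi d ρ / n := by rw [← hV]; rfl
  have hMp3 : M.p3 = 3 ^ d * phi d ρ / n := by rw [← hV]; rfl
  have hMk : M.κ = kappa d := rfl
  have hk : kolDist (binppLaw d n) (isolCount d n ρ) =
      kolDist (PL (uniformBox d (sideLen d n)) n) (fun ω => (M.SJ Finset.univ ω : ℝ)) :=
    kolDist_congr (isol_ae hd hL hρ h3 hp)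
  set v := variance (fun ω : Fin n → (Fin d → ℝ) => (M.SJ Finset.univ ω : ℝ))
    (PL (uniformBox d (sideLen d n)) n) with hv
  have hB : ∀ x, (1 - 2 ^ d * phi d ρ / n) * (1 - 2 * (phi d ρ / n)) ^ (n - 2) + (n:ℝ)⁻¹ *
      (Real.exp (-(4 * phi d ρ ^ 2) / n) * (ρ ^ d * (Jint 2 d ρ - Jint 1 d ρ))) ≤
      ∫ y, (1 - M.ri x y) * M.hh x y ^ (n-2) ∂(uniformBox d (sideLen d n)) := by
    intro x
    have := tor_B hL hρ h3 hp (by rw [hV]; exact hφn) (n - 2) (by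
      rw [hV]; exact_mod_cast Nat.sub_le n 2) x
    rw [I_eq hd hρ, hV] at this
    rw [neg_div]
    exact this
  have hvar := M.var_lower hn _ hB
  rw [← hv, hMp] at hvar
  have hq1 : (1 : ℝ) + (-phi d ρ) / n = 1 - phi d ρ / n := by ring
  have hvg : n * gn d ρ n ≤ v := by
    refine le_trans (le_trans (le_of_eq ?_) (gn_alg (E := Real.exp (-(4 * phi d ρ ^ 2) / n))
      (I := ρ ^ d * (Jint 2 d ρ - Jint 1 d ρ)) (a := 2 ^ d * phi d ρ) hn hφ hφn rfl rfl)) hvar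
    unfold gn
    rw [hq1, show (1 : ℝ) + (-(2 * phi d ρ)) / n = 1 - 2 * (phi d ρ / n) by ring]
  have hw : 0 < n * gn d ρ n := mul_pos hn0 hg
  have hkb := M.kol_bound hn (lt_of_lt_of_le hw hvg) hv.symm
  rw [hMp, hMp3, hMk, ← hk] at hkb
  rw [← hq1] at hkb
  have hq0 : 0 ≤ 1 + (-phi d ρ) / n := by
    rw [hq1, sub_nonneg, div_le_one hn0]; linarith
  have hA : 0 ≤ 1 - (1 + (-phi d ρ) / n) ^ (n - 1) := by
    rw [sub_nonneg]
    refine pow_le_one₀ hq0 ?_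
    rw [hq1]
    have : 0 < phi d ρ / n := by positivity
    linarith
  unfold cn Dn
  rw [← scale_alg hn0 hA hg]
  refine mul_le_mul_of_nonneg_left (hkb.trans ?_) (Real.sqrt_nonneg _)
  set A := 1 - (1 + (-phi d ρ) / n) ^ (n - 1)
  set w := n * gn d ρ n
  have hsw : 0 < Real.sqrt w := Real.sqrt_pos.2 hw
  rw [add_comm (kappa d : ℝ) 1, mul_div_assoc 4 (n:ℝ)]
  gcongr

lemma ratio_tendsto : Tendsto (fun n : ℕ => (n:ℝ) / (n - 1 : ℕ)) atTop (nhds 1) := by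
  have h := (inv_n_tendsto 1).const_sub 1
  have h2 := h.inv₀ (by norm_num)
  simp only [sub_zero, inv_one] at h2
  refine h2.congr' ?_
  filter_upwards [eventually_ge_atTop 2] with n hn
  have h1 : (2:ℝ) ≤ n := by exact_mod_cast hn
  rw [Nat.cast_sub (by omega)]
  push_cast
  have : (n:ℝ) - 1 ≠ 0 := by
    have : (0:ℝ) < n - 1 := by linarith
    exact this.ne'
  field_simp

lemma ratio2_tendsto (x : ℝ) : Tendsto (fun n : ℕ => ((n - 1 : ℕ):ℝ) * (x / n)) atTop (nhds x) := by
  have h := (ratio_tendsto.inv₀ one_ne_zero).mul_const x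
  simp only [inv_one, one_mul] at h
  refine h.congr fun n => ?_
  rw [inv_div]; ring

lemma cn_tendsto {d : ℕ} (hd : 1 ≤ d) {ρ : ℝ} (hρ : 0 < ρ) : Tendsto (cn d ρ) atTop
    (nhds ((1 - Real.exp (-phi d ρ)) * (1 + kappa d) ^ 2 / (2 * (gS d ρ * Real.sqrt (gS d ρ))))) := by
  unfold cn
  have hg := gS_pos hd hρ
  have h := gn_tendsto d ρ
  have hs : 0 < Real.sqrt (gS d ρ) := Real.sqrt_pos.2 hg
  exact (((pow_sub_tendsto (-phi d ρ) 1).const_sub 1).mul_const _).div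
    ((h.mul h.sqrt).const_mul 2) (by positivity)

lemma Dn_tendsto {d : ℕ} (hd : 1 ≤ d) {ρ : ℝ} (hρ : 0 < ρ) : Tendsto (Dn d ρ) atTop
    (nhds ((1 - Real.exp (-phi d ρ)) / gS d ρ * ((1 + kappa d + 4 * 1) *
      Real.sqrt (1 + 3 * (3 ^ d * phi d ρ) + (3 ^ d * phi d ρ) ^ 2) + 0))) := by
  unfold Dn
  have hg := gS_pos hd hρ
  have h := gn_tendsto d ρ
  have hx := ratio2_tendsto (3 ^ d * phi d ρ)
  have hn : Tendsto (fun n : ℕ => Real.sqrt (n:ℝ)) atTop atTop :=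
    Real.tendsto_sqrt_atTop.comp tendsto_natCast_atTop_atTop
  refine (((pow_sub_tendsto (-phi d ρ) 1).const_sub 1).div h hg.ne').mul
    ((((ratio_tendsto.const_mul 4).const_add _).mul
      (((hx.const_mul 3).const_add 1).add (hx.pow 2)).sqrt).add ?_)
  exact ((ratio_tendsto.mul (hx.const_add _)).const_mul 2).div_atTop hn

lemma eta_ratio (c : ℝ) : Tendsto (fun n : ℕ => (2 * (n:ℝ) - c) / (n - c)) atTop (nhds 2) := by
  have h1 := (inv_n_tendsto c).const_sub 2
  have h2 := (inv_n_tendsto c).const_sub 1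
  have h3 := h1.div h2 (by norm_num)
  simp only [sub_zero, div_one] at h3
  refine h3.congr' ?_
  filter_upwards [eventually_ge_atTop 1] with n hn
  have h1 : (n:ℝ) ≠ 0 := by positivity
  rw [Pi.div_apply, ← mul_div_mul_right _ _ h1]
  congr 1 <;> field_simp

lemma eta_ratio2 : Tendsto (fun n : ℕ => (4 * (n:ℝ) - 2) / (n - 1)) atTop (nhds 4) := by
  have h := (eta_ratio 1).const_mul 2
  norm_num at h
  refine h.congr fun n => ?_
  ring

lemma eta_ge {d : ℕ} (hd : 1 ≤ d) {ρ : ℝ} (hρ : 0 < ρ) {ηlim : ℝ}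
    (hη : Tendsto (fun n : ℕ => etaS d n ρ) atTop (nhds ηlim)) :
    (1 + kappa d + 4 * 1) * Real.sqrt (1 + 3 * (3 ^ d * phi d ρ) + (3 ^ d * phi d ρ) ^ 2) ≤
      Real.sqrt ηlim := by
  have hφ := phi_pos d hρ
  have hk : (2:ℝ) ≤ kappa d := by exact_mod_cast kappa_ge hd
  have h2 : Tendsto (fun n : ℕ => etaS d n ρ) atTop (nhds (2 * (1 + 2 * (kappa d : ℝ)) ^ 2 *
      (1 + (2 ^ d + 1) * 3 ^ d * phi d ρ + 2 * 9 ^ d * phi d ρ ^ 2) +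
    (((1 : ℝ) + kappa d) ^ 2 / 2) *
      ((2 ^ d + 2 * 3 ^ d + 3) * phi d ρ + (2 ^ (d + 1) + 1) * 2 * phi d ρ ^ 2 + 4))) := by
    unfold etaS
    exact ((((((eta_ratio _).mul_const _).mul_const _).const_add _)).const_mul _).add
      ((((((eta_ratio _).const_mul _).mul_const _).const_add _).add eta_ratio2).const_mul _)
  have e := tendsto_nhds_unique hη h2
  set k : ℝ := (kappa d : ℝ)
  set φ := phi d ρ
  rw [← Real.sqrt_sq (show 0 ≤ 1 + k + 4 * 1 by linarith), ← Real.sqrt_mul (sq_nonneg _)]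
  apply Real.sqrt_le_sqrt
  rw [e]
  have h9 : (9:ℝ) ^ d * φ ^ 2 = (3 ^ d * φ) ^ 2 := by
    rw [mul_pow, ← pow_mul, mul_comm d 2, pow_mul]; norm_num
  have h2d : (2:ℝ) ≤ 2 ^ d := by
    calc (2:ℝ) = 2 ^ 1 := by norm_num
      _ ≤ 2 ^ d := pow_le_pow_right₀ (by norm_num) hd
  have hx : 0 < 3 ^ d * φ := by positivity
  have hpos : 0 ≤ (((1 : ℝ) + k) ^ 2 / 2) *
      ((2 ^ d + 2 * 3 ^ d + 3) * φ + (2 ^ (d + 1) + 1) * 2 * φ ^ 2 + 4) := by positivity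
  have h1 : (1 + k + 4 * 1) ^ 2 ≤ 2 * (1 + 2 * k) ^ 2 := by nlinarith
  have h3 : 1 + 3 * (3 ^ d * φ) + (3 ^ d * φ) ^ 2 ≤
      1 + (2 ^ d + 1) * 3 ^ d * φ + 2 * 9 ^ d * φ ^ 2 := by
    rw [mul_assoc 2, h9, mul_assoc (2 ^ d + 1 : ℝ)]
    nlinarith [sq_nonneg (3 ^ d * φ)]
  have h4 : (1 + k + 4 * 1) ^ 2 * (1 + 3 * (3 ^ d * φ) + (3 ^ d * φ) ^ 2) ≤
      2 * (1 + 2 * k) ^ 2 * (1 + (2 ^ d + 1) * 3 ^ d * φ + 2 * 9 ^ d * φ ^ 2) := by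
    gcongr
  linarith

lemma fin_alg {E k g s D c : ℝ} (hE : 0 ≤ E) (hk : 0 ≤ k) (hg : 0 < g)
    (hc : c = E * k ^ 2 / (2 * (g * Real.sqrt g))) (hs : 0 ≤ s) (hD : D ≤ E / g * s) :
    (Real.sqrt (0.8 * c) + Real.sqrt (4.4 * c + D)) ^ 2 ≤
    E / (5 * g) * (Real.sqrt (11 * k ^ 2 / Real.sqrt g + 5 * s) + 2 * k / g ^ ((1:ℝ)/4)) ^ 2 := by
  have hsg : 0 < Real.sqrt g := Real.sqrt_pos.2 hg
  have h4 : g ^ ((1:ℝ)/4) = Real.sqrt (Real.sqrt g) := by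
    rw [Real.sqrt_eq_rpow, Real.sqrt_eq_rpow, ← Real.rpow_mul hg.le]; norm_num
  have hc0 : 0 ≤ c := by rw [hc]; positivity
  have hF : 0 ≤ E / (5 * g) := by positivity
  have e1 : 2 * k / g ^ ((1:ℝ)/4) = Real.sqrt (4 * k ^ 2 / Real.sqrt g) := by
    rw [h4, Real.sqrt_div (by positivity), show 4 * k ^ 2 = (2 * k) ^ 2 by ring,
      Real.sqrt_sq (by positivity)]
  rw [e1]
  have e2 : ∀ a b : ℝ, E / (5 * g) * (Real.sqrt a + Real.sqrt b) ^ 2 =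
      (Real.sqrt (E / (5 * g) * a) + Real.sqrt (E / (5 * g) * b)) ^ 2 := by
    intro a b
    rw [Real.sqrt_mul hF, Real.sqrt_mul hF, ← mul_add, mul_pow, Real.sq_sqrt hF]
  rw [e2]
  have e3 : E / (5 * g) * (4 * k ^ 2 / Real.sqrt g) = 1.6 * c := by
    rw [hc]; field_simp; ring
  have e4 : E / (5 * g) * (11 * k ^ 2 / Real.sqrt g + 5 * s) = 4.4 * c + E / g * s := by
    rw [hc]; field_simp; ring
  rw [e3, e4, add_comm]
  gcongr
  norm_num

lemma limsup_core {d : ℕ} (hd : 1 ≤ d) {ρ : ℝ} (hρ : 0 < ρ) {ηlim : ℝ}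
    (hη : Tendsto (fun n : ℕ => etaS d n ρ) atTop (nhds ηlim)) :
    limsup (fun n : ℕ => Real.sqrt n * kolDist (binppLaw d n) (isolCount d n ρ)) atTop ≤
      (1 - Real.exp (-phi d ρ)) / (5 * gS d ρ) *
        (Real.sqrt (11 * ((1 : ℝ) + kappa d) ^ 2 / Real.sqrt (gS d ρ) + 5 * Real.sqrt ηlim) +
          2 * ((1 : ℝ) + kappa d) / gS d ρ ^ ((1 : ℝ) / 4)) ^ 2 := by
  have hg := gS_pos hd hρ
  have hφ := phi_pos d hρ
  have hE : 0 ≤ 1 - Real.exp (-phi d ρ) := by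
    rw [sub_nonneg, Real.exp_le_one_iff]; linarith
  have ht := ((((cn_tendsto hd hρ).const_mul 0.8).sqrt).add
    ((((cn_tendsto hd hρ).const_mul 4.4).add (Dn_tendsto hd hρ)).sqrt)).pow 2
  have hfin := fin_alg (k := 1 + kappa d) hE (by positivity) hg rfl (Real.sqrt_nonneg ηlim)
    (D := (1 - Real.exp (-phi d ρ)) / gS d ρ * ((1 + kappa d + 4 * 1) *
      Real.sqrt (1 + 3 * (3 ^ d * phi d ρ) + (3 ^ d * phi d ρ) ^ 2) + 0)) (by
      rw [add_zero]
      exact mul_le_mul_of_nonneg_left (eta_ge hd hρ hη) (by positivity))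
  refine le_trans ?_ hfin
  rw [← ht.limsup_eq]
  refine limsup_le_limsup (main_bound hd hρ) ?_ ht.isBoundedUnder_le
  refine isCoboundedUnder_le_of_le atTop (x := 0) fun n => ?_
  refine mul_nonneg (Real.sqrt_nonneg _) ?_
  unfold kolDist
  exact Real.iSup_nonneg fun t => abs_nonneg _

/-- (3.6) of Theorem 2.3: asymptotic upper bound on `n^{1/2} D_S`, where
`η_S(ρ) := lim_{n→∞} η_S(n,ρ)`. -/
theorem limsup_kolDist_isolCount (d : ℕ) (hd : 1 ≤ d) (ρ : ℝ) (hρ : 0 < ρ)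
    (ηlim : ℝ) (hη : Tendsto (fun n : ℕ => etaS d n ρ) atTop (nhds ηlim)) :
    limsup (fun n : ℕ => Real.sqrt n * kolDist (binppLaw d n) (isolCount d n ρ)) atTop ≤
      (1 - Real.exp (-phi d ρ)) / (5 * gS d ρ) *
        (Real.sqrt (11 * ((1 : ℝ) + kappa d) ^ 2 / Real.sqrt (gS d ρ) +
              5 * Real.sqrt ηlim) +
            2 * ((1 : ℝ) + kappa d) / gS d ρ ^ ((1 : ℝ) / 4)) ^ 2 :=
  limsup_core hd hρ hη

end
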